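/- For every α > 0 and k, s, t ∈ ℕ, there exists C = C(k, s, t, α) > 0 such that the following holds for every d ∈ [k−1]. Let F be a strictly 1-balanced k-graph on s vertices with t edges, and let H = {H_1, …, H_{tn}} be any k-graph system on sn vertices with δ_d(H) ≥ (δ_{F,d}^T + α)·binom(sn−d, k−d). If p ≥ C·n^{−1/d_1(F) − 1}·(log n)^{1/t}, then with high probability the random sparsification H(p) = {H_1(p), …, H_{tn}(p)} contains a transversal F-factor. -/

import Mathlib

/-- A transversal `F`-factor of the `k`-graph system `Hs` on `s*n` vertices:
`n` pairwise vertex-disjoint copies of `F` (hence covering all vertices), whose copies of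
edges use exactly one edge from each member of the system. -/
def IsTransversalFFactor {s t n : ℕ} (F : Finset (Finset (Fin s)))
    (Hs : Fin (t * n) → Finset (Finset (Fin (s * n)))) : Prop :=
  ∃ φ : Fin n → Fin s → Fin (s * n),
    (∀ j, Function.Injective (φ j)) ∧
    (∀ j j' : Fin n, j ≠ j' → ∀ a b, φ j a ≠ φ j' b) ∧
    ∃ c : Fin n × {e // e ∈ F} → Fin (t * n),
      Function.Bijective c ∧
      ∀ (j : Fin n) (e : {e // e ∈ F}), Finset.image (φ j) e.1 ∈ Hs (c (j, e))

/-- The Dirac threshold `δ_{F,d}^T` for transversal `F`-factors in `k`-graph systems. -/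
noncomputable def transversalDiracThreshold (k s t d : ℕ) (F : Finset (Finset (Fin s))) : ℝ :=
  sInf {δ : ℝ | 0 < δ ∧ ∀ α : ℝ, 0 < α → ∃ n₀ : ℕ, ∀ n : ℕ, n₀ ≤ n →
    ∀ Hs : Fin (t * n) → Finset (Finset (Fin (s * n))),
      (∀ i, ∀ e ∈ Hs i, e.card = k) →
      (∀ i (D : Finset (Fin (s * n))), D.card = d →
        (δ + α) * ((s * n - d).choose (k - d) : ℝ) ≤
          (((Hs i).filter fun e => D ⊆ e).card : ℝ)) →
      IsTransversalFFactor F Hs}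

/-- `F` is strictly 1-balanced: every proper subgraph `(W, E')` with at least two vertices
has 1-density strictly smaller than `d₁(F)`. -/
def StrictlyOneBalanced {V : Type*} [Fintype V] [DecidableEq V]
    (F : Finset (Finset V)) : Prop :=
  ∀ (W : Finset V) (E' : Finset (Finset V)),
    E' ⊆ F → (∀ e ∈ E', e ⊆ W) → 2 ≤ W.card →
    (W ≠ Finset.univ ∨ E' ≠ F) →
    (E'.card : ℝ) / ((W.card : ℝ) - 1) < (F.card : ℝ) / ((Fintype.card V : ℝ) - 1)

/-- The 1-density `d₁(F) = e(F)/(|V(F)|-1)`. -/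
noncomputable def oneDensity {V : Type*} [Fintype V] (F : Finset (Finset V)) : ℝ :=
  (F.card : ℝ) / ((Fintype.card V : ℝ) - 1)

open Classical in
/-- The probability that the independent random sparsification (each edge of each `Hs i`
kept independently with probability `p`) satisfies the event `E`. -/
noncomputable def sysSparsProb {M : ℕ} {V : Type*} [DecidableEq V]
    (Hs : Fin M → Finset (Finset V)) (p : ℝ)
    (E : (Fin M → Finset (Finset V)) → Prop) : ℝ :=
  ∑ σ ∈ Fintype.piFinset (fun i => (Hs i).powerset),
    if E σ then ∏ i, p ^ (σ i).card * (1 - p) ^ ((Hs i).card - (σ i).card) else 0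

set_option linter.unusedSectionVars false

/-- The weight of `G` as a `p`-random subset of `H`. -/
noncomputable def subsetWeight {X : Type*} (p : ℝ) (H G : Finset X) : ℝ :=
  p ^ G.card * (1 - p) ^ (H.card - G.card)

section RandomSubset

variable {X : Type*}

lemma subsetWeight_nonneg {p : ℝ} (h0 : 0 ≤ p) (h1 : p ≤ 1) (H G : Finset X) :
    0 ≤ subsetWeight p H G :=
  mul_nonneg (pow_nonneg h0 _) (pow_nonneg (by linarith) _)

lemma sum_subsetWeight (p : ℝ) (H : Finset X) :
    ∑ G ∈ H.powerset, subsetWeight p H G = 1 := by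
  unfold subsetWeight
  rw [Finset.sum_pow_mul_eq_add_pow]
  simp

variable [DecidableEq X]

lemma sum_subsetWeight_insert (p : ℝ) {H : Finset X} {x : X} (hx : x ∉ H)
    (f : Finset X → ℝ) :
    ∑ G ∈ (insert x H).powerset, subsetWeight p (insert x H) G * f G =
      (1 - p) * ∑ G ∈ H.powerset, subsetWeight p H G * f G +
        p * ∑ G ∈ H.powerset, subsetWeight p H G * f (insert x G) := by
  rw [Finset.sum_powerset_insert hx, Finset.mul_sum, Finset.mul_sum]
  congr 1
  · refine Finset.sum_congr rfl fun G hG => ?_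
    have hle := Finset.card_le_card (Finset.mem_powerset.1 hG)
    unfold subsetWeight
    rw [Finset.card_insert_of_notMem hx, Nat.sub_add_comm hle, pow_succ]
    ring
  · refine Finset.sum_congr rfl fun G hG => ?_
    have hxG : x ∉ G := fun h => hx (Finset.mem_powerset.1 hG h)
    unfold subsetWeight
    rw [Finset.card_insert_of_notMem hx, Finset.card_insert_of_notMem hxG, pow_succ,
      Nat.add_sub_add_right]
    ring

lemma mul_sum_subsetWeight_insert_le {p : ℝ} (h0 : 0 ≤ p) (h1 : p ≤ 1) {H : Finset X} {x : X}
    (hx : x ∈ H) (f : Finset X → ℝ) (hf : ∀ G, 0 ≤ f G) :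
    p * ∑ G ∈ H.powerset, subsetWeight p H G * f (insert x G) ≤
      ∑ G ∈ H.powerset, subsetWeight p H G * f G := by
  obtain ⟨H', hx', rfl⟩ : ∃ H', x ∉ H' ∧ insert x H' = H :=
    ⟨H.erase x, Finset.notMem_erase x H, Finset.insert_erase hx⟩
  rw [sum_subsetWeight_insert p hx' f, sum_subsetWeight_insert p hx' fun G => f (insert x G)]
  simp only [Finset.insert_idem]
  have : 0 ≤ ∑ G ∈ H'.powerset, subsetWeight p H' G * f G :=
    Finset.sum_nonneg fun G _ => mul_nonneg (subsetWeight_nonneg h0 h1 _ _) (hf G)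
  nlinarith

lemma pow_mul_sum_subsetWeight_union_le {p : ℝ} (h0 : 0 ≤ p) (h1 : p ≤ 1) {H : Finset X}
    (Y : Finset X) (hY : Y ⊆ H) (f : Finset X → ℝ) (hf : ∀ G, 0 ≤ f G) :
    p ^ Y.card * ∑ G ∈ H.powerset, subsetWeight p H G * f (G ∪ Y) ≤
      ∑ G ∈ H.powerset, subsetWeight p H G * f G := by
  induction Y using Finset.induction_on generalizing f with
  | empty => simp
  | insert x Y hx ih =>
    rw [Finset.insert_subset_iff] at hY
    rw [Finset.card_insert_of_notMem hx, pow_succ, mul_assoc]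
    refine le_trans ?_ (ih hY.2 f hf)
    refine mul_le_mul_of_nonneg_left ?_ (pow_nonneg h0 _)
    have := mul_sum_subsetWeight_insert_le h0 h1 hY.1 (fun G => f (G ∪ Y)) fun G => hf _
    simpa [Finset.insert_union, Finset.union_insert] using this

open Classical in
lemma sum_subsetWeight_superset (p : ℝ) {H : Finset X} (Y : Finset X) (hY : Y ⊆ H) :
    ∑ G ∈ H.powerset, subsetWeight p H G * (if Y ⊆ G then 1 else 0) = p ^ Y.card := by
  induction Y using Finset.induction_on generalizing H with
  | empty => simp [sum_subsetWeight]
  | insert x Y hx ih =>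
    rw [Finset.insert_subset_iff] at hY
    obtain ⟨H', hx', rfl⟩ : ∃ H', x ∉ H' ∧ insert x H' = H :=
      ⟨H.erase x, Finset.notMem_erase x H, Finset.insert_erase hY.1⟩
    have hY' : Y ⊆ H' := fun y hy => by
      rcases Finset.mem_insert.1 (hY.2 hy) with rfl | h
      · exact absurd hy hx
      · exact h
    rw [sum_subsetWeight_insert p hx', Finset.card_insert_of_notMem hx, pow_succ, ← ih hY']
    rw [Finset.sum_eq_zero, mul_zero, zero_add, mul_comm]
    · congr 1
      refine Finset.sum_congr rfl fun G _ => ?_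
      congr 2
      rw [eq_iff_iff]
      constructor
      · intro h y hy
        rcases Finset.mem_insert.1 (h (Finset.mem_insert_of_mem hy)) with rfl | h
        · exact absurd hy hx
        · exact h
      · exact Finset.insert_subset_insert x
    · intro G hG
      rw [if_neg, mul_zero]
      intro h
      exact hx' (Finset.mem_powerset.1 hG (h (Finset.mem_insert_self x Y)))

lemma sum_subsetWeight_mono {p q : ℝ} (h0 : 0 ≤ p) (hpq : p ≤ q) (h1 : q ≤ 1) (H : Finset X)
    (f : Finset X → ℝ) (hf : Monotone f) :
    ∑ G ∈ H.powerset, subsetWeight p H G * f G ≤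
      ∑ G ∈ H.powerset, subsetWeight q H G * f G := by
  induction H using Finset.induction_on generalizing f with
  | empty => simp [subsetWeight]
  | insert x H hx ih =>
    rw [sum_subsetWeight_insert p hx, sum_subsetWeight_insert q hx]
    have e1 := ih f hf
    have e2 := ih (fun G => f (insert x G))
      fun G G' h => hf (Finset.insert_subset_insert x h)
    have e3 : ∑ G ∈ H.powerset, subsetWeight q H G * f G ≤
        ∑ G ∈ H.powerset, subsetWeight q H G * f (insert x G) :=
      Finset.sum_le_sum fun G _ => mul_le_mul_of_nonneg_left (hf (Finset.subset_insert x G))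
        (subsetWeight_nonneg (h0.trans hpq) h1 _ _)
    nlinarith

end RandomSubset

section RandomColouring

variable {Z A : Type*} [Fintype Z] [DecidableEq Z] [Fintype A]

lemma sum_prod_colouring (u : A → ℝ) (hu : ∑ a, u a = 1) :
    ∑ c : Z → A, ∏ z, u (c z) = 1 := by
  have := Fintype.prod_sum (fun (_ : Z) (a : A) => u a)
  rw [← this]
  simp [hu]

lemma mul_sum_colouring_update_le (u : A → ℝ) (hu0 : ∀ a, 0 ≤ u a) (hu : ∑ a, u a = 1)
    (z : Z) (a : A) (f : (Z → A) → ℝ) (hf : ∀ c, 0 ≤ f c) :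
    u a * ∑ c : Z → A, (∏ y, u (c y)) * f (Function.update c z a) ≤
      ∑ c : Z → A, (∏ y, u (c y)) * f c := by
  have key : ∀ g : (Z → A) → ℝ, ∑ c : Z → A, (∏ y, u (c y)) * g c =
      ∑ r : {y // y ≠ z} → A, (∏ y, u (r y)) *
        ∑ b, u b * g ((Equiv.funSplitAt z A).symm (b, r)) := by
    intro g
    rw [← (Equiv.funSplitAt z A).symm.sum_comp, Fintype.sum_prod_type_right]
    refine Finset.sum_congr rfl fun r _ => ?_
    rw [Finset.mul_sum]
    refine Finset.sum_congr rfl fun b _ => ?_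
    rw [← mul_assoc]
    congr 1
    rw [Fintype.prod_eq_mul_prod_subtype_ne _ z, mul_comm]
    congr 1
    · refine Finset.prod_congr rfl fun y _ => ?_
      simp [Equiv.funSplitAt, Equiv.piSplitAt, y.2]
    · simp [Equiv.funSplitAt, Equiv.piSplitAt]
  rw [key, key, Finset.mul_sum]
  refine Finset.sum_le_sum fun r _ => ?_
  have h1 : ∀ b, Function.update ((Equiv.funSplitAt z A).symm (b, r)) z a =
      (Equiv.funSplitAt z A).symm (a, r) := by
    intro b
    ext y
    by_cases hy : y = z
    · subst hy; simp [Equiv.funSplitAt, Equiv.piSplitAt]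
    · simp [Equiv.funSplitAt, Equiv.piSplitAt, hy]
  simp only [h1, ← Finset.sum_mul, hu, one_mul]
  rw [mul_left_comm]
  refine mul_le_mul_of_nonneg_left ?_ (Finset.prod_nonneg fun _ _ => hu0 _)
  exact Finset.single_le_sum (f := fun b => u b * f ((Equiv.funSplitAt z A).symm (b, r)))
    (fun b _ => mul_nonneg (hu0 b) (hf _)) (Finset.mem_univ a)

lemma prod_mul_sum_colouring_piecewise_le (u : A → ℝ) (hu0 : ∀ a, 0 ≤ u a) (hu : ∑ a, u a = 1)
    (Y : Finset Z) (g : Z → A) (f : (Z → A) → ℝ) (hf : ∀ c, 0 ≤ f c) :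
    (∏ z ∈ Y, u (g z)) * ∑ c : Z → A, (∏ y, u (c y)) * f (Y.piecewise g c) ≤
      ∑ c : Z → A, (∏ y, u (c y)) * f c := by
  induction Y using Finset.induction_on generalizing f with
  | empty => simp
  | insert x Y hx ih =>
    rw [Finset.prod_insert hx, mul_comm (u (g x)), mul_assoc]
    simp only [Finset.piecewise_insert]
    have h2 := mul_sum_colouring_update_le u hu0 hu x (g x)
      (fun c => f (Y.piecewise g c)) fun c => hf _
    have h3 : ∀ c : Z → A, Y.piecewise g (Function.update c x (g x)) =
        Function.update (Y.piecewise g c) x (g x) := by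
      intro c
      rw [Finset.update_piecewise_of_notMem _ _ _ hx]
    simp only [h3] at h2
    refine le_trans ?_ (ih f hf)
    exact mul_le_mul_of_nonneg_left h2 (Finset.prod_nonneg fun _ _ => hu0 _)

end RandomColouring

section Fragments

variable {Z : Type*} [DecidableEq Z]

lemma sdiff_subset_iff' {s t u : Finset Z} : s \ t ⊆ u ↔ s ⊆ t ∪ u := by
  simp only [Finset.subset_iff, Finset.mem_sdiff, Finset.mem_union]
  exact forall_congr' fun x => by tauto

/-- `B` minimises the part of `ψ B` outside `W` among the members of `𝓕` whose fragment has
size at most `l` and is contained in `ψ S ∪ W`. -/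
def IsMinFragment (𝓕 : Finset (Finset Z)) (W : Finset Z) (l : ℕ) (ψ : Finset Z → Finset Z)
    (S B : Finset Z) : Prop :=
  (B ∈ 𝓕 ∧ (ψ B).card ≤ l ∧ ψ B ⊆ ψ S ∪ W) ∧
    ∀ B' ∈ 𝓕, (ψ B').card ≤ l → ψ B' ⊆ ψ S ∪ W → (ψ B \ W).card ≤ (ψ B' \ W).card

open Classical in
/-- The minimum fragment of `S` left after exposing `W`. -/
noncomputable def fragStep (𝓕 : Finset (Finset Z)) (W : Finset Z) (l : ℕ)
    (ψ : Finset Z → Finset Z) (S : Finset Z) : Finset Z :=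
  if h : ∃ B, IsMinFragment 𝓕 W l ψ S B then ψ h.choose \ W else ψ S

lemma exists_isMinFragment {𝓕 : Finset (Finset Z)} {W : Finset Z} {l : ℕ}
    {ψ : Finset Z → Finset Z} {S : Finset Z} (hS : S ∈ 𝓕) (hl : (ψ S).card ≤ l) :
    ∃ B, IsMinFragment 𝓕 W l ψ S B := by
  classical
  obtain ⟨B, hB, hmin⟩ := Finset.exists_min_image
    (𝓕.filter fun B => (ψ B).card ≤ l ∧ ψ B ⊆ ψ S ∪ W) (fun B => (ψ B \ W).card)
    ⟨S, by simp [hS, hl]⟩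
  rw [Finset.mem_filter] at hB
  exact ⟨B, hB, fun B' h1 h2 h3 => hmin B' (Finset.mem_filter.2 ⟨h1, h2, h3⟩)⟩

lemma exists_fragStep_eq {𝓕 : Finset (Finset Z)} {W : Finset Z} {l : ℕ}
    {ψ : Finset Z → Finset Z} {S : Finset Z} (hS : S ∈ 𝓕) (hl : (ψ S).card ≤ l) :
    ∃ B, IsMinFragment 𝓕 W l ψ S B ∧ fragStep 𝓕 W l ψ S = ψ B \ W := by
  have h := exists_isMinFragment (W := W) hS hl
  exact ⟨h.choose, h.choose_spec, by rw [fragStep, dif_pos h]⟩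

lemma fragStep_subset (𝓕 : Finset (Finset Z)) (W : Finset Z) (l : ℕ)
    (ψ : Finset Z → Finset Z) (S : Finset Z) : fragStep 𝓕 W l ψ S ⊆ ψ S := by
  rw [fragStep]
  split_ifs with h
  · rw [sdiff_subset_iff', Finset.union_comm]
    exact h.choose_spec.1.2.2
  · exact Finset.Subset.refl _

lemma disjoint_fragStep {𝓕 : Finset (Finset Z)} {W : Finset Z} {l : ℕ}
    {ψ : Finset Z → Finset Z} {S : Finset Z} (hS : S ∈ 𝓕) (hl : (ψ S).card ≤ l) :
    Disjoint (fragStep 𝓕 W l ψ S) W := by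
  obtain ⟨B, -, h⟩ := exists_fragStep_eq (W := W) hS hl
  rw [h]
  exact Finset.sdiff_disjoint

open Classical in
/-- A canonical fragment of size at most `l` contained in `W`. -/
noncomputable def coveredFragment (𝓕 : Finset (Finset Z)) (W : Finset Z) (l : ℕ)
    (ψ : Finset Z → Finset Z) : Finset Z :=
  if h : ∃ B ∈ 𝓕, (ψ B).card ≤ l ∧ ψ B ⊆ W then ψ h.choose else ∅

lemma card_coveredFragment_le (𝓕 : Finset (Finset Z)) (W : Finset Z) (l : ℕ)
    (ψ : Finset Z → Finset Z) : (coveredFragment 𝓕 W l ψ).card ≤ l := by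
  rw [coveredFragment]
  split_ifs with h
  · exact h.choose_spec.2.1
  · simp

lemma fragStep_subset_coveredFragment {𝓕 : Finset (Finset Z)} {W : Finset Z} {l : ℕ}
    {ψ : Finset Z → Finset Z} {S : Finset Z} (hS : S ∈ 𝓕) (hl : (ψ S).card ≤ l) :
    fragStep 𝓕 W l ψ S ⊆ coveredFragment 𝓕 (W ∪ fragStep 𝓕 W l ψ S) l ψ := by
  obtain ⟨B, hB, hT⟩ := exists_fragStep_eq (W := W) hS hl
  have hsub := fragStep_subset 𝓕 W l ψ S
  set T := fragStep 𝓕 W l ψ S with hTdef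
  have h : ∃ B ∈ 𝓕, (ψ B).card ≤ l ∧ ψ B ⊆ W ∪ T := by
    refine ⟨B, hB.1.1, hB.1.2.1, ?_⟩
    rw [hT]
    exact fun x hx => by by_cases hxW : x ∈ W <;> simp [hx, hxW]
  rw [coveredFragment, dif_pos h]
  obtain ⟨h1, h2, h3⟩ := h.choose_spec
  set B' := h.choose
  have hle := hB.2 B' h1 h2 (h3.trans (by
    rw [Finset.union_comm]
    exact Finset.union_subset_union hsub (Finset.Subset.refl _)))
  rw [← hT] at hle
  have hsub' : ψ B' \ W ⊆ T := by rwa [sdiff_subset_iff']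
  have := Finset.eq_of_subset_of_card_le hsub' hle
  rw [← this]
  exact Finset.sdiff_subset

/-- The fragments obtained by exposing `W 0, W 1, …` in turn. -/
noncomputable def fragments (𝓕 : Finset (Finset Z)) (W : ℕ → Finset Z) (l : ℕ → ℕ) :
    ℕ → Finset Z → Finset Z
  | 0 => id
  | r + 1 => fragStep 𝓕 (W r) (l r) (fragments 𝓕 W l r)

lemma fragments_congr (𝓕 : Finset (Finset Z)) {W W' : ℕ → Finset Z} (l : ℕ → ℕ) (r : ℕ)
    (h : ∀ j < r, W j = W' j) : fragments 𝓕 W l r = fragments 𝓕 W' l r := by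
  induction r with
  | zero => rfl
  | succ r ih =>
    rw [fragments, fragments, ih fun j hj => h j (by omega), h r (by omega)]

lemma fragments_subset_of_le (𝓕 : Finset (Finset Z)) (W : ℕ → Finset Z) (l : ℕ → ℕ)
    {i j : ℕ} (hij : i ≤ j) (S : Finset Z) :
    fragments 𝓕 W l j S ⊆ fragments 𝓕 W l i S := by
  induction j, hij using Nat.le_induction with
  | base => exact Finset.Subset.refl _
  | succ j _ ih => exact (fragStep_subset _ _ _ _ _).trans ih

lemma fragments_subset (𝓕 : Finset (Finset Z)) (W : ℕ → Finset Z) (l : ℕ → ℕ)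
    (j : ℕ) (S : Finset Z) : fragments 𝓕 W l j S ⊆ S :=
  fragments_subset_of_le 𝓕 W l (Nat.zero_le j) S

lemma disjoint_fragments {𝓕 : Finset (Finset Z)} {W : ℕ → Finset Z} {l : ℕ → ℕ} {i j : ℕ}
    (hij : i < j) {S : Finset Z} (hS : S ∈ 𝓕) (hl : (fragments 𝓕 W l i S).card ≤ l i) :
    Disjoint (fragments 𝓕 W l j S) (W i) :=
  (disjoint_fragStep hS hl).mono_left (fragments_subset_of_le 𝓕 W l hij S)

lemma exists_subset_fragments_union {𝓕 : Finset (Finset Z)} (W : ℕ → Finset Z) (l : ℕ → ℕ)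
    (r : ℕ) {S : Finset Z} (hS : S ∈ 𝓕) :
    ∃ B ∈ 𝓕, B ⊆ fragments 𝓕 W l r S ∪ (Finset.range r).biUnion W := by
  induction r generalizing S with
  | zero => exact ⟨S, hS, by simp [fragments]⟩
  | succ r ih =>
    obtain ⟨B, hB, hsub⟩ : ∃ B ∈ 𝓕,
        fragments 𝓕 W l r B ⊆ fragments 𝓕 W l (r + 1) S ∪ W r := by
      rw [fragments, fragStep]
      split_ifs with h
      · exact ⟨h.choose, h.choose_spec.1.1, by
          rw [Finset.union_comm, ← sdiff_subset_iff']⟩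
      · exact ⟨S, hS, Finset.subset_union_left⟩
    obtain ⟨B', hB', hsub'⟩ := ih hB
    refine ⟨B', hB', fun x hx => ?_⟩
    have h1 := hsub' hx
    rw [Finset.range_add_one, Finset.biUnion_insert]
    rw [Finset.mem_union] at h1 ⊢
    rcases h1 with h1 | h1
    · rcases Finset.mem_union.1 (hsub h1) with h2 | h2
      · exact Or.inl h2
      · exact Or.inr (Finset.mem_union_left _ h2)
    · exact Or.inr (Finset.mem_union_right _ h1)

end Fragments

section Switching

open Classical in
/-- A first moment bound by switching: each event `(ω, S)` is charged to a set `T ω S ⊆ S`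
of size `w` that can be recovered, up to `2 ^ l` choices, from the switched outcome. -/
lemma sum_event_le_of_switching {Ω Z : Type*} [Fintype Z] [DecidableEq Z]
    (Ωs : Finset Ω) (P : Ω → ℝ) (hP : ∀ ω ∈ Ωs, 0 ≤ P ω) (hP1 : ∑ ω ∈ Ωs, P ω = 1)
    (𝓕 : Finset (Finset Z)) (μ : Finset Z → ℝ) (hμ : ∀ S, 0 ≤ μ S) {κ Λ : ℝ}
    (hκ : 0 ≤ κ) (hΛ : 0 ≤ Λ)
    (hspread : ∀ T, ∑ S ∈ 𝓕, (if T ⊆ S then μ S else 0) ≤ κ ^ T.card)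
    (l w : ℕ) (ev : Ω → Finset Z → Prop) [∀ ω S, Decidable (ev ω S)] (T : Ω → Finset Z → Finset Z)
    (sw : Ω → Finset Z → Ω) (ok : Ω → Finset Z → Prop) (B : Ω → Finset Z)
    (hT : ∀ ω ∈ Ωs, ∀ S ∈ 𝓕, ev ω S → T ω S ⊆ S ∧ (T ω S).card = w ∧ ok ω (T ω S) ∧
      T ω S ⊆ B (sw ω (T ω S)))
    (hB : ∀ ω, (B ω).card ≤ l)
    (hsw : ∀ (T : Finset Z) (h : Ω → ℝ), (∀ ω, 0 ≤ h ω) →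
      ∑ ω ∈ Ωs, P ω * (if ok ω T then h (sw ω T) else 0) ≤ Λ ^ T.card * ∑ ω ∈ Ωs, P ω * h ω) :
    ∑ ω ∈ Ωs, ∑ S ∈ 𝓕, (if ev ω S then P ω * μ S else 0) ≤ 2 ^ l * (Λ * κ) ^ w := by
  have step1 : ∀ ω ∈ Ωs, ∀ S ∈ 𝓕, (if ev ω S then P ω * μ S else 0) ≤
      ∑ U ∈ Finset.powersetCard w Finset.univ,
        P ω * (if ok ω U then (if U ⊆ B (sw ω U) then 1 else 0) else 0) *
          (if U ⊆ S then μ S else 0) := by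
    intro ω hω S hS
    have hnn : ∀ U ∈ Finset.powersetCard w (Finset.univ : Finset Z), 0 ≤
        P ω * (if ok ω U then (if U ⊆ B (sw ω U) then 1 else 0) else 0) *
          (if U ⊆ S then μ S else 0) := by
      intro U _
      have := hP ω hω
      have := hμ S
      split_ifs <;> simp <;> positivity
    split_ifs with hev
    · obtain ⟨h1, h2, h3, h4⟩ := hT ω hω S hS hev
      refine le_trans ?_ (Finset.single_le_sum hnn (a := T ω S) (by simp [h2]))
      simp [h1, h3, h4]
    · exact Finset.sum_nonneg hnn
  calc ∑ ω ∈ Ωs, ∑ S ∈ 𝓕, (if ev ω S then P ω * μ S else 0)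
      ≤ ∑ ω ∈ Ωs, ∑ S ∈ 𝓕, ∑ U ∈ Finset.powersetCard w Finset.univ,
        P ω * (if ok ω U then (if U ⊆ B (sw ω U) then 1 else 0) else 0) *
          (if U ⊆ S then μ S else 0) :=
        Finset.sum_le_sum fun ω hω => Finset.sum_le_sum fun S hS => step1 ω hω S hS
    _ = ∑ U ∈ Finset.powersetCard w Finset.univ,
        (∑ ω ∈ Ωs, P ω * (if ok ω U then (if U ⊆ B (sw ω U) then 1 else 0) else 0)) *
          ∑ S ∈ 𝓕, (if U ⊆ S then μ S else 0) := by
        simp_rw [Finset.sum_mul_sum]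
        rw [Finset.sum_comm]
        simp_rw [Finset.sum_comm (s := Ωs) (t := Finset.powersetCard w Finset.univ)]
        rw [Finset.sum_comm]
        refine Finset.sum_congr rfl fun U _ => ?_
        rw [Finset.sum_comm]
    _ ≤ ∑ U ∈ Finset.powersetCard w Finset.univ,
        (Λ ^ w * ∑ ω ∈ Ωs, P ω * (if U ⊆ B ω then 1 else 0)) * κ ^ w := by
        refine Finset.sum_le_sum fun U hU => ?_
        have hc := (Finset.mem_powersetCard.1 hU).2
        have h1 := hsw U (fun ω => if U ⊆ B ω then 1 else 0) fun ω => by split_ifs <;> simp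
        have h2 := hspread U
        rw [hc] at h1 h2
        refine mul_le_mul h1 h2 (Finset.sum_nonneg fun S _ => ?_) ?_
        · split_ifs
          · exact hμ S
          · exact le_rfl
        · refine mul_nonneg (pow_nonneg hΛ _) (Finset.sum_nonneg fun ω hω => ?_)
          refine mul_nonneg (hP ω hω) ?_
          split_ifs <;> simp
    _ = (Λ * κ) ^ w * ∑ ω ∈ Ωs, P ω *
          ∑ U ∈ Finset.powersetCard w Finset.univ, (if U ⊆ B ω then 1 else 0) := by
        simp_rw [Finset.mul_sum (s := Finset.powersetCard w Finset.univ)]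
        rw [Finset.sum_comm, Finset.mul_sum]
        refine Finset.sum_congr rfl fun U _ => ?_
        rw [mul_pow]
        ring
    _ ≤ (Λ * κ) ^ w * ∑ ω ∈ Ωs, P ω * 2 ^ l := by
        refine mul_le_mul_of_nonneg_left (Finset.sum_le_sum fun ω hω =>
          mul_le_mul_of_nonneg_left ?_ (hP ω hω)) (by positivity)
        rw [Finset.sum_boole]
        have : (Finset.powersetCard w (Finset.univ : Finset Z)).filter (fun U => U ⊆ B ω) ⊆
            (B ω).powerset := fun U hU =>
          Finset.mem_powerset.2 (Finset.mem_filter.1 hU).2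
        have := Finset.card_le_card this
        rw [Finset.card_powerset] at this
        calc _ ≤ ((2 ^ (B ω).card : ℕ) : ℝ) := by exact_mod_cast this
          _ ≤ 2 ^ l := by
            push_cast
            exact pow_le_pow_right₀ (by norm_num) (hB ω)
    _ = 2 ^ l * (Λ * κ) ^ w := by
        rw [← Finset.sum_mul, hP1]
        ring

variable {X Z : Type*} [DecidableEq X] [Fintype Z] [DecidableEq Z]

/-- The copies that become present, besides those in `T`, when the edges of `T` are added. -/
def extraCopies (edges : Z → Finset X) (G : Finset X) (T : Finset Z) : Finset Z :=
  Finset.univ.filter fun E => E ∉ T ∧ edges E ⊆ G ∪ T.biUnion edges ∧ ¬ edges E ⊆ G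

/-- The copies present in `G` of colour `r`. -/
def colourClass {N : ℕ} (edges : Z → Finset X) (ω : Finset X × (Z → Fin N)) (r : ℕ) :
    Finset Z :=
  Finset.univ.filter fun E => edges E ⊆ ω.1 ∧ (ω.2 E : ℕ) = r

/-- Add the edges of `T`, recolour `T` with `r` and the extra copies with the last colour. -/
def switchOutcome {N : ℕ} (edges : Z → Finset X) (r : Fin (N + 1))
    (ω : Finset X × (Z → Fin (N + 1))) (T : Finset Z) : Finset X × (Z → Fin (N + 1)) :=
  (ω.1 ∪ T.biUnion edges, (T ∪ extraCopies edges ω.1 T).piecewise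
    (fun E => if E ∈ T then r else Fin.last N) ω.2)

lemma mem_extraCopies {edges : Z → Finset X} {G : Finset X} {T : Finset Z} {E : Z} :
    E ∈ extraCopies edges G T ↔ E ∉ T ∧ edges E ⊆ G ∪ T.biUnion edges ∧ ¬ edges E ⊆ G := by
  simp [extraCopies]

lemma mem_colourClass {N : ℕ} {edges : Z → Finset X} {ω : Finset X × (Z → Fin N)} {r : ℕ}
    {E : Z} : E ∈ colourClass edges ω r ↔ edges E ⊆ ω.1 ∧ (ω.2 E : ℕ) = r := by
  simp [colourClass]

lemma colourClass_switchOutcome_of_ne {N : ℕ} (edges : Z → Finset X) {r : Fin (N + 1)}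
    (ω : Finset X × (Z → Fin (N + 1))) (T : Finset Z) {j : ℕ} (hj : j < N) (hjr : j ≠ r)
    (hT : Disjoint T (colourClass edges ω j)) :
    colourClass edges (switchOutcome edges r ω T) j = colourClass edges ω j := by
  ext E
  have hE : E ∈ T → ¬ (edges E ⊆ ω.1 ∧ (ω.2 E : ℕ) = j) := fun h1 h2 =>
    Finset.disjoint_left.1 hT h1 (mem_colourClass.2 h2)
  rw [mem_colourClass, mem_colourClass]
  simp only [switchOutcome]
  by_cases h1 : E ∈ T
  · have := hE h1
    simp only [Finset.piecewise, Finset.mem_union, h1, true_or, if_true]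
    constructor
    · rintro ⟨-, h⟩
      exact absurd h.symm hjr
    · intro h
      exact absurd h this
  · by_cases h2 : E ∈ extraCopies edges ω.1 T
    · simp only [Finset.piecewise, Finset.mem_union, h1, h2, or_true, if_true, if_false,
        Fin.val_last]
      rw [mem_extraCopies] at h2
      constructor
      · rintro ⟨-, h⟩
        omega
      · rintro ⟨h, -⟩
        exact absurd h h2.2.2
    · simp only [Finset.piecewise, Finset.mem_union, h1, h2, or_self, if_false]
      simp only [mem_extraCopies, h1,
        not_false_eq_true, not_and, not_not] at h2
      constructor
      · rintro ⟨h, h'⟩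
        exact ⟨h2 trivial h, h'⟩
      · rintro ⟨h, hc⟩
        exact ⟨h.trans Finset.subset_union_left, hc⟩

lemma colourClass_switchOutcome_self {N : ℕ} (edges : Z → Finset X) {r : Fin (N + 1)}
    (hr : (r : ℕ) < N) (ω : Finset X × (Z → Fin (N + 1))) (T : Finset Z) :
    colourClass edges (switchOutcome edges r ω T) r = colourClass edges ω r ∪ T := by
  ext E
  rw [Finset.mem_union, mem_colourClass, mem_colourClass]
  simp only [switchOutcome]
  by_cases h1 : E ∈ T
  · simp only [Finset.piecewise, Finset.mem_union, h1, true_or, if_true, or_true, and_true,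
      iff_true]
    exact (Finset.subset_biUnion_of_mem edges h1).trans Finset.subset_union_right
  · by_cases h2 : E ∈ extraCopies edges ω.1 T
    · simp only [Finset.piecewise, Finset.mem_union, h1, h2, or_true, if_true, if_false,
        Fin.val_last, or_false]
      rw [mem_extraCopies] at h2
      constructor
      · rintro ⟨-, h⟩
        omega
      · rintro ⟨h, -⟩
        exact absurd h h2.2.2
    · simp only [Finset.piecewise, Finset.mem_union, h1, h2, or_self, if_false, or_false]
      simp only [mem_extraCopies, h1,
        not_false_eq_true, not_and, not_not] at h2
      constructor
      · rintro ⟨h, h'⟩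
        exact ⟨h2 trivial h, h'⟩
      · rintro ⟨h, hc⟩
        exact ⟨h.trans Finset.subset_union_left, hc⟩

/-- The joint weight of a random edge set and a random colouring of the copies. -/
noncomputable def outcomeWeight {N : ℕ} (p : ℝ) (H : Finset X) (u : Fin (N + 1) → ℝ)
    (ω : Finset X × (Z → Fin (N + 1))) : ℝ :=
  subsetWeight p H ω.1 * ∏ E, u (ω.2 E)

open Classical in
lemma sum_outcomeWeight_switchOutcome_le {N : ℕ} {p : ℝ} (h0 : 0 < p) (h1 : p ≤ 1)
    (H : Finset X) (u : Fin (N + 1) → ℝ) (hu0 : ∀ a, 0 < u a) (hu : ∑ a, u a = 1)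
    (edges : Z → Finset X) {t : ℕ} (ht : ∀ E, (edges E).card ≤ t) (M : ℕ) (r : Fin (N + 1))
    (T : Finset Z) (hTH : T.biUnion edges ⊆ H)
    (h : Finset X × (Z → Fin (N + 1)) → ℝ) (hh : ∀ ω, 0 ≤ h ω) :
    ∑ ω ∈ H.powerset ×ˢ (Finset.univ : Finset (Z → Fin (N + 1))), outcomeWeight p H u ω *
        (if (extraCopies edges ω.1 T).card ≤ M * T.card then h (switchOutcome edges r ω T)
          else 0) ≤
      (p ^ t * (u r * u (Fin.last N) ^ M))⁻¹ ^ T.card *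
        ∑ ω ∈ H.powerset ×ˢ (Finset.univ : Finset (Z → Fin (N + 1))),
          outcomeWeight p H u ω * h ω := by
  have hul : u (Fin.last N) ≤ 1 := by
    rw [← hu]
    exact Finset.single_le_sum (fun a _ => (hu0 a).le) (Finset.mem_univ _)
  set Y := T.biUnion edges with hY
  have hc0 : 0 < u r * u (Fin.last N) ^ M := mul_pos (hu0 _) (pow_pos (hu0 _) _)
  have hYc : Y.card ≤ t * T.card := by
    rw [mul_comm]
    exact Finset.card_biUnion_le_card_mul _ _ _ fun E _ => ht E
  rw [Finset.sum_product, Finset.sum_product]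
  have inner : ∀ G ∈ H.powerset, (u r * u (Fin.last N) ^ M) ^ T.card *
      ∑ c : Z → Fin (N + 1), outcomeWeight p H u (G, c) *
        (if (extraCopies edges G T).card ≤ M * T.card then h (switchOutcome edges r (G, c) T)
          else 0) ≤ subsetWeight p H G * ∑ c : Z → Fin (N + 1), (∏ E, u (c E)) * h (G ∪ Y, c) := by
    intro G _
    have hw := subsetWeight_nonneg h0.le h1 H G
    have hnn : 0 ≤ ∑ c : Z → Fin (N + 1), (∏ E, u (c E)) * h (G ∪ Y, c) :=
      Finset.sum_nonneg fun c _ => mul_nonneg (Finset.prod_nonneg fun _ _ => (hu0 _).le) (hh _)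
    split_ifs with hM
    · simp only [outcomeWeight, mul_assoc]
      rw [← Finset.mul_sum, mul_left_comm]
      refine mul_le_mul_of_nonneg_left ?_ hw
      set Q := T ∪ extraCopies edges G T
      have h2 := prod_mul_sum_colouring_piecewise_le u (fun a => (hu0 a).le) hu Q
        (fun E => if E ∈ T then r else Fin.last N) (fun c => h (G ∪ Y, c)) fun c => hh _
      refine le_trans (mul_le_mul_of_nonneg_right ?_ ?_) h2
      · have hdis : Disjoint T (extraCopies edges G T) := by
          rw [Finset.disjoint_right]
          intro E hE
          exact (Finset.mem_filter.1 hE).2.1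
        rw [Finset.prod_union hdis, mul_pow, ← pow_mul]
        refine mul_le_mul ?_ ?_ (by have := hu0 (Fin.last N); positivity)
          (Finset.prod_nonneg fun E _ => (hu0 _).le)
        · rw [Finset.prod_congr rfl fun E hE => by rw [if_pos hE], Finset.prod_const]
        · rw [Finset.prod_congr rfl fun E hE => by
            rw [if_neg (Finset.disjoint_right.1 hdis hE)], Finset.prod_const]
          exact pow_le_pow_of_le_one (hu0 _).le hul hM
      · exact Finset.sum_nonneg fun c _ =>
          mul_nonneg (Finset.prod_nonneg fun _ _ => (hu0 _).le) (hh _)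
    · simp only [mul_zero, Finset.sum_const_zero]
      exact mul_nonneg hw hnn
  have outer := pow_mul_sum_subsetWeight_union_le h0.le h1 Y hTH
    (fun G => ∑ c : Z → Fin (N + 1), (∏ E, u (c E)) * h (G, c)) fun G =>
      Finset.sum_nonneg fun c _ => mul_nonneg (Finset.prod_nonneg fun _ _ => (hu0 _).le) (hh _)
  rw [inv_pow, le_inv_mul_iff₀ (by positivity), mul_pow, mul_assoc, Finset.mul_sum]
  have hR : ∑ x ∈ H.powerset, ∑ y : Z → Fin (N + 1), outcomeWeight p H u (x, y) * h (x, y) =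
      ∑ G ∈ H.powerset, subsetWeight p H G * ∑ c : Z → Fin (N + 1), (∏ E, u (c E)) * h (G, c) := by
    simp only [outcomeWeight, mul_assoc, Finset.mul_sum]
  rw [hR]
  refine le_trans (mul_le_mul ?_ (Finset.sum_le_sum inner) ?_ (by positivity)) outer
  · rw [← pow_mul]
    exact pow_le_pow_of_le_one h0.le h1 hYc
  · refine Finset.sum_nonneg fun G _ => mul_nonneg (by positivity) (Finset.sum_nonneg fun c _ => ?_)
    refine mul_nonneg (mul_nonneg (subsetWeight_nonneg h0.le h1 _ _)
      (Finset.prod_nonneg fun _ _ => (hu0 _).le)) ?_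
    split_ifs
    · exact hh _
    · exact le_rfl

lemma sum_outcomeWeight {N : ℕ} (p : ℝ) (H : Finset X) (u : Fin (N + 1) → ℝ)
    (hu : ∑ a, u a = 1) (f : Finset X → ℝ) :
    ∑ ω ∈ H.powerset ×ˢ (Finset.univ : Finset (Z → Fin (N + 1))), outcomeWeight p H u ω * f ω.1 =
      ∑ G ∈ H.powerset, subsetWeight p H G * f G := by
  rw [Finset.sum_product]
  refine Finset.sum_congr rfl fun G _ => ?_
  simp only [outcomeWeight]
  rw [← Finset.sum_mul, ← Finset.mul_sum, sum_prod_colouring u hu, mul_one]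

end Switching

section FragmentCover

variable {X Z : Type*} [DecidableEq X] [Fintype Z] [DecidableEq Z]

open Classical in
lemma sum_fragment_event_le {N : ℕ} {p : ℝ} (h0 : 0 < p) (h1 : p ≤ 1)
    (H : Finset X) (u : Fin (N + 1) → ℝ) (hu0 : ∀ a, 0 < u a) (hu : ∑ a, u a = 1)
    (edges : Z → Finset X) {t : ℕ} (ht : ∀ E, (edges E).card ≤ t) (M : ℕ)
    (𝓕 : Finset (Finset Z)) (h𝓕 : ∀ S ∈ 𝓕, ∀ E ∈ S, edges E ⊆ H)
    (μ : Finset Z → ℝ) (hμ : ∀ S, 0 ≤ μ S) {κ : ℝ} (hκ : 0 ≤ κ)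
    (hspread : ∀ T, ∑ S ∈ 𝓕, (if T ⊆ S then μ S else 0) ≤ κ ^ T.card)
    (l : ℕ → ℕ) (good : Finset X → Finset Z → Prop)
    (hgood : ∀ G, ∀ S ∈ 𝓕, good G S → ∀ T ⊆ S, (extraCopies edges G T).card ≤ M * T.card)
    (r : Fin N) (w : ℕ) :
    ∑ ω ∈ H.powerset ×ˢ (Finset.univ : Finset (Z → Fin (N + 1))), ∑ S ∈ 𝓕,
      (if good ω.1 S ∧ (∀ j ≤ (r : ℕ), (fragments 𝓕 (colourClass edges ω) l j S).card ≤ l j) ∧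
        (fragments 𝓕 (colourClass edges ω) l (r + 1) S).card = w then
        outcomeWeight p H u ω * μ S else 0) ≤
      2 ^ l r * ((p ^ t * (u r.castSucc * u (Fin.last N) ^ M))⁻¹ * κ) ^ w := by
  have hr : ((r.castSucc : Fin (N + 1)) : ℕ) < N := r.2
  have hc0 : 0 < p ^ t * (u r.castSucc * u (Fin.last N) ^ M) :=
    mul_pos (pow_pos h0 _) (mul_pos (hu0 _) (pow_pos (hu0 _) _))
  have hP : ∀ ω ∈ H.powerset ×ˢ (Finset.univ : Finset (Z → Fin (N + 1))),
      0 ≤ outcomeWeight p H u ω := fun ω _ =>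
    mul_nonneg (subsetWeight_nonneg h0.le h1 _ _) (Finset.prod_nonneg fun _ _ => (hu0 _).le)
  have hP1 : ∑ ω ∈ H.powerset ×ˢ (Finset.univ : Finset (Z → Fin (N + 1))),
      outcomeWeight p H u ω = 1 := by
    have := sum_outcomeWeight (Z := Z) p H u hu fun _ => 1
    simpa [sum_subsetWeight] using this
  refine sum_event_le_of_switching _ _ hP hP1 𝓕 μ hμ hκ (inv_nonneg.2 hc0.le) hspread (l r) w
    (fun ω S => good ω.1 S ∧
      (∀ j ≤ (r : ℕ), (fragments 𝓕 (colourClass edges ω) l j S).card ≤ l j) ∧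
        (fragments 𝓕 (colourClass edges ω) l (r + 1) S).card = w)
    (fun ω S => fragments 𝓕 (colourClass edges ω) l (r + 1) S)
    (switchOutcome edges r.castSucc)
    (fun ω T => (∀ j < (r : ℕ), Disjoint T (colourClass edges ω j)) ∧
      (extraCopies edges ω.1 T).card ≤ M * T.card ∧ T.biUnion edges ⊆ H)
    (fun ω => coveredFragment 𝓕 (colourClass edges ω r) (l r)
      (fragments 𝓕 (colourClass edges ω) l r)) ?_ (fun ω => card_coveredFragment_le _ _ _ _) ?_
  · rintro ω - S hS ⟨hg, hl, hw⟩
    have hsub := fragments_subset 𝓕 (colourClass edges ω) l (r + 1) S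
    have hd : ∀ j < (r : ℕ), Disjoint (fragments 𝓕 (colourClass edges ω) l (r + 1) S)
        (colourClass edges ω j) := fun j hj =>
      disjoint_fragments (by omega) hS (hl j hj.le)
    refine ⟨hsub, hw, ⟨hd, hgood _ S hS hg _ hsub, ?_⟩, ?_⟩
    · rw [Finset.biUnion_subset]
      exact fun E hE => h𝓕 S hS E (hsub hE)
    · have e1 : fragments 𝓕 (colourClass edges (switchOutcome edges r.castSucc ω
          (fragments 𝓕 (colourClass edges ω) l (r + 1) S))) l r =
          fragments 𝓕 (colourClass edges ω) l r :=
        fragments_congr 𝓕 l r fun j hj => colourClass_switchOutcome_of_ne edges ω _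
          (by omega) (by simp; omega) (hd j hj)
      have e2 : colourClass edges (switchOutcome edges r.castSucc ω
          (fragments 𝓕 (colourClass edges ω) l (r + 1) S)) r = _ :=
        colourClass_switchOutcome_self edges hr ω _
      rw [e1, e2]
      exact fragStep_subset_coveredFragment hS (hl r le_rfl)
  · intro T h hh
    by_cases hTH : T.biUnion edges ⊆ H
    · refine le_trans (Finset.sum_le_sum fun ω hω => mul_le_mul_of_nonneg_left ?_ (hP ω hω))
        (sum_outcomeWeight_switchOutcome_le h0 h1 H u hu0 hu edges ht M r.castSucc T hTH h hh)
      by_cases hM : (extraCopies edges ω.1 T).card ≤ M * T.card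
      · rw [if_pos hM]
        split_ifs
        · exact le_rfl
        · exact hh _
      · rw [if_neg hM, if_neg fun h => hM h.2.1]
    · simp only [hTH, and_false, if_false, mul_zero, Finset.sum_const_zero]
      exact mul_nonneg (pow_nonneg (inv_nonneg.2 hc0.le) _)
        (Finset.sum_nonneg fun ω hω => mul_nonneg (hP ω hω) (hh ω))

open Classical in
/-- The spread lemma for random sparsifications: under a `κ`-spread measure `μ` on `𝓕`, the
random edge set contains all edges of some member of `𝓕` except with the given probability. -/
theorem one_le_prob_covers_add {N : ℕ} {p : ℝ} (h0 : 0 < p) (h1 : p ≤ 1)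
    (H : Finset X) (u : Fin (N + 1) → ℝ) (hu0 : ∀ a, 0 < u a) (hu : ∑ a, u a = 1)
    (edges : Z → Finset X) {t : ℕ} (ht : ∀ E, (edges E).card ≤ t) (M : ℕ)
    (𝓕 : Finset (Finset Z)) (h𝓕 : ∀ S ∈ 𝓕, ∀ E ∈ S, edges E ⊆ H)
    (μ : Finset Z → ℝ) (hμ : ∀ S, 0 ≤ μ S) (hμ1 : ∑ S ∈ 𝓕, μ S = 1) {κ : ℝ} (hκ : 0 ≤ κ)
    (hspread : ∀ T, ∑ S ∈ 𝓕, (if T ⊆ S then μ S else 0) ≤ κ ^ T.card)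
    (l : ℕ → ℕ) (hl0 : ∀ S ∈ 𝓕, S.card ≤ l 0) (hlN : l N = 0)
    (good : Finset X → Finset Z → Prop)
    (hgood : ∀ G, ∀ S ∈ 𝓕, good G S → ∀ T ⊆ S, (extraCopies edges G T).card ≤ M * T.card) :
    1 ≤ ∑ G ∈ H.powerset, subsetWeight p H G *
          (if ∃ S ∈ 𝓕, ∀ E ∈ S, edges E ⊆ G then 1 else 0) +
        ∑ G ∈ H.powerset, subsetWeight p H G * ∑ S ∈ 𝓕, (if good G S then 0 else μ S) +
        ∑ r : Fin N, ∑ w ∈ Finset.Icc (l (r + 1) + 1) (l r),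
          2 ^ l r * ((p ^ t * (u r.castSucc * u (Fin.last N) ^ M))⁻¹ * κ) ^ w := by
  have hP : ∀ ω ∈ H.powerset ×ˢ (Finset.univ : Finset (Z → Fin (N + 1))),
      0 ≤ outcomeWeight p H u ω := fun ω _ =>
    mul_nonneg (subsetWeight_nonneg h0.le h1 _ _) (Finset.prod_nonneg fun _ _ => (hu0 _).le)
  set ev : Fin N → ℕ → (Finset X × (Z → Fin (N + 1))) → Finset Z → Prop := fun r w ω S =>
    good ω.1 S ∧ (∀ j ≤ (r : ℕ), (fragments 𝓕 (colourClass edges ω) l j S).card ≤ l j) ∧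
        (fragments 𝓕 (colourClass edges ω) l (r + 1) S).card = w with hev
  have key : ∀ ω ∈ H.powerset ×ˢ (Finset.univ : Finset (Z → Fin (N + 1))),
      outcomeWeight p H u ω ≤
        outcomeWeight p H u ω * (if ∃ S ∈ 𝓕, ∀ E ∈ S, edges E ⊆ ω.1 then 1 else 0) +
        outcomeWeight p H u ω * ∑ S ∈ 𝓕, (if good ω.1 S then 0 else μ S) +
        ∑ r : Fin N, ∑ w ∈ Finset.Icc (l (r + 1) + 1) (l r),
          ∑ S ∈ 𝓕, (if ev r w ω S then outcomeWeight p H u ω * μ S else 0) := by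
    intro ω hω
    have hw := hP ω hω
    have n1 : 0 ≤ ∑ S ∈ 𝓕, (if good ω.1 S then 0 else μ S) :=
      Finset.sum_nonneg fun S _ => by split_ifs; exacts [le_rfl, hμ S]
    have n2 : ∀ r : Fin N, ∀ w : ℕ, ∀ S : Finset Z,
        0 ≤ (if ev r w ω S then outcomeWeight p H u ω * μ S else 0) := fun r w S => by
      split_ifs
      exacts [mul_nonneg hw (hμ S), le_rfl]
    split_ifs with hsucc
    · have := mul_nonneg hw n1
      have : 0 ≤ ∑ r : Fin N, ∑ w ∈ Finset.Icc (l (r + 1) + 1) (l r),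
          ∑ S ∈ 𝓕, (if ev r w ω S then outcomeWeight p H u ω * μ S else 0) :=
        Finset.sum_nonneg fun r _ => Finset.sum_nonneg fun w _ =>
          Finset.sum_nonneg fun S _ => n2 r w S
      linarith
    · rw [mul_zero, zero_add]
      calc outcomeWeight p H u ω = ∑ S ∈ 𝓕, outcomeWeight p H u ω * μ S := by
            rw [← Finset.mul_sum, hμ1, mul_one]
        _ ≤ ∑ S ∈ 𝓕, (outcomeWeight p H u ω * (if good ω.1 S then 0 else μ S) +
            ∑ r : Fin N, ∑ w ∈ Finset.Icc (l (r + 1) + 1) (l r),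
              (if ev r w ω S then outcomeWeight p H u ω * μ S else 0)) := by
            refine Finset.sum_le_sum fun S hS => ?_
            have n3 : 0 ≤ ∑ r : Fin N, ∑ w ∈ Finset.Icc (l (r + 1) + 1) (l r),
                (if ev r w ω S then outcomeWeight p H u ω * μ S else 0) :=
              Finset.sum_nonneg fun r _ => Finset.sum_nonneg fun w _ => n2 r w S
            split_ifs with hg
            · rw [mul_zero, zero_add]
              obtain ⟨r, hr⟩ : ∃ r : Fin N, ∃ w ∈ Finset.Icc (l (r + 1) + 1) (l r),
                  ev r w ω S := by
                by_contra hno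
                push Not at hno
                have hall : ∀ r ≤ N, ∀ j ≤ r,
                    (fragments 𝓕 (colourClass edges ω) l j S).card ≤ l j := by
                  intro r
                  induction r with
                  | zero =>
                    intro _ j hj
                    obtain rfl : j = 0 := by omega
                    exact hl0 S hS
                  | succ r ih =>
                    intro hr j hj
                    rcases Nat.lt_or_ge j (r + 1) with h | h
                    · exact ih (by omega) j (by omega)
                    obtain rfl : j = r + 1 := by omega
                    by_contra hlt
                    have hmono := (Finset.card_le_card (fragments_subset_of_le 𝓕
                      (colourClass edges ω) l (Nat.le_succ r) S)).trans (ih (by omega) r le_rfl)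
                    exact hno ⟨r, by omega⟩ _ (Finset.mem_Icc.2 ⟨by simpa using hlt, hmono⟩)
                      ⟨hg, ih (by omega), rfl⟩
                have hN := hall N le_rfl N le_rfl
                rw [hlN, Nat.le_zero, Finset.card_eq_zero] at hN
                obtain ⟨B, hB, hsub⟩ := exists_subset_fragments_union
                  (colourClass edges ω) l N hS
                rw [hN, Finset.empty_union] at hsub
                refine hsucc ⟨B, hB, fun E hE => ?_⟩
                obtain ⟨j, -, hj⟩ := Finset.mem_biUnion.1 (hsub hE)
                exact (mem_colourClass.1 hj).1
              obtain ⟨w, hw', he⟩ := hr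
              refine le_trans (le_of_eq ?_) (Finset.single_le_sum (fun r _ =>
                Finset.sum_nonneg fun w _ => n2 r w S) (Finset.mem_univ r))
              refine le_antisymm ?_ ?_
              · refine le_trans (le_of_eq ?_) (Finset.single_le_sum (fun w _ => n2 r w S) hw')
                rw [if_pos he]
              · refine le_trans (Finset.sum_le_sum (g := fun w' => if w' = w then
                  outcomeWeight p H u ω * μ S else 0) fun w' _ => ?_) ?_
                · by_cases hww : w' = w
                  · rw [hww, if_pos he, if_pos rfl]
                  · rw [if_neg hww, if_neg fun h' => hww (h'.2.2.symm.trans he.2.2)]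
                · rw [Finset.sum_ite_eq' _ w, if_pos hw']
            · linarith
        _ = _ := by
            rw [Finset.sum_add_distrib, ← Finset.mul_sum]
            congr 1
            rw [Finset.sum_comm]
            refine Finset.sum_congr rfl fun r _ => ?_
            rw [Finset.sum_comm]
  have hP1 : ∑ ω ∈ H.powerset ×ˢ (Finset.univ : Finset (Z → Fin (N + 1))),
      outcomeWeight p H u ω = 1 := by
    have := sum_outcomeWeight (Z := Z) p H u hu fun _ => 1
    simpa [sum_subsetWeight] using this
  have := Finset.sum_le_sum key
  rw [hP1, Finset.sum_add_distrib, Finset.sum_add_distrib,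
    sum_outcomeWeight p H u hu fun G => if ∃ S ∈ 𝓕, ∀ E ∈ S, edges E ⊆ G then 1 else 0,
    sum_outcomeWeight p H u hu fun G => ∑ S ∈ 𝓕, (if good G S then 0 else μ S)] at this
  refine this.trans (add_le_add le_rfl ?_)
  rw [Finset.sum_comm]
  refine Finset.sum_le_sum fun r _ => ?_
  rw [Finset.sum_comm]
  refine Finset.sum_le_sum fun w _ => ?_
  exact sum_fragment_event_le h0 h1 H u hu0 hu edges ht M 𝓕 h𝓕 μ hμ hκ hspread l good hgood r w

end FragmentCover

section Extras

variable {X Z : Type*} [DecidableEq X] [Fintype Z] [DecidableEq Z]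

lemma card_add_card_sdiff {A B : Finset X} {t : ℕ} (hA : A.card = t) :
    t + (B \ A).card = B.card + (A \ B).card := by
  have h1 := Finset.card_sdiff_add_card B A
  have h2 := Finset.card_sdiff_add_card A B
  rw [Finset.union_comm] at h2
  omega

/-- A spread family rarely covers a prescribed set of edges. -/
lemma sum_subset_and_cover_le {edges : Z → Finset X} {t : ℕ} (ht : ∀ E, (edges E).card = t)
    (𝓕 : Finset (Finset Z)) (μ : Finset Z → ℝ) (hμ : ∀ S, 0 ≤ μ S) {κ K q D Ca : ℝ}
    (hκ : 0 ≤ κ) (hq : 0 ≤ q) (hK : 0 ≤ K) (hκq : κ ≤ K * q ^ t) (hD : 1 ≤ D)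
    (hspread : ∀ T, ∑ S ∈ 𝓕, (if T ⊆ S then μ S else 0) ≤ κ ^ T.card) {b : ℕ}
    (hCa : ∀ Y : Finset X, Y.card ≤ b →
      ∑ E ∈ Finset.univ.filter (fun E => ¬ Disjoint (edges E) Y), q ^ (edges E \ Y).card ≤ Ca)
    (hKD : K * Ca ≤ D) (Y : Finset X) (hY : Y.card ≤ b) (T : Finset Z)
    (hYT : Disjoint Y (T.biUnion edges)) :
    ∑ S ∈ 𝓕, (if T ⊆ S ∧ Y ⊆ S.biUnion edges then μ S else 0) ≤
      κ ^ T.card * (D * q) ^ Y.card := by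
  induction hn : Y.card using Nat.strong_induction_on generalizing Y T with
  | _ m ih =>
  subst hn
  rcases Y.eq_empty_or_nonempty with rfl | ⟨y, hy⟩
  · simpa using hspread T
  have hyT : ∀ E, y ∈ edges E → E ∉ T := fun E hE hET =>
    Finset.disjoint_left.1 hYT hy (Finset.mem_biUnion.2 ⟨E, hET, hE⟩)
  have hD0 : 0 ≤ D := by linarith
  have step1 : ∀ S ∈ 𝓕, (if T ⊆ S ∧ Y ⊆ S.biUnion edges then μ S else 0) ≤
      ∑ E ∈ Finset.univ.filter (fun E => y ∈ edges E),
        (if insert E T ⊆ S ∧ Y \ edges E ⊆ S.biUnion edges then μ S else 0) := by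
    intro S _
    have hnn : ∀ E ∈ Finset.univ.filter (fun E => y ∈ edges E),
        0 ≤ (if insert E T ⊆ S ∧ Y \ edges E ⊆ S.biUnion edges then μ S else 0) := by
      intro E _
      split_ifs
      exacts [hμ S, le_rfl]
    split_ifs with h
    · obtain ⟨E, hE, hyE⟩ := Finset.mem_biUnion.1 (h.2 hy)
      refine le_trans ?_ (Finset.single_le_sum hnn (a := E) (by simp [hyE]))
      rw [if_pos ⟨Finset.insert_subset hE h.1, Finset.sdiff_subset.trans h.2⟩]
    · exact Finset.sum_nonneg hnn
  have hlt : ∀ E, y ∈ edges E → (Y \ edges E).card < Y.card := fun E hE =>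
    Finset.card_lt_card ⟨Finset.sdiff_subset, fun h => (Finset.mem_sdiff.1 (h hy)).2 hE⟩
  have step2 : ∀ E ∈ Finset.univ.filter (fun E => y ∈ edges E),
      ∑ S ∈ 𝓕, (if insert E T ⊆ S ∧ Y \ edges E ⊆ S.biUnion edges then μ S else 0) ≤
        κ ^ T.card * (D ^ (Y.card - 1) * K * q ^ Y.card) * q ^ (edges E \ Y).card := by
    intro E hE
    have hyE := (Finset.mem_filter.1 hE).2
    have h1 := ih _ (hlt E hyE) (Y \ edges E) (by have := hlt E hyE; omega) (insert E T) (by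
      rw [Finset.biUnion_insert, Finset.disjoint_union_right]
      exact ⟨Finset.sdiff_disjoint, hYT.mono_left Finset.sdiff_subset⟩) rfl
    refine h1.trans ?_
    rw [Finset.card_insert_of_notMem (hyT E hyE), pow_succ]
    have h2 := card_add_card_sdiff (B := Y) (ht E)
    have h3 := hlt E hyE
    calc κ ^ T.card * κ * (D * q) ^ (Y \ edges E).card
        ≤ κ ^ T.card * (K * q ^ t) * (D * q) ^ (Y \ edges E).card := by gcongr
      _ = κ ^ T.card * (D ^ (Y \ edges E).card * K * q ^ (t + (Y \ edges E).card)) := by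
          rw [mul_pow, pow_add]
          ring
      _ = κ ^ T.card * (D ^ (Y \ edges E).card * K * q ^ Y.card) * q ^ (edges E \ Y).card := by
          rw [h2, pow_add]
          ring
      _ ≤ _ := by
          gcongr
          omega
  calc ∑ S ∈ 𝓕, (if T ⊆ S ∧ Y ⊆ S.biUnion edges then μ S else 0)
      ≤ ∑ S ∈ 𝓕, ∑ E ∈ Finset.univ.filter (fun E => y ∈ edges E),
        (if insert E T ⊆ S ∧ Y \ edges E ⊆ S.biUnion edges then μ S else 0) :=
        Finset.sum_le_sum step1
    _ ≤ ∑ E ∈ Finset.univ.filter (fun E => y ∈ edges E),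
        κ ^ T.card * (D ^ (Y.card - 1) * K * q ^ Y.card) * q ^ (edges E \ Y).card := by
        rw [Finset.sum_comm]
        exact Finset.sum_le_sum step2
    _ ≤ κ ^ T.card * (D ^ (Y.card - 1) * K * q ^ Y.card) * Ca := by
        rw [← Finset.mul_sum]
        refine mul_le_mul_of_nonneg_left (le_trans ?_ (hCa Y hY)) (by positivity)
        refine Finset.sum_le_sum_of_subset_of_nonneg ?_ fun _ _ _ => by positivity
        intro E hE
        rw [Finset.mem_filter] at hE ⊢
        exact ⟨hE.1, Finset.not_disjoint_iff.2 ⟨y, hE.2, hy⟩⟩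
    _ = κ ^ T.card * (D ^ (Y.card - 1) * (K * Ca) * q ^ Y.card) := by ring
    _ ≤ κ ^ T.card * (D ^ (Y.card - 1) * D * q ^ Y.card) := by gcongr
    _ = κ ^ T.card * (D * q) ^ Y.card := by
        rw [← pow_succ, Nat.sub_add_cancel (Finset.card_pos.2 ⟨y, hy⟩), mul_pow]

/-- The same for the union of the family with an independent random edge set. -/
lemma sum_mem_and_cover_le {edges : Z → Finset X} {t : ℕ} (ht : ∀ E, (edges E).card = t)
    (𝓕 : Finset (Finset Z)) (μ : Finset Z → ℝ) (hμ : ∀ S, 0 ≤ μ S) {κ K q D Ca p : ℝ}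
    (hκ : 0 ≤ κ) (hq : 0 ≤ q) (hK : 0 ≤ K) (hκq : κ ≤ K * q ^ t) (hD : 1 ≤ D)
    (hspread : ∀ T, ∑ S ∈ 𝓕, (if T ⊆ S then μ S else 0) ≤ κ ^ T.card) {b : ℕ}
    (hCa : ∀ Y : Finset X, Y.card ≤ b →
      ∑ E ∈ Finset.univ.filter (fun E => ¬ Disjoint (edges E) Y), q ^ (edges E \ Y).card ≤ Ca)
    (hKD : K * Ca ≤ D) (hqp : q ≤ p) (hp1 : p ≤ 1) (H : Finset X)
    (E₀ : Z) (Y : Finset X) (hY : Y.card ≤ b) :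
    ∑ G ∈ H.powerset, subsetWeight p H G *
      ∑ S ∈ 𝓕, (if E₀ ∈ S ∧ Y ⊆ G ∪ S.biUnion edges then μ S else 0) ≤
      κ * (2 * D) ^ b * p ^ (Y \ edges E₀).card := by
  have hp0 : 0 ≤ p := hq.trans hqp
  have hD0 : 0 ≤ D := by linarith
  set Y' := Y \ edges E₀ with hY'
  have hY'b : Y'.card ≤ b := (Finset.card_le_card Finset.sdiff_subset).trans hY
  have step1 : ∀ G S : Finset _, (if E₀ ∈ S ∧ Y ⊆ G ∪ S.biUnion edges then μ S else 0) ≤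
      ∑ Y₁ ∈ Y'.powerset, (if Y' \ Y₁ ⊆ G then 1 else 0) *
        (if {E₀} ⊆ S ∧ Y₁ ⊆ S.biUnion edges then μ S else 0) := by
    intro G S
    have hnn : ∀ Y₁ ∈ Y'.powerset, 0 ≤ (if Y' \ Y₁ ⊆ G then (1 : ℝ) else 0) *
        (if {E₀} ⊆ S ∧ Y₁ ⊆ S.biUnion edges then μ S else 0) := by
      intro Y₁ _
      have := hμ S
      refine mul_nonneg ?_ ?_ <;> split_ifs <;> first | exact this | norm_num
    split_ifs with h
    · refine le_trans ?_ (Finset.single_le_sum hnn (a := Y' ∩ S.biUnion edges)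
        (Finset.mem_powerset.2 Finset.inter_subset_left))
      rw [if_pos, if_pos, one_mul]
      · exact ⟨Finset.singleton_subset_iff.2 h.1, Finset.inter_subset_right⟩
      · intro y hy
        rw [Finset.mem_sdiff, Finset.mem_inter, not_and] at hy
        rcases Finset.mem_union.1 (h.2 (Finset.mem_sdiff.1 hy.1).1) with h' | h'
        · exact h'
        · exact absurd h' (hy.2 hy.1)
    · exact Finset.sum_nonneg hnn
  have hpr : ∀ Y₁ : Finset X, ∑ G ∈ H.powerset, subsetWeight p H G *
      (if Y₁ ⊆ G then 1 else 0) ≤ p ^ Y₁.card := by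
    intro Y₁
    by_cases h : Y₁ ⊆ H
    · have := sum_subsetWeight_superset p Y₁ h
      refine le_of_eq ?_
      convert this
    · refine le_trans (le_of_eq (Finset.sum_eq_zero fun G hG => ?_)) (pow_nonneg hp0 _)
      rw [if_neg fun h' => h (h'.trans (Finset.mem_powerset.1 hG)), mul_zero]
  calc ∑ G ∈ H.powerset, subsetWeight p H G *
      ∑ S ∈ 𝓕, (if E₀ ∈ S ∧ Y ⊆ G ∪ S.biUnion edges then μ S else 0)
      ≤ ∑ G ∈ H.powerset, subsetWeight p H G * ∑ S ∈ 𝓕,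
        ∑ Y₁ ∈ Y'.powerset, (if Y' \ Y₁ ⊆ G then 1 else 0) *
        (if {E₀} ⊆ S ∧ Y₁ ⊆ S.biUnion edges then μ S else 0) :=
        Finset.sum_le_sum fun G _ => mul_le_mul_of_nonneg_left
          (Finset.sum_le_sum fun S _ => step1 G S) (subsetWeight_nonneg hp0 hp1 _ _)
    _ = ∑ Y₁ ∈ Y'.powerset, (∑ G ∈ H.powerset, subsetWeight p H G *
          (if Y' \ Y₁ ⊆ G then 1 else 0)) *
          ∑ S ∈ 𝓕, (if {E₀} ⊆ S ∧ Y₁ ⊆ S.biUnion edges then μ S else 0) := by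
        simp_rw [Finset.sum_mul]
        rw [Finset.sum_comm (s := Y'.powerset)]
        refine Finset.sum_congr rfl fun G _ => ?_
        rw [Finset.sum_comm, Finset.mul_sum]
        refine Finset.sum_congr rfl fun Y₁ _ => ?_
        rw [mul_assoc, ← Finset.mul_sum]
    _ ≤ ∑ Y₁ ∈ Y'.powerset, p ^ (Y' \ Y₁).card * (κ ^ 1 * (D * q) ^ Y₁.card) := by
        refine Finset.sum_le_sum fun Y₁ hY₁ => ?_
        have hY₁' := Finset.mem_powerset.1 hY₁
        refine mul_le_mul (hpr _) ?_ (Finset.sum_nonneg fun S _ => ?_) (pow_nonneg hp0 _)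
        · refine sum_subset_and_cover_le ht 𝓕 μ hμ hκ hq hK hκq hD hspread hCa hKD Y₁
            ((Finset.card_le_card hY₁').trans hY'b) {E₀} ?_
          rw [Finset.singleton_biUnion]
          exact Finset.sdiff_disjoint.mono_left hY₁'
        · split_ifs
          exacts [hμ S, le_rfl]
    _ ≤ ∑ Y₁ ∈ Y'.powerset, κ * D ^ b * p ^ Y'.card := by
        refine Finset.sum_le_sum fun Y₁ hY₁ => ?_
        have hY₁' := Finset.mem_powerset.1 hY₁
        have hc := Finset.card_sdiff_add_card_eq_card hY₁'
        calc p ^ (Y' \ Y₁).card * (κ ^ 1 * (D * q) ^ Y₁.card)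
            = κ * D ^ Y₁.card * (p ^ (Y' \ Y₁).card * q ^ Y₁.card) := by
              rw [mul_pow]
              ring
          _ ≤ κ * D ^ b * (p ^ (Y' \ Y₁).card * p ^ Y₁.card) := by
              gcongr
              exact (Finset.card_le_card hY₁').trans hY'b
          _ = _ := by rw [← pow_add, hc]
    _ = 2 ^ Y'.card * (κ * D ^ b * p ^ Y'.card) := by
        rw [Finset.sum_const, Finset.card_powerset, nsmul_eq_mul]
        push_cast
        ring
    _ ≤ 2 ^ b * (κ * D ^ b * p ^ Y'.card) := by
        gcongr
        norm_num
    _ = _ := by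
        rw [mul_pow]
        ring

/-- `Y` extends, inside `U`, by `a` successive copies meeting `e₀`, each with a new edge. -/
def HasChain (edges : Z → Finset X) (e₀ U : Finset X) : ℕ → Finset X → Prop
  | 0, _ => True
  | a + 1, Y => ∃ E, ¬ Disjoint (edges E) e₀ ∧ edges E ⊆ U ∧ ¬ edges E ⊆ Y ∧
      HasChain edges e₀ U a (Y ∪ edges E)

open Classical in
lemma sum_hasChain_le {Ω : Type*} (Ωs : Finset Ω) (m : Ω → ℝ) (hm : ∀ ω ∈ Ωs, 0 ≤ m ω)
    {edges : Z → Finset X} {t : ℕ} (ht : ∀ E, (edges E).card = t) (e₀ : Finset X)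
    (U : Ω → Finset X) (P : Ω → Prop) {D p δ : ℝ} (hD : 0 ≤ D) (hp : 0 ≤ p) {b : ℕ}
    (hbase : ∀ Y : Finset X, Y.card ≤ b →
      ∑ ω ∈ Ωs, (if P ω ∧ Y ⊆ U ω then m ω else 0) ≤ D * p ^ (Y \ e₀).card)
    (hδ : ∀ Y : Finset X, e₀ ⊆ Y → Y.card ≤ b →
      ∑ E ∈ Finset.univ.filter (fun E => ¬ Disjoint (edges E) Y ∧ ¬ edges E ⊆ Y),
        p ^ (edges E \ Y).card ≤ δ)
    (a : ℕ) (Y : Finset X) (he : e₀ ⊆ Y) (hY : Y.card + a * t ≤ b) :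
    ∑ ω ∈ Ωs, (if P ω ∧ Y ⊆ U ω ∧ HasChain edges e₀ (U ω) a Y then m ω else 0) ≤
      D * p ^ (Y \ e₀).card * δ ^ a := by
  have hδ0 : 0 ≤ δ := le_trans (Finset.sum_nonneg fun _ _ => pow_nonneg hp _)
    (hδ Y he (by omega))
  induction a generalizing Y with
  | zero => simpa [HasChain] using hbase Y (by omega)
  | succ a ih =>
    set Zs := Finset.univ.filter (fun E => ¬ Disjoint (edges E) Y ∧ ¬ edges E ⊆ Y) with hZs
    have step1 : ∀ ω ∈ Ωs,
        (if P ω ∧ Y ⊆ U ω ∧ HasChain edges e₀ (U ω) (a + 1) Y then m ω else 0) ≤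
        ∑ E ∈ Zs, (if P ω ∧ Y ∪ edges E ⊆ U ω ∧
          HasChain edges e₀ (U ω) a (Y ∪ edges E) then m ω else 0) := by
      intro ω hω
      have hnn : ∀ E ∈ Zs, 0 ≤ (if P ω ∧ Y ∪ edges E ⊆ U ω ∧
          HasChain edges e₀ (U ω) a (Y ∪ edges E) then m ω else 0) := by
        intro E _
        split_ifs
        exacts [hm ω hω, le_rfl]
      split_ifs with h
      · obtain ⟨h1, h2, E, h3, h4, h5, h6⟩ := h
        refine le_trans ?_ (Finset.single_le_sum hnn (a := E) ?_)
        · rw [if_pos ⟨h1, Finset.union_subset h2 h4, h6⟩]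
        · exact Finset.mem_filter.2 ⟨Finset.mem_univ _, fun h => h3 (h.mono_right he), h5⟩
      · exact Finset.sum_nonneg hnn
    calc _ ≤ ∑ E ∈ Zs, ∑ ω ∈ Ωs, (if P ω ∧ Y ∪ edges E ⊆ U ω ∧
          HasChain edges e₀ (U ω) a (Y ∪ edges E) then m ω else 0) := by
          rw [Finset.sum_comm]
          exact Finset.sum_le_sum step1
      _ ≤ ∑ E ∈ Zs, D * p ^ (Y \ e₀).card * δ ^ a * p ^ (edges E \ Y).card := by
          refine Finset.sum_le_sum fun E _ => ?_
          have hc : (Y ∪ edges E).card ≤ Y.card + t := by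
            rw [← ht E]
            exact Finset.card_union_le _ _
          refine (ih (Y ∪ edges E) (he.trans Finset.subset_union_left)
            (by rw [add_mul] at hY; omega)).trans (le_of_eq ?_)
          have : ((Y ∪ edges E) \ e₀).card = (Y \ e₀).card + (edges E \ Y).card := by
            rw [← Finset.card_union_of_disjoint]
            · congr 1
              ext x
              have := @he x
              simp only [Finset.mem_sdiff, Finset.mem_union]
              tauto
            · rw [Finset.disjoint_left]
              intro x hx hx'
              exact (Finset.mem_sdiff.1 hx').2 (Finset.mem_sdiff.1 hx).1
          rw [this, pow_add]
          ring
      _ ≤ D * p ^ (Y \ e₀).card * δ ^ a * δ := by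
          rw [← Finset.mul_sum]
          exact mul_le_mul_of_nonneg_left (hδ Y he (by omega)) (by positivity)
      _ = _ := by ring

lemma hasChain_of_many {edges : Z → Finset X} {t : ℕ} (ht : ∀ E, (edges E).card = t)
    (e₀ U : Finset X) {b M : ℕ}
    (hM : ∀ Y : Finset X, Y.card ≤ b → (Finset.univ.filter fun E => edges E ⊆ Y).card ≤ M)
    (hmany : M < (Finset.univ.filter fun E => ¬ Disjoint (edges E) e₀ ∧ edges E ⊆ U).card)
    (a : ℕ) (Y : Finset X) (hY : Y.card + a * t ≤ b) : HasChain edges e₀ U a Y := by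
  induction a generalizing Y with
  | zero => trivial
  | succ a ih =>
    obtain ⟨E, hE, hE'⟩ := Finset.exists_mem_notMem_of_card_lt_card
      ((hM Y (by omega)).trans_lt hmany)
    simp only [Finset.mem_filter, Finset.mem_univ, true_and] at hE hE'
    refine ⟨E, hE.1, hE.2, hE', ih _ ?_⟩
    have := Finset.card_union_le Y (edges E)
    rw [ht E] at this
    rw [add_mul] at hY
    omega

lemma card_extraCopies_le (edges : Z → Finset X) (G : Finset X) (S : Finset Z) (M : ℕ)
    (h : ∀ E₀ ∈ S, (Finset.univ.filter fun E => ¬ Disjoint (edges E) (edges E₀) ∧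
      edges E ⊆ G ∪ S.biUnion edges).card ≤ M) (T : Finset Z) (hT : T ⊆ S) :
    (extraCopies edges G T).card ≤ M * T.card := by
  have : extraCopies edges G T ⊆ T.biUnion fun E₀ =>
      Finset.univ.filter fun E => ¬ Disjoint (edges E) (edges E₀) ∧
        edges E ⊆ G ∪ S.biUnion edges := by
    intro E hE
    obtain ⟨-, h1, h2⟩ := mem_extraCopies.1 hE
    obtain ⟨x, hx, hxG⟩ := Finset.not_subset.1 h2
    rcases Finset.mem_union.1 (h1 hx) with h3 | h3
    · exact absurd h3 hxG
    · obtain ⟨E₀, hE₀, hx₀⟩ := Finset.mem_biUnion.1 h3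
      refine Finset.mem_biUnion.2 ⟨E₀, hE₀, Finset.mem_filter.2 ⟨Finset.mem_univ _,
        Finset.not_disjoint_iff.2 ⟨x, hx, hx₀⟩, h1.trans ?_⟩⟩
      exact Finset.union_subset_union le_rfl (Finset.biUnion_subset_biUnion_of_subset_left _ hT)
  refine (Finset.card_le_card this).trans ?_
  rw [mul_comm]
  exact Finset.card_biUnion_le_card_mul _ _ _ fun E hE => h E (hT hE)

end Extras

section NotGood

variable {X Z : Type*} [DecidableEq X] [Fintype Z] [DecidableEq Z]

/-- Every copy of `S` shares edges with at most `M` copies present in `G ∪ S`. -/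
def FewTouching (edges : Z → Finset X) (M : ℕ) (G : Finset X) (S : Finset Z) : Prop :=
  ∀ E₀ ∈ S, (Finset.univ.filter fun E => ¬ Disjoint (edges E) (edges E₀) ∧
      edges E ⊆ G ∪ S.biUnion edges).card ≤ M

open Classical in
lemma sum_not_fewTouching_le {edges : Z → Finset X} {t : ℕ} (ht : ∀ E, (edges E).card = t)
    (𝓕 : Finset (Finset Z)) (μ : Finset Z → ℝ) (hμ : ∀ S, 0 ≤ μ S) {κ K q D Ca p δ : ℝ}
    (hκ : 0 ≤ κ) (hq : 0 ≤ q) (hK : 0 ≤ K) (hκq : κ ≤ K * q ^ t) (hD : 1 ≤ D)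
    (hspread : ∀ T, ∑ S ∈ 𝓕, (if T ⊆ S then μ S else 0) ≤ κ ^ T.card) {b a M : ℕ}
    (hCa : ∀ Y : Finset X, Y.card ≤ b →
      ∑ E ∈ Finset.univ.filter (fun E => ¬ Disjoint (edges E) Y), q ^ (edges E \ Y).card ≤ Ca)
    (hKD : K * Ca ≤ D) (hqp : q ≤ p) (hp1 : p ≤ 1) (H : Finset X)
    (hδ : ∀ Y : Finset X, Y.card ≤ b →
      ∑ E ∈ Finset.univ.filter (fun E => ¬ Disjoint (edges E) Y ∧ ¬ edges E ⊆ Y),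
        p ^ (edges E \ Y).card ≤ δ)
    (hM : ∀ Y : Finset X, Y.card ≤ b → (Finset.univ.filter fun E => edges E ⊆ Y).card ≤ M)
    (hb : t + a * t ≤ b) :
    ∑ G ∈ H.powerset, subsetWeight p H G *
        ∑ S ∈ 𝓕, (if FewTouching edges M G S then 0 else μ S) ≤
      Fintype.card Z * (κ * (2 * D) ^ b * δ ^ a) := by
  have hp0 : 0 ≤ p := hq.trans hqp
  have hw : ∀ G, 0 ≤ subsetWeight p H G := fun G => subsetWeight_nonneg hp0 hp1 _ _
  have h1 : ∀ E₀ : Z, ∑ ω ∈ H.powerset ×ˢ 𝓕, (if E₀ ∈ ω.2 ∧ edges E₀ ⊆ ω.1 ∪ ω.2.biUnion edges ∧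
      HasChain edges (edges E₀) (ω.1 ∪ ω.2.biUnion edges) a (edges E₀) then
        subsetWeight p H ω.1 * μ ω.2 else 0) ≤ κ * (2 * D) ^ b * δ ^ a := by
    intro E₀
    refine le_of_le_of_eq (b := κ * (2 * D) ^ b * p ^ (edges E₀ \ edges E₀).card * δ ^ a) ?_
      (by simp)
    convert sum_hasChain_le (H.powerset ×ˢ 𝓕) (fun ω => subsetWeight p H ω.1 * μ ω.2)
      (fun ω _ => mul_nonneg (hw _) (hμ _)) ht (edges E₀) (fun ω => ω.1 ∪ ω.2.biUnion edges)
      (fun ω => E₀ ∈ ω.2) (D := κ * (2 * D) ^ b) (p := p) (δ := δ) (by positivity) hp0 (b := b)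
      ?_ (fun Y _ hY => ?_) a (edges E₀) le_rfl (by rw [ht]; exact hb)
    · intro Y hY
      refine le_trans (le_of_eq ?_) (sum_mem_and_cover_le ht 𝓕 μ hμ hκ hq hK hκq hD hspread hCa
        hKD hqp hp1 H E₀ Y hY)
      rw [Finset.sum_product]
      refine Finset.sum_congr rfl fun G _ => ?_
      rw [Finset.mul_sum]
      refine Finset.sum_congr rfl fun S _ => ?_
      split_ifs <;> simp
    · convert hδ Y hY
  calc _ = ∑ ω ∈ H.powerset ×ˢ 𝓕, (if FewTouching edges M ω.1 ω.2 then 0 else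
        subsetWeight p H ω.1 * μ ω.2) := by
        rw [Finset.sum_product]
        refine Finset.sum_congr rfl fun G _ => ?_
        rw [Finset.mul_sum]
        refine Finset.sum_congr rfl fun S _ => ?_
        split_ifs <;> simp
    _ ≤ ∑ ω ∈ H.powerset ×ˢ 𝓕, ∑ E₀ : Z,
        (if E₀ ∈ ω.2 ∧ edges E₀ ⊆ ω.1 ∪ ω.2.biUnion edges ∧
          HasChain edges (edges E₀) (ω.1 ∪ ω.2.biUnion edges) a (edges E₀) then
          subsetWeight p H ω.1 * μ ω.2 else 0) := by
        refine Finset.sum_le_sum fun ω _ => ?_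
        have hnn : ∀ E₀ ∈ (Finset.univ : Finset Z),
            0 ≤ (if E₀ ∈ ω.2 ∧ edges E₀ ⊆ ω.1 ∪ ω.2.biUnion edges ∧
          HasChain edges (edges E₀) (ω.1 ∪ ω.2.biUnion edges) a (edges E₀) then
          subsetWeight p H ω.1 * μ ω.2 else 0) := by
          intro E₀ _
          split_ifs
          exacts [mul_nonneg (hw _) (hμ _), le_rfl]
        split_ifs with hf
        · exact Finset.sum_nonneg hnn
        · unfold FewTouching at hf
          push Not at hf
          obtain ⟨E₀, hE₀, hlt⟩ := hf
          refine le_trans ?_ (Finset.single_le_sum hnn (Finset.mem_univ E₀))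
          rw [if_pos ⟨hE₀, (Finset.subset_biUnion_of_mem edges hE₀).trans
            Finset.subset_union_right, hasChain_of_many ht _ _ hM (by convert hlt) a _
              (by rw [ht]; exact hb)⟩]
    _ ≤ ∑ E₀ : Z, κ * (2 * D) ^ b * δ ^ a := by
        rw [Finset.sum_comm]
        exact Finset.sum_le_sum fun E₀ _ => h1 E₀
    _ = _ := by simp

end NotGood

section Copies

variable {s : ℕ} (F : Finset (Finset (Fin s))) (I V : Type*)

/-- A rainbow labelled copy of `F`: an injective placement of its vertices and an injective
assignment of colours to its edges. -/
abbrev RainbowCopy := (Fin s ↪ V) × ({e // e ∈ F} ↪ I)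

variable {F I V} [DecidableEq I] [DecidableEq V]

/-- The coloured edges of a rainbow copy. -/
def RainbowCopy.edges (E : RainbowCopy F I V) : Finset (I × Finset V) :=
  Finset.univ.image fun e => (E.2 e, e.1.image E.1)

lemma RainbowCopy.card_edges (E : RainbowCopy F I V) : E.edges.card = F.card := by
  rw [RainbowCopy.edges, Finset.card_image_of_injective, Finset.card_univ, Fintype.card_coe]
  intro e e' h
  exact E.2.injective (Prod.ext_iff.1 h).1

/-- The edges of `F` whose copies lie in `U`. -/
def RainbowCopy.inside (E : RainbowCopy F I V) (U : Finset (I × Finset V)) :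
    Finset {e // e ∈ F} :=
  Finset.univ.filter fun e => (E.2 e, e.1.image E.1) ∈ U

lemma RainbowCopy.card_edges_sdiff (E : RainbowCopy F I V) (U : Finset (I × Finset V)) :
    (E.edges \ U).card = F.card - (E.inside U).card := by
  have : E.edges \ U = (Finset.univ \ E.inside U).image fun e => (E.2 e, e.1.image E.1) := by
    ext x
    simp only [RainbowCopy.edges, RainbowCopy.inside, Finset.mem_sdiff, Finset.mem_image,
      Finset.mem_univ, true_and, Finset.mem_filter]
    constructor
    · rintro ⟨⟨e, rfl⟩, h⟩
      exact ⟨e, h, rfl⟩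
    · rintro ⟨e, h, rfl⟩
      exact ⟨⟨e, rfl⟩, h⟩
  rw [this, Finset.card_image_of_injective, Finset.card_sdiff_of_subset (Finset.subset_univ _),
    Finset.card_univ, Fintype.card_coe]
  intro e e' h
  exact E.2.injective (Prod.ext_iff.1 h).1

lemma RainbowCopy.inside_nonempty {E : RainbowCopy F I V} {U : Finset (I × Finset V)}
    (h : ¬ Disjoint E.edges U) : (E.inside U).Nonempty := by
  obtain ⟨x, hx, hxU⟩ := Finset.not_disjoint_iff.1 h
  obtain ⟨e, -, rfl⟩ := Finset.mem_image.1 hx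
  exact ⟨e, Finset.mem_filter.2 ⟨Finset.mem_univ _, hxU⟩⟩

lemma RainbowCopy.inside_eq_univ {E : RainbowCopy F I V} {U : Finset (I × Finset V)} :
    E.inside U = Finset.univ ↔ E.edges ⊆ U := by
  simp [RainbowCopy.inside, RainbowCopy.edges, Finset.filter_eq_self, Finset.image_subset_iff]

variable [Fintype I] [Fintype V]

lemma card_filter_subset_inside_le (U : Finset (I × Finset V)) {b : ℕ} (hU : U.card ≤ b)
    (J : Finset {e // e ∈ F}) :
    (Finset.univ.filter fun E : RainbowCopy F I V => J ⊆ E.inside U).card ≤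
      ((s * b) ^ (J.biUnion Subtype.val).card *
        Fintype.card V ^ (s - (J.biUnion Subtype.val).card)) *
      (b ^ J.card * Fintype.card I ^ (F.card - J.card)) := by
  set W := J.biUnion Subtype.val
  set Q := (U.filter fun y => y.2.card ≤ s).biUnion fun y => y.2 with hQ
  have hQc : Q.card ≤ s * b := by
    refine (Finset.card_biUnion_le_card_mul _ _ s fun y hy => (Finset.mem_filter.1 hy).2).trans ?_
    rw [mul_comm]
    exact Nat.mul_le_mul_left _ ((Finset.card_filter_le _ _).trans hU)
  set Q' := U.image Prod.fst
  have hQc' : Q'.card ≤ b := Finset.card_image_le.trans hU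
  have h1 : (Fintype.piFinset fun v : Fin s => if v ∈ W then Q else Finset.univ).card ≤
      (s * b) ^ W.card * Fintype.card V ^ (s - W.card) := by
    rw [Fintype.card_piFinset, ← Finset.prod_mul_prod_compl W]
    refine Nat.mul_le_mul ?_ ?_
    · rw [Finset.prod_congr rfl fun v hv => by rw [if_pos hv], Finset.prod_const]
      exact Nat.pow_le_pow_left hQc _
    · rw [Finset.prod_congr rfl fun v hv => by rw [if_neg (Finset.mem_compl.1 hv)],
        Finset.prod_const, Finset.card_compl, Fintype.card_fin, Finset.card_univ]
  have h2 : (Fintype.piFinset fun e : {e // e ∈ F} => if e ∈ J then Q' else Finset.univ).card ≤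
      b ^ J.card * Fintype.card I ^ (F.card - J.card) := by
    rw [Fintype.card_piFinset, ← Finset.prod_mul_prod_compl J]
    refine Nat.mul_le_mul ?_ ?_
    · rw [Finset.prod_congr rfl fun v hv => by rw [if_pos hv], Finset.prod_const]
      exact Nat.pow_le_pow_left hQc' _
    · rw [Finset.prod_congr rfl fun v hv => by rw [if_neg (Finset.mem_compl.1 hv)],
        Finset.prod_const, Finset.card_compl, Fintype.card_coe, Finset.card_univ]
  refine le_trans ?_ (Nat.mul_le_mul h1 h2)
  rw [← Finset.card_product]
  refine Finset.card_le_card_of_injOn (fun E => ((E.1 : Fin s → V), (E.2 : {e // e ∈ F} → I)))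
    ?_ ?_
  · intro E hE
    have hE' : J ⊆ E.inside U := by simpa using hE
    have hmem : ∀ e ∈ J, (E.2 e, e.1.image E.1) ∈ U := fun e he => by
      simpa [RainbowCopy.inside] using hE' he
    simp only [Finset.coe_product, Set.mem_prod, Finset.mem_coe, Fintype.mem_piFinset]
    constructor
    · intro v
      split_ifs with hv
      · obtain ⟨e, he, hve⟩ := Finset.mem_biUnion.1 hv
        refine Finset.mem_biUnion.2 ⟨_, Finset.mem_filter.2 ⟨hmem e he, ?_⟩,
          Finset.mem_image_of_mem _ hve⟩
        exact Finset.card_image_le.trans ((Finset.card_le_univ _).trans (by simp))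
      · exact Finset.mem_univ _
    · intro e
      split_ifs with he
      · exact Finset.mem_image.2 ⟨_, hmem e he, rfl⟩
      · exact Finset.mem_univ _
  · rintro ⟨f, c⟩ - ⟨f', c'⟩ - h
    simp only [Prod.mk.injEq] at h
    exact Prod.ext (DFunLike.coe_injective h.1) (DFunLike.coe_injective h.2)

lemma sum_pow_card_edges_sdiff_le (U : Finset (I × Finset V)) {b : ℕ} (hU : U.card ≤ b)
    {q : ℝ} (hq : 0 ≤ q) (P : Finset {e // e ∈ F} → Prop) [DecidablePred P] :
    ∑ E ∈ Finset.univ.filter (fun E : RainbowCopy F I V => P (E.inside U)),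
        q ^ (E.edges \ U).card ≤
      ∑ J ∈ Finset.univ.filter P, (((s * b : ℕ) : ℝ) ^ (J.biUnion Subtype.val).card *
        (Fintype.card V : ℝ) ^ (s - (J.biUnion Subtype.val).card)) *
      ((b : ℝ) ^ J.card * (Fintype.card I : ℝ) ^ (F.card - J.card)) * q ^ (F.card - J.card) := by
  rw [← Finset.sum_fiberwise_of_maps_to (t := Finset.univ.filter P)
    (g := fun E : RainbowCopy F I V => E.inside U) (by
      intro E hE
      simpa using hE)]
  refine Finset.sum_le_sum fun J hJ => ?_
  have h1 := card_filter_subset_inside_le (F := F) U hU J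
  calc _ ≤ ∑ E ∈ Finset.univ.filter (fun E : RainbowCopy F I V => J ⊆ E.inside U),
        q ^ (F.card - J.card) := by
        rw [Finset.sum_congr rfl (g := fun _ => q ^ (F.card - J.card))]
        · refine Finset.sum_le_sum_of_subset_of_nonneg ?_ fun _ _ _ => pow_nonneg hq _
          intro E hE
          simp only [Finset.mem_filter, Finset.mem_univ, true_and] at hE ⊢
          exact hE.2.ge
        · intro E hE
          rw [RainbowCopy.card_edges_sdiff, (Finset.mem_filter.1 hE).2]
    _ ≤ _ := by
        rw [Finset.sum_const, nsmul_eq_mul]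
        exact mul_le_mul_of_nonneg_right (by exact_mod_cast h1) (pow_nonneg hq _)

end Copies

section Balanced

variable {s : ℕ} {F : Finset (Finset (Fin s))}

lemma StrictlyOneBalanced.biUnion_eq_univ (hF : StrictlyOneBalanced F) {k : ℕ}
    (hk : 2 ≤ k) (hFk : ∀ e ∈ F, e.card = k) (hne : F.Nonempty) :
    (Finset.univ : Finset {e // e ∈ F}).biUnion Subtype.val = Finset.univ := by
  by_contra hW
  set W := (Finset.univ : Finset {e // e ∈ F}).biUnion Subtype.val with hWdef
  obtain ⟨e, he⟩ := hne
  have hsub : ∀ e ∈ F, e ⊆ W := fun e he =>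
    Finset.subset_biUnion_of_mem (u := Subtype.val) (Finset.mem_univ (⟨e, he⟩ : {e // e ∈ F}))
  have h2 : 2 ≤ W.card := by
    rw [← hFk e he] at hk
    exact hk.trans (Finset.card_le_card (hsub e he))
  have := hF W F le_rfl hsub h2 (Or.inl hW)
  rw [Fintype.card_fin] at this
  have hle : W.card ≤ s := by simpa using Finset.card_le_univ W
  have h2' : (2 : ℝ) ≤ W.card := by exact_mod_cast h2
  have hle' : (W.card : ℝ) ≤ s := by exact_mod_cast hle
  refine absurd this (not_lt.2 ?_)
  gcongr
  linarith

lemma StrictlyOneBalanced.exponent_neg (hF : StrictlyOneBalanced F) {k : ℕ}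
    (hk : 2 ≤ k) (hFk : ∀ e ∈ F, e.card = k) (hs : 2 ≤ s) (J : Finset {e // e ∈ F})
    (hJ : J.Nonempty) (hJ' : J ≠ Finset.univ) :
    1 - ((J.biUnion Subtype.val).card : ℝ) + J.card * ((s - 1 : ℝ) / F.card) < 0 := by
  set W := J.biUnion Subtype.val with hWdef
  obtain ⟨e, he⟩ := hJ
  have hF0 : (0 : ℝ) < F.card := by exact_mod_cast Finset.card_pos.2 ⟨e.1, e.2⟩
  have h2 : 2 ≤ W.card := by
    rw [← hFk e e.2] at hk
    exact hk.trans (Finset.card_le_card (Finset.subset_biUnion_of_mem Subtype.val he))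
  have := hF W (J.map (Function.Embedding.subtype _)) (by
      intro x hx
      obtain ⟨y, -, rfl⟩ := Finset.mem_map.1 hx
      exact y.2) (by
      intro x hx
      obtain ⟨y, hy, rfl⟩ := Finset.mem_map.1 hx
      exact Finset.subset_biUnion_of_mem Subtype.val hy) h2 (Or.inr (by
      intro h
      apply hJ'
      refine Finset.eq_univ_of_card _ ?_
      have h' := congrArg Finset.card h
      rw [Finset.card_map] at h'
      rw [Fintype.card_coe, h']))
  rw [Finset.card_map, Fintype.card_fin] at this
  have h2' : (2 : ℝ) ≤ W.card := by exact_mod_cast h2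
  have hs' : (2 : ℝ) ≤ s := by exact_mod_cast hs
  rw [div_lt_div_iff₀ (by linarith) (by linarith)] at this
  have : J.card * ((s - 1 : ℝ) / F.card) < W.card - 1 := by
    rw [mul_div_assoc', div_lt_iff₀ hF0]
    linarith
  linarith

lemma StrictlyOneBalanced.exists_gap (hF : StrictlyOneBalanced F) {k : ℕ}
    (hk : 2 ≤ k) (hFk : ∀ e ∈ F, e.card = k) (hs : 2 ≤ s) :
    ∃ ε : ℝ, 0 < ε ∧ ∀ J : Finset {e // e ∈ F}, J.Nonempty → J ≠ Finset.univ →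
      1 - ((J.biUnion Subtype.val).card : ℝ) + J.card * ((s - 1 : ℝ) / F.card) ≤ -ε := by
  classical
  set 𝒥 := (Finset.univ : Finset (Finset {e // e ∈ F})).filter
    fun J => J.Nonempty ∧ J ≠ Finset.univ
  rcases 𝒥.eq_empty_or_nonempty with h | h
  · refine ⟨1, one_pos, fun J h1 h2 => ?_⟩
    have : J ∈ 𝒥 := Finset.mem_filter.2 ⟨Finset.mem_univ _, h1, h2⟩
    rw [h] at this
    simp at this
  · obtain ⟨J₀, hJ₀, hmax⟩ := Finset.exists_max_image 𝒥 (fun J =>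
      1 - ((J.biUnion Subtype.val).card : ℝ) + J.card * ((s - 1 : ℝ) / F.card)) h
    have h0 := (Finset.mem_filter.1 hJ₀).2
    have := hF.exponent_neg hk hFk hs J₀ h0.1 h0.2
    refine ⟨_, neg_pos.2 this, fun J h1 h2 => ?_⟩
    rw [neg_neg]
    exact hmax J (Finset.mem_filter.2 ⟨Finset.mem_univ _, h1, h2⟩)

end Balanced

section TouchingAsymptotics

variable {s t : ℕ} {F : Finset (Finset (Fin s))}

lemma class_term_le (hFt : F.card = t) (ht : 0 < t) (b n : ℕ) (hn : 1 ≤ n) (v j : ℕ)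
    (hv : v ≤ s) (hj : j ≤ t) {lam : ℝ} (hlam : 1 ≤ lam) :
    (((s * b : ℕ) : ℝ) ^ v * (Fintype.card (Fin (s * n)) : ℝ) ^ (s - v)) *
      ((b : ℝ) ^ j * (Fintype.card (Fin (t * n)) : ℝ) ^ (F.card - j)) *
        (lam * (n : ℝ) ^ (-((s - 1 : ℝ) / t) - 1)) ^ (F.card - j) ≤
      ((s * b + s : ℝ) ^ s * (b + t : ℝ) ^ t) * lam ^ t *
        (n : ℝ) ^ (1 - (v : ℝ) + j * ((s - 1 : ℝ) / t)) := by
  have hn0 : (0 : ℝ) < n := by exact_mod_cast hn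
  have ht0 : (0 : ℝ) < t := by exact_mod_cast ht
  rw [hFt, Fintype.card_fin, Fintype.card_fin]
  push_cast
  have e1 : ((s : ℝ) * b) ^ v * ((s : ℝ) * n) ^ (s - v) ≤
      (s * b + s : ℝ) ^ s * (n : ℝ) ^ (s - v) := by
    calc ((s : ℝ) * b) ^ v * ((s : ℝ) * n) ^ (s - v)
        ≤ (s * b + s : ℝ) ^ v * ((s * b + s : ℝ) * n) ^ (s - v) := by
          gcongr
          · have : (0 : ℝ) ≤ s := by positivity
            linarith
          · have : (0 : ℝ) ≤ s * b := by positivity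
            linarith
      _ = _ := by rw [mul_pow, ← mul_assoc, ← pow_add, Nat.add_sub_cancel' hv]
  have e2 : (b : ℝ) ^ j * ((t : ℝ) * n) ^ (t - j) ≤ (b + t : ℝ) ^ t * (n : ℝ) ^ (t - j) := by
    calc (b : ℝ) ^ j * ((t : ℝ) * n) ^ (t - j)
        ≤ (b + t : ℝ) ^ j * ((b + t : ℝ) * n) ^ (t - j) := by
          gcongr
          · linarith
          · have : (0 : ℝ) ≤ b := by positivity
            linarith
      _ = _ := by rw [mul_pow, ← mul_assoc, ← pow_add, Nat.add_sub_cancel' hj]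
  have e3 : (n : ℝ) ^ (s - v) * ((n : ℝ) ^ (t - j) *
      ((n : ℝ) ^ (-((s - 1 : ℝ) / t) - 1)) ^ (t - j)) =
      (n : ℝ) ^ (1 - (v : ℝ) + j * ((s - 1 : ℝ) / t)) := by
    rw [← Real.rpow_natCast, ← Real.rpow_natCast, ← Real.rpow_natCast, ← Real.rpow_mul hn0.le,
      ← Real.rpow_add hn0, ← Real.rpow_add hn0]
    congr 1
    rw [Nat.cast_sub hv, Nat.cast_sub hj]
    field_simp
    ring
  calc _ ≤ ((s * b + s : ℝ) ^ s * (n : ℝ) ^ (s - v)) * ((b + t : ℝ) ^ t * (n : ℝ) ^ (t - j)) *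
        (lam ^ t * ((n : ℝ) ^ (-((s - 1 : ℝ) / t) - 1)) ^ (t - j)) := by
        rw [mul_pow lam]
        gcongr
        omega
    _ = ((s * b + s : ℝ) ^ s * (b + t : ℝ) ^ t) * lam ^ t * ((n : ℝ) ^ (s - v) *
        ((n : ℝ) ^ (t - j) * ((n : ℝ) ^ (-((s - 1 : ℝ) / t) - 1)) ^ (t - j))) := by ring
    _ = _ := by rw [e3]

lemma sum_classes_le (hFt : F.card = t) (ht : 0 < t) (b n : ℕ) (hn : 1 ≤ n)
    {lam x : ℝ} (hlam : 1 ≤ lam) (P : Finset {e // e ∈ F} → Prop) [DecidablePred P]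
    (hP : ∀ J, P J → 1 - ((J.biUnion Subtype.val).card : ℝ) + J.card * ((s - 1 : ℝ) / t) ≤ x)
    (U : Finset (Fin (t * n) × Finset (Fin (s * n)))) (hU : U.card ≤ b) :
    ∑ E ∈ Finset.univ.filter
        (fun E : RainbowCopy F (Fin (t * n)) (Fin (s * n)) => P (E.inside U)),
        (lam * (n : ℝ) ^ (-((s - 1 : ℝ) / t) - 1)) ^ (E.edges \ U).card ≤
      2 ^ t * ((s * b + s : ℝ) ^ s * (b + t : ℝ) ^ t) * lam ^ t * (n : ℝ) ^ x := by
  have hn1 : (1 : ℝ) ≤ n := by exact_mod_cast hn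
  have hc : 0 ≤ ((s * b + s : ℝ) ^ s * (b + t : ℝ) ^ t) * lam ^ t * (n : ℝ) ^ x := by positivity
  refine (sum_pow_card_edges_sdiff_le U hU (by positivity) P).trans ?_
  calc _ ≤ ∑ J ∈ Finset.univ.filter P,
        ((s * b + s : ℝ) ^ s * (b + t : ℝ) ^ t) * lam ^ t * (n : ℝ) ^ x := by
        refine Finset.sum_le_sum fun J hJ => ?_
        refine (class_term_le hFt ht b n hn _ _ ?_ ?_ hlam).trans ?_
        · simpa using Finset.card_le_univ (J.biUnion Subtype.val)
        · rw [← hFt]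
          simpa using Finset.card_le_univ J
        · refine mul_le_mul_of_nonneg_left ?_ (by positivity)
          exact Real.rpow_le_rpow_of_exponent_le hn1 (hP J (Finset.mem_filter.1 hJ).2)
    _ ≤ ∑ J : Finset {e // e ∈ F},
        ((s * b + s : ℝ) ^ s * (b + t : ℝ) ^ t) * lam ^ t * (n : ℝ) ^ x :=
        Finset.sum_le_sum_of_subset_of_nonneg (Finset.subset_univ _) fun _ _ _ => hc
    _ = _ := by
        rw [Finset.sum_const, Finset.card_univ, Fintype.card_finset, Fintype.card_coe, hFt,
          nsmul_eq_mul]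
        push_cast
        ring

lemma card_filter_edges_subset_le (hF : StrictlyOneBalanced F) {k : ℕ} (hk : 2 ≤ k)
    (hFk : ∀ e ∈ F, e.card = k) (hFt : F.card = t) (ht : 0 < t)
    {I V : Type*} [Fintype I] [Fintype V] [DecidableEq I] [DecidableEq V]
    (U : Finset (I × Finset V)) {b : ℕ} (hU : U.card ≤ b) :
    (Finset.univ.filter fun E : RainbowCopy F I V => E.edges ⊆ U).card ≤ (s * b) ^ s * b ^ t := by
  have h := card_filter_subset_inside_le (F := F) U hU Finset.univ
  rw [hF.biUnion_eq_univ hk hFk (Finset.card_pos.1 (by omega))] at h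
  simp only [Finset.card_univ, Fintype.card_fin, Fintype.card_coe, hFt, Nat.sub_self, pow_zero,
    mul_one] at h
  refine le_trans (le_of_eq ?_) h
  congr 1
  ext E
  rw [Finset.mem_filter, Finset.mem_filter, Finset.univ_subset_iff, RainbowCopy.inside_eq_univ]

lemma card_rainbowCopy_le (I V : Type*) [Fintype I] [Fintype V] [DecidableEq I]
    [DecidableEq V] :
    Fintype.card (RainbowCopy F I V) ≤ Fintype.card V ^ s * Fintype.card I ^ F.card := by
  have h := card_filter_subset_inside_le (F := F) (I := I) (V := V) ∅ (b := 0) (by simp) ∅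
  simpa using h

open Filter Topology in
lemma tendsto_log_pow_mul_inv (c : ℝ) (a : ℕ) :
    Tendsto (fun n : ℕ => c * (Real.log n) ^ a / n) atTop (𝓝 0) := by
  have h : Tendsto (fun x : ℝ => Real.log x ^ a / x) atTop (𝓝 0) := by
    have := (Real.isLittleO_pow_log_id_atTop (n := a)).tendsto_div_nhds_zero
    simpa using this
  have := (h.comp tendsto_natCast_atTop_atTop).const_mul c
  simpa [mul_div_assoc] using this

/-- Under a spread measure, with high probability few copies touch any copy. -/
theorem exists_sum_not_fewTouching_le (hF : StrictlyOneBalanced F) {k : ℕ} (hk : 2 ≤ k)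
    (hFk : ∀ e ∈ F, e.card = k) (hs : 2 ≤ s) (hFt : F.card = t) (ht : 0 < t) :
    ∃ M : ℕ, ∀ K C : ℝ, 0 ≤ K → 1 ≤ C → ∀ ε : ℝ, 0 < ε → ∃ n₀ : ℕ, ∀ n : ℕ, n₀ ≤ n →
      ∀ p : ℝ, p = C * (n : ℝ) ^ (-((s - 1 : ℝ) / t) - 1) * (Real.log n) ^ ((1 : ℝ) / t) →
      p ≤ 1 → ∀ (H : Finset (Fin (t * n) × Finset (Fin (s * n))))
        (𝓕 : Finset (Finset (RainbowCopy F (Fin (t * n)) (Fin (s * n)))))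
        (μ : Finset (RainbowCopy F (Fin (t * n)) (Fin (s * n))) → ℝ), (∀ S, 0 ≤ μ S) →
        (∀ T, ∑ S ∈ 𝓕, (if T ⊆ S then μ S else 0) ≤
          (K * (n : ℝ) ^ (-(s + t - 1 : ℝ))) ^ T.card) →
        ∀ [∀ G S, Decidable (FewTouching (RainbowCopy.edges (F := F) (I := Fin (t * n))
          (V := Fin (s * n))) M G S)],
        ∑ G ∈ H.powerset, subsetWeight p H G *
          ∑ S ∈ 𝓕, (if FewTouching RainbowCopy.edges M G S then 0 else μ S) ≤ ε := by
  classical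
  obtain ⟨gap, hgap, hgapJ⟩ := hF.exists_gap hk hFk hs
  obtain ⟨a, ha⟩ := exists_nat_ge (2 / gap)
  rw [div_le_iff₀ hgap] at ha
  set b := t + a * t with hb
  have ht0 : (0 : ℝ) < t := by exact_mod_cast ht
  refine ⟨(s * b) ^ s * b ^ t, fun K C hK hC ε hε => ?_⟩
  set B : ℝ := 2 ^ t * ((s * b + s : ℝ) ^ s * (b + t : ℝ) ^ t) with hB
  have hB0 : 0 ≤ B := by positivity
  set D : ℝ := max 1 (K * B) with hD
  have hD1 : 1 ≤ D := le_max_left _ _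
  set c : ℝ := (s : ℝ) ^ s * (t : ℝ) ^ t * (K * (2 * D) ^ b * (B * C ^ t) ^ a) with hc
  have hc0 : 0 ≤ c := by positivity
  have hlim := tendsto_log_pow_mul_inv c a
  obtain ⟨n₁, hn₁⟩ := Filter.eventually_atTop.1 (hlim.eventually (eventually_le_nhds hε))
  refine ⟨max n₁ 3, fun n hn p hp hp1 H 𝓕 μ hμ hspread _ => ?_⟩
  have hn3 : 3 ≤ n := (le_max_right _ _).trans hn
  have hn1 : 1 ≤ n := by omega
  have hnR : (3 : ℝ) ≤ n := by exact_mod_cast hn3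
  have hn0 : (0 : ℝ) < n := by linarith
  have hlog : 1 ≤ Real.log n := by
    rw [Real.le_log_iff_exp_le hn0]
    exact (Real.exp_one_lt_d9.le.trans (by norm_num)).trans hnR
  set q : ℝ := (n : ℝ) ^ (-((s - 1 : ℝ) / t) - 1) with hq
  have hq0 : 0 ≤ q := by positivity
  set lam : ℝ := C * (Real.log n) ^ ((1 : ℝ) / t) with hlam
  have hlam1 : 1 ≤ lam := one_le_mul_of_one_le_of_one_le hC (Real.one_le_rpow hlog (by positivity))
  have hlamt : lam ^ t = C ^ t * Real.log n := by
    rw [hlam, mul_pow, ← Real.rpow_natCast (_ ^ _), ← Real.rpow_mul (by linarith)]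
    rw [one_div, inv_mul_cancel₀ ht0.ne', Real.rpow_one]
  have hplam : p = lam * q := by
    rw [hp, hlam]
    ring
  have hqp : q ≤ p := by
    rw [hplam]
    exact le_mul_of_one_le_left hq0 hlam1
  have hqt : q ^ t = (n : ℝ) ^ (-(s + t - 1 : ℝ)) := by
    rw [hq, ← Real.rpow_natCast, ← Real.rpow_mul hn0.le]
    congr 1
    field_simp
    ring
  set κ := K * (n : ℝ) ^ (-(s + t - 1 : ℝ)) with hκ
  have hCa : ∀ Y : Finset (Fin (t * n) × Finset (Fin (s * n))), Y.card ≤ b →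
      ∑ E ∈ Finset.univ.filter (fun E : RainbowCopy F (Fin (t * n)) (Fin (s * n)) =>
        ¬ Disjoint E.edges Y), q ^ (E.edges \ Y).card ≤ B := by
    intro Y hY
    have h1 := sum_classes_le (F := F) hFt ht b n hn1 (lam := 1) (x := 0) le_rfl
      (fun J => J.Nonempty) (fun J hJ => by
        by_cases hJ' : J = Finset.univ
        · rw [hJ', hF.biUnion_eq_univ hk hFk (Finset.card_pos.1 (by omega))]
          simp only [Finset.card_univ, Fintype.card_fin, Fintype.card_coe, hFt]
          rw [mul_div_cancel₀ _ ht0.ne']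
          linarith
        · have := hgapJ J hJ hJ'
          rw [hFt] at this
          linarith) Y hY
    simp only [one_mul, one_pow, mul_one, Real.rpow_zero] at h1
    refine le_trans (Finset.sum_le_sum_of_subset_of_nonneg ?_ fun _ _ _ => pow_nonneg hq0 _) h1
    intro E hE
    rw [Finset.mem_filter] at hE ⊢
    exact ⟨hE.1, RainbowCopy.inside_nonempty hE.2⟩
  have hδ : ∀ Y : Finset (Fin (t * n) × Finset (Fin (s * n))), Y.card ≤ b →
      ∑ E ∈ Finset.univ.filter (fun E : RainbowCopy F (Fin (t * n)) (Fin (s * n)) =>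
        ¬ Disjoint E.edges Y ∧ ¬ E.edges ⊆ Y), p ^ (E.edges \ Y).card ≤
        B * lam ^ t * (n : ℝ) ^ (-gap) := by
    intro Y hY
    have h1 := sum_classes_le (F := F) hFt ht b n hn1 (x := -gap) hlam1
      (fun J => J.Nonempty ∧ J ≠ Finset.univ) (fun J hJ => by
        have := hgapJ J hJ.1 hJ.2
        rwa [hFt] at this) Y hY
    rw [← hplam] at h1
    refine le_trans (Finset.sum_le_sum_of_subset_of_nonneg ?_
      fun _ _ _ => pow_nonneg (hq0.trans hqp) _) h1
    intro E hE
    rw [Finset.mem_filter] at hE ⊢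
    exact ⟨hE.1, RainbowCopy.inside_nonempty hE.2.1,
      fun h => hE.2.2 (RainbowCopy.inside_eq_univ.1 h)⟩
  have main := sum_not_fewTouching_le (edges := RainbowCopy.edges (F := F)) (t := t)
    (fun E => by rw [RainbowCopy.card_edges, hFt]) 𝓕 μ hμ (κ := κ) (by positivity) hq0 hK
    (by rw [hqt]) hD1 hspread hCa (le_max_right _ _) hqp hp1 H hδ
    (fun Y hY => card_filter_edges_subset_le hF hk hFk hFt ht Y hY) (a := a) le_rfl
  refine le_trans (le_trans (le_of_eq ?_) main) (le_trans ?_ (hn₁ n ((le_max_left _ _).trans hn)))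
  · refine Finset.sum_congr rfl fun G _ => ?_
    congr 1
    refine Finset.sum_congr rfl fun S _ => ?_
    congr
  have hZ : (Fintype.card (RainbowCopy F (Fin (t * n)) (Fin (s * n))) : ℝ) ≤
      (s : ℝ) ^ s * (t : ℝ) ^ t * (n : ℝ) ^ (s + t) := by
    have h := card_rainbowCopy_le (F := F) (Fin (t * n)) (Fin (s * n))
    rw [Fintype.card_fin, Fintype.card_fin, hFt] at h
    calc _ ≤ (((s * n) ^ s * (t * n) ^ t : ℕ) : ℝ) := by exact_mod_cast h
      _ = _ := by
        push_cast
        rw [mul_pow, mul_pow, pow_add]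
        ring
  have hpow : (n : ℝ) ^ (s + t) * (n : ℝ) ^ (-(s + t - 1 : ℝ)) = n := by
    rw [← Real.rpow_natCast, ← Real.rpow_add hn0]
    push_cast
    rw [show (s + t + -(s + t - 1) : ℝ) = 1 by ring, Real.rpow_one]
  have hpow' : ((n : ℝ) ^ (-gap)) ^ a ≤ (n : ℝ) ^ (-2 : ℝ) := by
    rw [← Real.rpow_natCast, ← Real.rpow_mul hn0.le]
    exact Real.rpow_le_rpow_of_exponent_le (by linarith) (by linarith)
  have h2 : (n : ℝ) * (n : ℝ) ^ (-2 : ℝ) = 1 / n := by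
    rw [Real.rpow_neg hn0.le, Real.rpow_two]
    field_simp
  calc _ ≤ ((s : ℝ) ^ s * (t : ℝ) ^ t * (n : ℝ) ^ (s + t)) *
        (κ * (2 * D) ^ b * (B * lam ^ t * (n : ℝ) ^ (-gap)) ^ a) := by gcongr
    _ = (s : ℝ) ^ s * (t : ℝ) ^ t * (K * (2 * D) ^ b * (B * lam ^ t) ^ a) *
        (((n : ℝ) ^ (s + t) * (n : ℝ) ^ (-(s + t - 1 : ℝ))) * ((n : ℝ) ^ (-gap)) ^ a) := by
        rw [mul_pow (B * lam ^ t)]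
        ring
    _ ≤ (s : ℝ) ^ s * (t : ℝ) ^ t * (K * (2 * D) ^ b * (B * lam ^ t) ^ a) *
        (n * (n : ℝ) ^ (-2 : ℝ)) := by
        rw [hpow]
        gcongr
    _ = c * Real.log n ^ a / n := by
        rw [h2, hlamt, hc, ← mul_assoc B, mul_pow _ (Real.log n)]
        ring

end TouchingAsymptotics

section Rounds

/-- Weights of the colours: `R` halving rounds, a final round and a junk colour. -/
noncomputable def roundWeight (R : ℕ) (i : Fin (R + 2)) : ℝ :=
  if (i : ℕ) < R then 1 / (4 * R) else if (i : ℕ) = R then 1 / 4 else 1 / 2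

lemma roundWeight_pos {R : ℕ} (i : Fin (R + 2)) : 0 < roundWeight R i := by
  rw [roundWeight]
  split_ifs with h
  · have : (0 : ℝ) < R := by exact_mod_cast (Nat.zero_le _).trans_lt h
    positivity
  · norm_num
  · norm_num

lemma sum_roundWeight {R : ℕ} (hR : 1 ≤ R) : ∑ i, roundWeight R i = 1 := by
  have hR0 : (0 : ℝ) < R := by exact_mod_cast hR
  rw [Fin.sum_univ_castSucc, Fin.sum_univ_castSucc]
  have h : ∀ i : Fin R, roundWeight R i.castSucc.castSucc = 1 / (4 * R) := fun i => by
    rw [roundWeight, if_pos (by simp)]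
  rw [Finset.sum_congr rfl fun i _ => h i]
  simp only [roundWeight, Finset.sum_const, Finset.card_univ, Fintype.card_fin, nsmul_eq_mul,
    Fin.val_castSucc, Fin.val_last, lt_self_iff_false, if_false, if_true]
  rw [if_neg (by omega), if_neg (by omega)]
  field_simp
  norm_num

/-- Sizes of the fragments: halved until they reach `ℓ`, then exhausted. -/
def roundSize (n R ℓ r : ℕ) : ℕ := if r ≤ R then max (n / 2 ^ r) ℓ else 0

lemma geom_tail_le {x : ℝ} (hx0 : 0 ≤ x) (hx : x ≤ 1 / 64) (m m' : ℕ) (hm : m' ≤ 2 * m + 1) :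
    ∑ w ∈ Finset.Icc (m + 1) m', 2 ^ m' * x ^ w ≤ (1 / 16 : ℝ) ^ m := by
  have h2 : ∀ d : ℕ, ∑ w ∈ Finset.range d, (1 / 64 : ℝ) ^ w ≤ 64 / 63 := by
    intro d
    rw [geom_sum_eq (by norm_num)]
    have : (0 : ℝ) ≤ (1 / 64) ^ d := by positivity
    rw [div_le_iff_of_neg (by norm_num)]
    linarith
  calc ∑ w ∈ Finset.Icc (m + 1) m', 2 ^ m' * x ^ w
      ≤ ∑ w ∈ Finset.Ico (m + 1) (m' + 1), 2 ^ (2 * m + 1) * (1 / 64 : ℝ) ^ w := by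
        rw [show Finset.Icc (m + 1) m' = Finset.Ico (m + 1) (m' + 1) from by ext; simp]
        refine Finset.sum_le_sum fun w _ => ?_
        gcongr
        norm_num
    _ = 2 ^ (2 * m + 1) * (1 / 64 : ℝ) ^ (m + 1) *
        ∑ w ∈ Finset.range (m' + 1 - (m + 1)), (1 / 64 : ℝ) ^ w := by
        rw [Finset.sum_Ico_eq_sum_range, Finset.mul_sum]
        refine Finset.sum_congr rfl fun w _ => ?_
        rw [pow_add]
        ring
    _ ≤ 2 ^ (2 * m + 1) * (1 / 64 : ℝ) ^ (m + 1) * (64 / 63) := by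
        gcongr
        exact h2 _
    _ = (1 / 16 : ℝ) ^ m * (2 / 63) := by
        rw [show (1 / 16 : ℝ) = 4 * (1 / 64) by norm_num, mul_pow, pow_succ, pow_succ, pow_mul]
        norm_num
        ring
    _ ≤ _ := mul_le_of_le_one_right (by positivity) (by norm_num)

lemma sum_roundSize_le {n R ℓ : ℕ} (hn : 2 ^ (R - 1) ≤ n) (hR : 1 ≤ R) {x : ℝ} (hx0 : 0 ≤ x)
    (hx : x ≤ 1 / 64) :
    ∑ r ∈ Finset.range R, ∑ w ∈ Finset.Icc (roundSize n R ℓ (r + 1) + 1) (roundSize n R ℓ r),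
      2 ^ roundSize n R ℓ r * x ^ w ≤ 2 * (1 / 4 : ℝ) ^ ℓ := by
  have h1 : ∀ r ∈ Finset.range R,
      ∑ w ∈ Finset.Icc (roundSize n R ℓ (r + 1) + 1) (roundSize n R ℓ r),
      2 ^ roundSize n R ℓ r * x ^ w ≤ (1 / 4 : ℝ) ^ (R - 1 - r) * (1 / 4) ^ ℓ := by
    intro r hr
    rw [Finset.mem_range] at hr
    have e1 : roundSize n R ℓ (r + 1) = max (n / 2 ^ (r + 1)) ℓ := if_pos (by omega)
    have e2 : roundSize n R ℓ r = max (n / 2 ^ r) ℓ := if_pos (by omega)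
    have e3 : n / 2 ^ (r + 1) = n / 2 ^ r / 2 := by rw [pow_succ, Nat.div_div_eq_div_mul]
    refine (geom_tail_le hx0 hx _ _ (by
      rw [e1, e2, e3]
      generalize n / 2 ^ r = a
      omega)).trans ?_
    have h3 : R - 1 - r ≤ n / 2 ^ (r + 1) := by
      rcases Nat.lt_or_ge (R - 1) (r + 1) with h | h
      · rw [show R - 1 - r = 0 by omega]
        exact Nat.zero_le _
      · rw [Nat.le_div_iff_mul_le (by positivity)]
        refine le_trans ?_ hn
        have h4 : 2 ^ (R - 1) = 2 ^ (R - 1 - (r + 1)) * 2 ^ (r + 1) := by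
          rw [← pow_add]
          congr 1
          omega
        rw [h4]
        have := Nat.lt_two_pow_self (n := R - 1 - (r + 1))
        exact Nat.mul_le_mul_right _ (by omega)
    rw [← pow_add, show (1 / 16 : ℝ) = (1 / 4) ^ 2 by norm_num, ← pow_mul]
    exact pow_le_pow_of_le_one (by norm_num) (by norm_num) (by
      rw [e1]
      generalize n / 2 ^ (r + 1) = a at h3 ⊢
      omega)
  refine (Finset.sum_le_sum h1).trans ?_
  rw [← Finset.sum_mul]
  refine mul_le_mul_of_nonneg_right ?_ (by positivity)
  rw [Finset.sum_range_reflect (fun j => (1 / 4 : ℝ) ^ j), geom_sum_eq (by norm_num)]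
  have : (0 : ℝ) ≤ (1 / 4) ^ R := by positivity
  rw [div_le_iff_of_neg (by norm_num)]
  linarith

lemma natLog_two_add_one_le {n : ℕ} (hn : 3 ≤ n) : ((Nat.log 2 n + 1 : ℕ) : ℝ) ≤ 3 * Real.log n := by
  have hnR : (3 : ℝ) ≤ n := by exact_mod_cast hn
  have hn0 : (0 : ℝ) < n := by linarith
  have hlog : 1 ≤ Real.log n := by
    rw [Real.le_log_iff_exp_le hn0]
    exact (Real.exp_one_lt_d9.le.trans (by norm_num)).trans hnR
  have h : (2 : ℝ) ^ Nat.log 2 n ≤ n := by exact_mod_cast Nat.pow_log_le_self 2 (by omega)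
  have h2 := Real.log_le_log (by positivity) h
  rw [Real.log_pow] at h2
  have h3 := Real.log_two_gt_d9
  have h4 : (Nat.log 2 n : ℝ) * (1 / 2) ≤ Nat.log 2 n * Real.log 2 := by
    gcongr
    linarith
  push_cast
  linarith

variable {s t : ℕ} {F : Finset (Finset (Fin s))}

open Classical in
/-- Sparsification preserves the existence of a member of a spread family of packings. -/
theorem exists_const_prob_covers (hF : StrictlyOneBalanced F) {k : ℕ} (hk : 2 ≤ k)
    (hFk : ∀ e ∈ F, e.card = k) (hs : 2 ≤ s) (hFt : F.card = t) (ht : 0 < t) (K : ℝ)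
    (hK : 0 ≤ K) :
    ∃ C₀ : ℝ, 1 ≤ C₀ ∧ ∀ C : ℝ, C₀ ≤ C → ∀ ε : ℝ, 0 < ε → ∃ n₀ : ℕ, ∀ n : ℕ, n₀ ≤ n →
      ∀ p : ℝ, p = C * (n : ℝ) ^ (-((s - 1 : ℝ) / t) - 1) * (Real.log n) ^ ((1 : ℝ) / t) →
      p ≤ 1 → ∀ (H : Finset (Fin (t * n) × Finset (Fin (s * n))))
        (𝓕 : Finset (Finset (RainbowCopy F (Fin (t * n)) (Fin (s * n)))))
        (μ : Finset (RainbowCopy F (Fin (t * n)) (Fin (s * n))) → ℝ), (∀ S, 0 ≤ μ S) →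
        ∑ S ∈ 𝓕, μ S = 1 → (∀ S ∈ 𝓕, S.card ≤ n) → (∀ S ∈ 𝓕, ∀ E ∈ S, E.edges ⊆ H) →
        (∀ T, ∑ S ∈ 𝓕, (if T ⊆ S then μ S else 0) ≤
          (K * (n : ℝ) ^ (-(s + t - 1 : ℝ))) ^ T.card) →
        1 - ε ≤ ∑ G ∈ H.powerset, subsetWeight p H G *
          (if ∃ S ∈ 𝓕, ∀ E ∈ S, E.edges ⊆ G then 1 else 0) := by
  obtain ⟨M, hM⟩ := exists_sum_not_fewTouching_le hF hk hFk hs hFt ht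
  have ht0 : (0 : ℝ) < t := by exact_mod_cast ht
  refine ⟨max 1 (768 * 2 ^ M * K), le_max_left _ _, fun C hC ε hε => ?_⟩
  have hC1 : 1 ≤ C := (le_max_left _ _).trans hC
  have hC2 : 768 * 2 ^ M * K ≤ C ^ t :=
    ((le_max_right _ _).trans hC).trans (le_self_pow₀ hC1 (by omega))
  obtain ⟨n₁, hn₁⟩ := hM K C hK hC1 (ε / 3) (by positivity)
  obtain ⟨ℓ, hℓ⟩ := exists_pow_lt_of_lt_one (show (0 : ℝ) < ε / 6 by positivity)
    (show (1 / 4 : ℝ) < 1 by norm_num)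
  have hlim : Filter.Tendsto (fun n : ℕ => Real.log n) Filter.atTop Filter.atTop :=
    Real.tendsto_log_atTop.comp tendsto_natCast_atTop_atTop
  obtain ⟨n₂, hn₂⟩ := Filter.eventually_atTop.1
    (hlim.eventually (Filter.eventually_ge_atTop (2 ^ ℓ * ℓ * 3 / ε)))
  refine ⟨max (max n₁ n₂) 3, fun n hn p hp hp1 H 𝓕 μ hμ hμ1 hn𝓕 hH hspread => ?_⟩
  have hn3 : 3 ≤ n := (le_max_right _ _).trans hn
  have hnR : (3 : ℝ) ≤ n := by exact_mod_cast hn3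
  have hn0 : (0 : ℝ) < n := by linarith
  have hlog : 1 ≤ Real.log n := by
    rw [Real.le_log_iff_exp_le hn0]
    exact (Real.exp_one_lt_d9.le.trans (by norm_num)).trans hnR
  have hp0 : 0 < p := by
    rw [hp]
    positivity
  set y := (n : ℝ) ^ (-(s + t - 1 : ℝ)) with hy
  have hy0 : 0 < y := by positivity
  have hpt : p ^ t = C ^ t * y * Real.log n := by
    rw [hp, mul_pow, mul_pow, ← Real.rpow_natCast (_ ^ _), ← Real.rpow_mul (by linarith),
      ← Real.rpow_natCast (_ ^ _), ← Real.rpow_mul (by linarith)]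
    rw [one_div, inv_mul_cancel₀ ht0.ne', Real.rpow_one, hy]
    congr 3
    field_simp
    ring
  set R := Nat.log 2 n + 1 with hR
  have hR1 : 1 ≤ R := by omega
  have hRlog : (R : ℝ) ≤ 3 * Real.log n := natLog_two_add_one_le hn3
  have hR0 : (0 : ℝ) < R := by exact_mod_cast hR1
  have hrat : ∀ v : ℝ, 0 < v → (p ^ t * (v * (1 / 2) ^ M))⁻¹ * (K * y) =
      2 ^ M * K / (C ^ t * Real.log n * v) := by
    intro v hv
    rw [hpt, one_div, inv_pow]
    field_simp
  have main := one_le_prob_covers_add hp0 hp1 H (roundWeight R) roundWeight_pos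
    (sum_roundWeight hR1) RainbowCopy.edges (t := t)
    (fun E => by rw [RainbowCopy.card_edges, hFt]) M 𝓕 hH μ hμ hμ1 (κ := K * y) (by positivity)
    hspread (roundSize n R ℓ) (fun S hS => (hn𝓕 S hS).trans (by simp [roundSize]))
    (by simp [roundSize]) (FewTouching RainbowCopy.edges M)
    (fun G S _ hg => card_extraCopies_le _ G S M hg)
  have hgood := hn₁ n ((le_max_left _ _).trans ((le_max_left _ _).trans hn)) p hp hp1 H 𝓕 μ hμ
    hspread
  have hlast : roundWeight R (Fin.last (R + 1)) = 1 / 2 := by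
    rw [roundWeight, if_neg (by simp), if_neg (by simp)]
  have hmid : roundWeight R (Fin.last R).castSucc = 1 / 4 := by
    rw [roundWeight, if_neg (by simp), if_pos (by simp)]
  have hfst : ∀ i : Fin R, roundWeight R i.castSucc.castSucc = 1 / (4 * R) := fun i => by
    rw [roundWeight, if_pos (by simp)]
  rw [Fin.sum_univ_castSucc] at main
  simp only [hlast, hmid, hfst, hrat _ (show (0 : ℝ) < 1 / 4 by norm_num),
    hrat _ (show (0 : ℝ) < 1 / (4 * R) by positivity), Fin.val_castSucc, Fin.val_last] at main
  have hC0 : 0 < C ^ t := by positivity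
  have hx1 : 2 ^ M * K / (C ^ t * Real.log n * (1 / (4 * R))) ≤ 1 / 64 := by
    rw [div_le_iff₀ (by positivity)]
    have h1 : 2 ^ M * K * (4 * R) * 64 ≤ C ^ t * Real.log n := by
      calc 2 ^ M * K * (4 * R) * 64 ≤ 2 ^ M * K * (4 * (3 * Real.log n)) * 64 := by gcongr
        _ = 768 * 2 ^ M * K * Real.log n := by ring
        _ ≤ _ := by gcongr
    have h2 : C ^ t * Real.log n * (1 / (4 * R)) * (4 * R) = C ^ t * Real.log n := by
      field_simp
    have h3 : (0 : ℝ) < 4 * R := by positivity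
    nlinarith
  have hx2 : 2 ^ M * K / (C ^ t * Real.log n * (1 / 4)) ≤ 1 / Real.log n := by
    rw [div_le_div_iff₀ (by positivity) (by linarith)]
    have : 0 ≤ 2 ^ M * K := by positivity
    nlinarith
  have hs1 := sum_roundSize_le (n := n) (R := R) (ℓ := ℓ)
    (by rw [hR, Nat.add_sub_cancel]; exact Nat.pow_log_le_self 2 (by omega)) hR1
    (x := 2 ^ M * K / (C ^ t * Real.log n * (1 / (4 * R)))) (by positivity) hx1
  have hs2 : ∑ w ∈ Finset.Icc (roundSize n R ℓ (R + 1) + 1) (roundSize n R ℓ R),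
      2 ^ roundSize n R ℓ R * (2 ^ M * K / (C ^ t * Real.log n * (1 / 4))) ^ w ≤ ε / 3 := by
    have e1 : roundSize n R ℓ (R + 1) = 0 := if_neg (by omega)
    have e2 : roundSize n R ℓ R = ℓ := by
      rw [roundSize, if_pos le_rfl, Nat.div_eq_of_lt (Nat.lt_pow_succ_log_self (by norm_num) n)]
      simp
    rw [e1, e2]
    have hx3 : 1 / Real.log n ≤ 1 := by
      rw [div_le_one (by linarith)]
      exact hlog
    calc _ ≤ ∑ w ∈ Finset.Icc (0 + 1) ℓ, (2 : ℝ) ^ ℓ * (1 / Real.log n) := by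
          refine Finset.sum_le_sum fun w hw => ?_
          have hw1 : 1 ≤ w := by simpa using (Finset.mem_Icc.1 hw).1
          refine mul_le_mul_of_nonneg_left ?_ (by positivity)
          refine (pow_le_of_le_one (by positivity) (hx2.trans hx3) (by omega)).trans hx2
      _ = 2 ^ ℓ * ℓ / Real.log n := by
          rw [Finset.sum_const, Nat.card_Icc, nsmul_eq_mul]
          simp
          ring
      _ ≤ ε / 3 := by
          have := hn₂ n ((le_max_right _ _).trans ((le_max_left _ _).trans hn))
          rw [div_le_iff₀ hε] at this
          rw [div_le_div_iff₀ (by linarith) (by norm_num)]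
          linarith
  rw [Fin.sum_univ_eq_sum_range (fun r => ∑ w ∈ Finset.Icc (roundSize n R ℓ (r + 1) + 1)
    (roundSize n R ℓ r), 2 ^ roundSize n R ℓ r *
      (2 ^ M * K / (C ^ t * Real.log n * (1 / (4 * R)))) ^ w) R] at main
  linarith

end Rounds

section Cube

variable {V : Type*} [DecidableEq V]

lemma exp_add_exp_le (a b c : ℝ) (h : |b - a| ≤ c) :
    Real.exp a + Real.exp b ≤ 2 * Real.exp ((a + b) / 2 + c ^ 2 / 8) := by
  have h1 : Real.exp a + Real.exp b = 2 * Real.exp ((a + b) / 2) * Real.cosh ((b - a) / 2) := by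
    rw [Real.cosh_eq, show 2 * Real.exp ((a + b) / 2) *
      ((Real.exp ((b - a) / 2) + Real.exp (-((b - a) / 2))) / 2) =
      Real.exp ((a + b) / 2) * Real.exp (-((b - a) / 2)) +
      Real.exp ((a + b) / 2) * Real.exp ((b - a) / 2) by ring, ← Real.exp_add, ← Real.exp_add]
    congr 2 <;> ring_nf
  have h2 := Real.cosh_le_exp_half_sq ((b - a) / 2)
  have h3 : (b - a) ^ 2 ≤ c ^ 2 := by
    rw [← sq_abs]
    gcongr
  rw [h1, Real.exp_add, ← mul_assoc]
  refine mul_le_mul_of_nonneg_left (h2.trans (Real.exp_le_exp.2 ?_)) (by positivity)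
  rw [div_pow]
  linarith

lemma sum_powerset_exp_le (A : Finset V) (f : Finset V → ℝ) (c l : ℝ)
    (hf : ∀ x L, |f (insert x L) - f L| ≤ c) :
    ∑ L ∈ A.powerset, Real.exp (l * f L) ≤ 2 ^ A.card *
      Real.exp (l * ((∑ L ∈ A.powerset, f L) / 2 ^ A.card) + l ^ 2 * c ^ 2 * A.card / 8) := by
  induction A using Finset.induction_on generalizing f with
  | empty => simp
  | insert x A hx ih =>
    rw [Finset.sum_powerset_insert hx, Finset.sum_powerset_insert hx, ← Finset.sum_add_distrib,
      ← Finset.sum_add_distrib, Finset.card_insert_of_notMem hx]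
    have hc : 0 ≤ c := (abs_nonneg _).trans (hf x ∅)
    have h1 := ih (fun L => (f L + f (insert x L)) / 2) fun y L => by
      have e1 := abs_le.1 (hf y L)
      have e2 := abs_le.1 (hf y (insert x L))
      rw [Finset.insert_comm] at e2
      rw [abs_le]
      constructor <;> linarith [e1.1, e1.2, e2.1, e2.2]
    calc ∑ L ∈ A.powerset, (Real.exp (l * f L) + Real.exp (l * f (insert x L)))
        ≤ ∑ L ∈ A.powerset, 2 * Real.exp (l ^ 2 * c ^ 2 / 8) *
          Real.exp (l * ((f L + f (insert x L)) / 2)) := by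
          refine Finset.sum_le_sum fun L _ => ?_
          have h2 := exp_add_exp_le (l * f L) (l * f (insert x L)) (|l| * c) (by
            rw [← mul_sub, abs_mul]
            exact mul_le_mul_of_nonneg_left (hf x L) (abs_nonneg _))
          refine h2.trans (le_of_eq ?_)
          rw [mul_assoc, ← Real.exp_add, mul_pow, sq_abs]
          congr 2
          ring
      _ ≤ 2 * Real.exp (l ^ 2 * c ^ 2 / 8) * (2 ^ A.card * Real.exp (l *
          ((∑ L ∈ A.powerset, (f L + f (insert x L)) / 2) / 2 ^ A.card) +
          l ^ 2 * c ^ 2 * A.card / 8)) := by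
          rw [← Finset.mul_sum]
          exact mul_le_mul_of_nonneg_left h1 (by positivity)
      _ = _ := by
          rw [← Finset.sum_div, show 2 * Real.exp (l ^ 2 * c ^ 2 / 8) * (2 ^ A.card * Real.exp (l *
            ((∑ L ∈ A.powerset, (f L + f (insert x L))) / 2 / 2 ^ A.card) +
            l ^ 2 * c ^ 2 * A.card / 8)) = 2 ^ (A.card + 1) * (Real.exp (l ^ 2 * c ^ 2 / 8) *
            Real.exp (l * ((∑ L ∈ A.powerset, (f L + f (insert x L))) / 2 / 2 ^ A.card) +
            l ^ 2 * c ^ 2 * A.card / 8)) by ring, ← Real.exp_add]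
          congr 2
          rw [pow_succ]
          push_cast
          field_simp
          ring

/-- The bounded differences inequality on the discrete cube. -/
lemma card_powerset_filter_le (A : Finset V) (hA : 0 < A.card) (f : Finset V → ℝ) {c τ : ℝ}
    (hc : 0 < c) (hτ : 0 ≤ τ) (hf : ∀ x L, |f (insert x L) - f L| ≤ c) :
    ((A.powerset.filter fun L => f L ≤ (∑ L ∈ A.powerset, f L) / 2 ^ A.card - τ).card : ℝ) ≤
      2 ^ A.card * Real.exp (-(2 * τ ^ 2 / (c ^ 2 * A.card))) := by
  have hA' : (0 : ℝ) < A.card := by exact_mod_cast hA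
  set E := (∑ L ∈ A.powerset, f L) / 2 ^ A.card with hE
  set l := -(4 * τ / (c ^ 2 * A.card)) with hl
  have hl0 : l ≤ 0 := by
    rw [hl, neg_nonpos]
    positivity
  have h1 := sum_powerset_exp_le A f c l hf
  have h2 : ((A.powerset.filter fun L => f L ≤ E - τ).card : ℝ) * Real.exp (l * (E - τ)) ≤
      ∑ L ∈ A.powerset, Real.exp (l * f L) := by
    rw [← nsmul_eq_mul, ← Finset.sum_const]
    refine (Finset.sum_le_sum fun L hL => ?_).trans
      (Finset.sum_le_sum_of_subset_of_nonneg (Finset.filter_subset _ _) fun _ _ _ => by positivity)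
    exact Real.exp_le_exp.2 (mul_le_mul_of_nonpos_left (Finset.mem_filter.1 hL).2 hl0)
  have h3 := h2.trans h1
  rw [← hE] at h3
  rw [← le_div_iff₀ (Real.exp_pos _), mul_div_assoc, ← Real.exp_sub] at h3
  refine h3.trans (le_of_eq ?_)
  congr 2
  rw [hl]
  field_simp
  ring

lemma card_filter_powerset_superset {A Y : Finset V} (hY : Y ⊆ A) :
    (A.powerset.filter fun L => Y ⊆ L).card = 2 ^ (A.card - Y.card) := by
  rw [← Finset.card_sdiff_of_subset hY, ← Finset.card_powerset]
  refine Finset.card_bij' (fun L _ => L \ Y) (fun L _ => L ∪ Y) ?_ ?_ ?_ ?_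
  · intro L hL
    simp only [Finset.mem_filter, Finset.mem_powerset] at hL ⊢
    exact Finset.sdiff_subset_sdiff hL.1 le_rfl
  · intro L hL
    simp only [Finset.mem_filter, Finset.mem_powerset] at hL ⊢
    exact ⟨Finset.union_subset (hL.trans Finset.sdiff_subset) hY, Finset.subset_union_right⟩
  · intro L hL
    simp only [Finset.mem_filter, Finset.mem_powerset] at hL ⊢
    exact Finset.sdiff_union_of_subset hL.2
  · intro L hL
    simp only [Finset.mem_powerset] at hL ⊢
    rw [Finset.union_sdiff_right]
    exact Finset.sdiff_eq_self_of_disjoint (Finset.disjoint_of_subset_left hL Finset.sdiff_disjoint)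

/-- Few subsets `L` of `A` contain substantially fewer than the expected number of links. -/
lemma card_link_deviation_le {A D : Finset V} {G : Finset (Finset V)} {ℓ : ℕ} (hℓ : 1 ≤ ℓ)
    (hA : 0 < A.card) (hG : ∀ e ∈ G, D ⊆ e ∧ e ⊆ A ∧ (e \ D).card = ℓ) {τ : ℝ} (hτ : 0 ≤ τ) :
    ((A.powerset.filter fun L => ((G.filter fun e => e \ D ⊆ L).card : ℝ) ≤
      (G.card : ℝ) / 2 ^ ℓ - τ * (A.card : ℝ) ^ ℓ).card : ℝ) ≤
      2 ^ A.card * Real.exp (-(2 * τ ^ 2 * A.card)) := by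
  have hA' : (0 : ℝ) < A.card := by exact_mod_cast hA
  have hmean : (∑ L ∈ A.powerset, ((G.filter fun e => e \ D ⊆ L).card : ℝ)) / 2 ^ A.card =
      (G.card : ℝ) / 2 ^ ℓ := by
    have h1 : ∑ L ∈ A.powerset, (G.filter fun e => e \ D ⊆ L).card = G.card * 2 ^ (A.card - ℓ) := by
      simp_rw [Finset.card_filter]
      rw [Finset.sum_comm]
      simp_rw [← Finset.card_filter]
      rw [Finset.sum_congr rfl fun e he => ?_, Finset.sum_const, smul_eq_mul]
      rw [card_filter_powerset_superset (Finset.sdiff_subset.trans (hG e he).2.1), (hG e he).2.2]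
    rw [← Nat.cast_sum, h1]
    rcases G.eq_empty_or_nonempty with rfl | ⟨e, he⟩
    · simp
    have hle : ℓ ≤ A.card := by
      rw [← (hG e he).2.2]
      exact Finset.card_le_card (Finset.sdiff_subset.trans (hG e he).2.1)
    rw [div_eq_div_iff (by positivity) (by positivity)]
    push_cast
    rw [mul_assoc, ← pow_add, Nat.sub_add_cancel hle]
  have hlip : ∀ x L, |((G.filter fun e => e \ D ⊆ insert x L).card : ℝ) -
      (G.filter fun e => e \ D ⊆ L).card| ≤ (A.card : ℝ) ^ (ℓ - 1) := by
    intro x L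
    have hsub : (G.filter fun e => e \ D ⊆ L) ⊆ G.filter fun e => e \ D ⊆ insert x L :=
      Finset.monotone_filter_right _ fun e _ he => he.trans (Finset.subset_insert _ _)
    have h2 : ((G.filter fun e => e \ D ⊆ insert x L).card : ℝ) -
        (G.filter fun e => e \ D ⊆ L).card = (((G.filter fun e => e \ D ⊆ insert x L) \
          (G.filter fun e => e \ D ⊆ L)).card : ℝ) := by
      rw [Finset.card_sdiff_of_subset hsub, Nat.cast_sub (Finset.card_le_card hsub)]
    rw [h2, abs_of_nonneg (by positivity)]
    have hmem : ∀ e ∈ (G.filter fun e => e \ D ⊆ insert x L) \ (G.filter fun e => e \ D ⊆ L),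
        e ∈ G ∧ x ∈ e \ D := by
      intro e he
      simp only [Finset.mem_sdiff, Finset.mem_filter, not_and] at he
      refine ⟨he.1.1, ?_⟩
      by_contra hx
      exact he.2 he.1.1 ((Finset.subset_insert_iff_of_notMem hx).1 he.1.2)
    have h3 : ((G.filter fun e => e \ D ⊆ insert x L) \ (G.filter fun e => e \ D ⊆ L)).card ≤
        (A.powersetCard (ℓ - 1)).card := by
      refine Finset.card_le_card_of_injOn (fun e => (e \ D).erase x) ?_ ?_
      · intro e he
        obtain ⟨heG, hx⟩ := hmem e he
        rw [Finset.mem_coe, Finset.mem_powersetCard, Finset.card_erase_of_mem hx, (hG e heG).2.2]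
        exact ⟨(Finset.erase_subset _ _).trans (Finset.sdiff_subset.trans (hG e heG).2.1), rfl⟩
      · intro e he e' he' hee
        obtain ⟨heG, hx⟩ := hmem e he
        obtain ⟨heG', hx'⟩ := hmem e' he'
        have h4 : e \ D = e' \ D := by
          rw [← Finset.insert_erase hx, ← Finset.insert_erase hx']
          exact congrArg _ hee
        rw [← Finset.sdiff_union_of_subset (hG e heG).1, h4,
          Finset.sdiff_union_of_subset (hG e' heG').1]
    rw [Finset.card_powersetCard] at h3
    exact_mod_cast h3.trans (Nat.choose_le_pow _ _)
  have h := card_powerset_filter_le A hA (fun L => ((G.filter fun e => e \ D ⊆ L).card : ℝ))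
    (c := (A.card : ℝ) ^ (ℓ - 1)) (τ := τ * (A.card : ℝ) ^ ℓ) (by positivity) (by positivity) hlip
  rw [hmean] at h
  refine h.trans (le_of_eq ?_)
  congr 3
  obtain ⟨r, rfl⟩ : ∃ r, ℓ = r + 1 := ⟨ℓ - 1, by omega⟩
  rw [Nat.add_sub_cancel]
  field_simp
  rw [pow_succ]
  ring

end Cube

section Choose

lemma two_pow_le_choose_mul {r m : ℕ} :
    2 ^ (r * m) ≤ (r * m + 1) ^ (r + 1) * (r * m).choose (r * (m / 2)) := by
  have h1 : 2 ^ (r * m) ≤ (r * m + 1) * (r * m).choose (r * m / 2) := by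
    rw [← Nat.sum_range_choose]
    refine (Finset.sum_le_sum fun i _ => Nat.choose_le_middle i _).trans ?_
    simp
  have h2 : ∀ N a i : ℕ, N.choose (a + i) ≤ (N + 1) ^ i * N.choose a := by
    intro N a i
    induction i with
    | zero => simp
    | succ i ih =>
      have h3 := Nat.choose_succ_right_eq N (a + i)
      calc N.choose (a + (i + 1)) ≤ N.choose (a + i + 1) * (a + i + 1) :=
            Nat.le_mul_of_pos_right _ (by omega)
        _ = N.choose (a + i) * (N - (a + i)) := h3
        _ ≤ ((N + 1) ^ i * N.choose a) * (N + 1) := Nat.mul_le_mul ih (by omega)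
        _ = _ := by ring
  have h4 : r * (m / 2) ≤ r * m / 2 := by
    rw [Nat.le_div_iff_mul_le (by norm_num), mul_assoc]
    exact Nat.mul_le_mul_left _ (Nat.div_mul_le_self _ _)
  have h5 : r * m / 2 ≤ r * (m / 2) + r := by
    have : r * m ≤ r * (2 * (m / 2) + 1) := Nat.mul_le_mul_left _ (by omega)
    have h6 : r * (2 * (m / 2) + 1) = 2 * (r * (m / 2)) + r := by ring
    omega
  have h7 := h2 (r * m) (r * (m / 2)) (r * m / 2 - r * (m / 2))
  rw [Nat.add_sub_cancel' h4] at h7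
  calc 2 ^ (r * m) ≤ _ := h1
    _ ≤ (r * m + 1) * ((r * m + 1) ^ r * (r * m).choose (r * (m / 2))) := by
      refine Nat.mul_le_mul_left _ (h7.trans (Nat.mul_le_mul_right _ ?_))
      exact Nat.pow_le_pow_right (by omega) (by omega)
    _ = _ := by ring

lemma choose_mul_pow_le (M x y₁ y₂ b : ℕ) (h1 : x + y₁ ≤ b) (h2 : M + y₂ ≤ x + b) :
    M.choose x * M ^ (y₁ + y₂) ≤ (M + (y₁ + y₂)).choose (x + y₁) * b ^ (y₁ + y₂) := by
  induction y₁ with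
  | zero =>
    simp only [zero_add, add_zero]
    induction y₂ with
    | zero => simp
    | succ y ih =>
      have h3 := Nat.choose_mul_succ_eq (M + y) x
      have h4 : M + y + 1 - x ≤ b := by omega
      calc M.choose x * M ^ (y + 1) = (M.choose x * M ^ y) * M := by ring
        _ ≤ ((M + y).choose x * b ^ y) * (M + y + 1) := Nat.mul_le_mul (ih (by omega)) (by omega)
        _ = ((M + y).choose x * (M + y + 1)) * b ^ y := by ring
        _ = ((M + y + 1).choose x * (M + y + 1 - x)) * b ^ y := by rw [h3]
        _ ≤ ((M + y + 1).choose x * b) * b ^ y := by gcongr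
        _ = _ := by rw [← add_assoc]; ring
  | succ y ih =>
    have h3 := Nat.add_one_mul_choose_eq (M + (y + y₂)) (x + y)
    calc M.choose x * M ^ (y + 1 + y₂) = (M.choose x * M ^ (y + y₂)) * M := by ring
      _ ≤ ((M + (y + y₂)).choose (x + y) * b ^ (y + y₂)) * (M + (y + y₂) + 1) :=
        Nat.mul_le_mul (ih (by omega)) (by omega)
      _ = ((M + (y + y₂) + 1) * (M + (y + y₂)).choose (x + y)) * b ^ (y + y₂) := by ring
      _ = ((M + (y + y₂) + 1).choose (x + y + 1) * (x + y + 1)) * b ^ (y + y₂) := by rw [h3]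
      _ ≤ ((M + (y + y₂) + 1).choose (x + y + 1) * b) * b ^ (y + y₂) := by
        gcongr
        omega
      _ = _ := by
        rw [show M + (y + 1 + y₂) = M + (y + y₂) + 1 by ring, ← add_assoc]
        ring

end Choose

section Levels

lemma eventually_mul_pow_le_exp (c a ε : ℝ) (ha : 0 < a) (hε : 0 < ε) :
    ∀ᶠ j : ℕ in Filter.atTop, c * a ^ j ≤ Real.exp (ε * (9 / 8 : ℝ) ^ j) := by
  have h1 := tendsto_pow_const_div_const_pow_of_one_lt 1 (show (1 : ℝ) < 9 / 8 by norm_num)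
  have hb : 0 < |c| + |Real.log a| + 1 := by positivity
  filter_upwards [h1.eventually (gt_mem_nhds (show 0 < ε / (|c| + |Real.log a| + 1) by positivity)),
    Filter.eventually_ge_atTop 1] with j hj hj1
  have hj1' : (1 : ℝ) ≤ j := by exact_mod_cast hj1
  rw [pow_one, div_lt_div_iff₀ (by positivity) hb] at hj
  have h2 : c ≤ Real.exp |c| := (le_abs_self c).trans (by linarith [Real.add_one_le_exp |c|])
  have h3 : a ^ j ≤ Real.exp (j * |Real.log a|) := by
    rw [← Real.log_le_iff_le_exp (by positivity), Real.log_pow]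
    gcongr
    exact le_abs_self _
  calc c * a ^ j ≤ Real.exp |c| * Real.exp (j * |Real.log a|) := by gcongr
    _ = Real.exp (|c| + j * |Real.log a|) := (Real.exp_add _ _).symm
    _ ≤ _ := by
      refine Real.exp_le_exp.2 ?_
      have := abs_nonneg c
      nlinarith

lemma eventually_choose_le (r : ℕ) (hr : 1 ≤ r) : ∀ᶠ j : ℕ in Filter.atTop, ∀ m u₁ u₂ : ℕ,
    2 ^ j ≤ m → m ≤ 2 ^ (j + 1) → u₁ ≤ m / 2 → u₂ ≤ m - m / 2 →
    ((r * (m - (u₁ + u₂))).choose (r * (m / 2 - u₁)) : ℝ) * 2 ^ (r * (u₁ + u₂)) ≤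
      (1 + 4 * (3 / 4 : ℝ) ^ j) ^ (r * (u₁ + u₂)) * (r * m).choose (r * (m / 2)) := by
  filter_upwards [eventually_mul_pow_le_exp ((3 * r : ℝ) ^ (r + 1)) (2 ^ (r + 1)) 1 (by positivity)
    one_pos, Filter.eventually_ge_atTop 3] with j hj hj3 m u₁ u₂ hm1 hm2 hu₁ hu₂
  set x := (3 / 4 : ℝ) ^ j with hx
  have hx0 : 0 < x := by positivity
  have hx1 : x ≤ 1 / 2 := by
    calc x ≤ (3 / 4) ^ 3 := pow_le_pow_of_le_one (by norm_num) (by norm_num) hj3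
      _ ≤ _ := by norm_num
  have hr0 : (0 : ℝ) < r := by exact_mod_cast hr
  have hm0 : (2 : ℝ) ^ j ≤ m := by exact_mod_cast hm1
  have hmx : 1 ≤ x * m := by
    calc (1 : ℝ) ≤ (3 / 2) ^ j := one_le_pow₀ (by norm_num)
      _ = x * 2 ^ j := by rw [hx, ← mul_pow]; norm_num
      _ ≤ _ := by gcongr
  set u := u₁ + u₂ with hu
  have hum : u ≤ m := by omega
  by_cases hcase : (u : ℝ) ≤ x * m
  · have h1 := choose_mul_pow_le (r * (m - u)) (r * (m / 2 - u₁)) (r * u₁) (r * u₂)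
      (r * (m - m / 2)) (by
        rw [← mul_add]
        exact Nat.mul_le_mul_left _ (by omega)) (by
        rw [← mul_add, ← mul_add]
        exact Nat.mul_le_mul_left _ (by omega))
    rw [← mul_add, ← mul_add, ← mul_add, ← hu, Nat.sub_add_cancel hum,
      Nat.sub_add_cancel hu₁] at h1
    have h1' : ((r * (m - u)).choose (r * (m / 2 - u₁)) : ℝ) * ((r * (m - u) : ℕ) : ℝ) ^ (r * u) ≤
        (r * m).choose (r * (m / 2)) * ((r * (m - m / 2) : ℕ) : ℝ) ^ (r * u) := by
      exact_mod_cast h1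
    have hM : ((r * (m - u) : ℕ) : ℝ) = r * (m - u) := by
      push_cast [hum]
      ring
    have hb : 2 * ((r * (m - m / 2) : ℕ) : ℝ) ≤ r * (m + 1) := by
      have : 2 * (m - m / 2) ≤ m + 1 := by omega
      have h2 : (2 : ℝ) * ((m - m / 2 : ℕ) : ℝ) ≤ m + 1 := by exact_mod_cast this
      push_cast only [Nat.cast_mul]
      nlinarith
    have hM0 : (0 : ℝ) < ((r * (m - u) : ℕ) : ℝ) := by
      rw [hM]
      have : (0 : ℝ) < m - u := by nlinarith
      positivity
    have hbM : 2 * ((r * (m - m / 2) : ℕ) : ℝ) ≤ (1 + 4 * x) * ((r * (m - u) : ℕ) : ℝ) := by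
      rw [hM]
      refine hb.trans ?_
      have h3 : (m : ℝ) + 1 ≤ (1 + 4 * x) * (m - u) := by
        have h4 : (1 + 4 * x) * (m - x * m) ≤ (1 + 4 * x) * (m - u) := by gcongr
        have h5 : 0 ≤ x * m * (1 - 2 * x) := by
          have : 0 ≤ 1 - 2 * x := by linarith
          positivity
        nlinarith
      nlinarith
    refine le_of_mul_le_mul_right ?_ (pow_pos hM0 (r * u))
    calc _ = ((r * (m - u)).choose (r * (m / 2 - u₁)) : ℝ) * ((r * (m - u) : ℕ) : ℝ) ^ (r * u) *
          2 ^ (r * u) := by ring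
      _ ≤ (r * m).choose (r * (m / 2)) * ((r * (m - m / 2) : ℕ) : ℝ) ^ (r * u) * 2 ^ (r * u) := by
          gcongr
      _ = (r * m).choose (r * (m / 2)) * (2 * ((r * (m - m / 2) : ℕ) : ℝ)) ^ (r * u) := by
          rw [mul_pow]
          ring
      _ ≤ (r * m).choose (r * (m / 2)) * ((1 + 4 * x) * ((r * (m - u) : ℕ) : ℝ)) ^ (r * u) := by
          gcongr
      _ = _ := by
          rw [mul_pow]
          ring
  · push Not at hcase
    have h1 : ((r * (m - u)).choose (r * (m / 2 - u₁)) : ℝ) ≤ 2 ^ (r * (m - u)) := by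
      exact_mod_cast Nat.choose_le_two_pow _ _
    have h2 : (2 : ℝ) ^ (r * m) ≤
        ((r * m : ℕ) + 1) ^ (r + 1) * (r * m).choose (r * (m / 2)) := by
      exact_mod_cast two_pow_le_choose_mul (r := r) (m := m)
    have h3 : (((r * m : ℕ) : ℝ) + 1) ^ (r + 1) ≤ (1 + 4 * x) ^ (r * u) := by
      have h4 : ((r * m : ℕ) : ℝ) + 1 ≤ 3 * r * 2 ^ j := by
        have h5 : (m : ℝ) ≤ 2 * 2 ^ j := by
          have : (m : ℝ) ≤ 2 ^ (j + 1) := by exact_mod_cast hm2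
          rw [pow_succ] at this
          linarith
        have h6 : (1 : ℝ) ≤ r * 2 ^ j := by exact_mod_cast Nat.mul_pos hr (by positivity)
        push_cast
        nlinarith
      have h7 : Real.exp x ≤ 1 + 4 * x := by
        have := Real.abs_exp_sub_one_sub_id_le (x := x) (by rw [abs_of_pos hx0]; linarith)
        have := (abs_le.1 this).2
        nlinarith
      calc (((r * m : ℕ) : ℝ) + 1) ^ (r + 1) ≤ (3 * r * 2 ^ j) ^ (r + 1) := by gcongr
        _ = (3 * r : ℝ) ^ (r + 1) * (2 ^ (r + 1)) ^ j := by
          rw [mul_pow, ← pow_mul, ← pow_mul, mul_comm j]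
        _ ≤ Real.exp (1 * (9 / 8 : ℝ) ^ j) := hj
        _ ≤ Real.exp (u * x) := by
          refine Real.exp_le_exp.2 ?_
          calc 1 * (9 / 8 : ℝ) ^ j = x * 2 ^ j * x := by
                rw [hx, mul_right_comm, ← mul_pow, ← mul_pow]
                norm_num
            _ ≤ x * m * x := by gcongr
            _ ≤ _ := by gcongr
        _ = Real.exp x ^ u := by rw [← Real.exp_nat_mul]
        _ ≤ (1 + 4 * x) ^ u := by gcongr
        _ ≤ _ := pow_le_pow_right₀ (by linarith) (Nat.le_mul_of_pos_left _ hr)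
    calc _ ≤ (2 : ℝ) ^ (r * (m - u)) * 2 ^ (r * u) := by gcongr
      _ = 2 ^ (r * m) := by rw [← pow_add, ← mul_add, Nat.sub_add_cancel hum]
      _ ≤ _ := h2
      _ ≤ _ := by gcongr

lemma eventually_deviation_le (s t d : ℕ) (hs : 1 ≤ s) : ∀ᶠ j : ℕ in Filter.atTop, ∀ m : ℕ,
    2 ^ j ≤ m → m ≤ 2 ^ (j + 1) →
    2 * (t * m : ℝ) * (s * m : ℝ) ^ d *
      (2 ^ (s * m) * Real.exp (-(2 * ((3 / 4 : ℝ) ^ j) ^ 2 * (s * m)))) ≤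
      (3 / 4 : ℝ) ^ j * (s * m).choose (s * (m / 2)) := by
  filter_upwards [eventually_mul_pow_le_exp (4 * t * (2 * s) ^ d * (3 * s) ^ (s + 1))
    (2 * 2 ^ d * 2 ^ (s + 1) * (4 / 3)) 2 (by positivity) two_pos] with j hj m hm1 hm2
  have hs0 : (1 : ℝ) ≤ s := by exact_mod_cast hs
  have hm0 : (2 : ℝ) ^ j ≤ m := by exact_mod_cast hm1
  have hm3 : (m : ℝ) ≤ 2 * 2 ^ j := by
    have : (m : ℝ) ≤ 2 ^ (j + 1) := by exact_mod_cast hm2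
    rw [pow_succ] at this
    linarith
  have h2 : (2 : ℝ) ^ (s * m) ≤
      ((s * m : ℕ) + 1) ^ (s + 1) * (s * m).choose (s * (m / 2)) := by
    exact_mod_cast two_pow_le_choose_mul (r := s) (m := m)
  have h3 : Real.exp (-(2 * ((3 / 4 : ℝ) ^ j) ^ 2 * (s * m))) ≤
      (Real.exp (2 * (9 / 8 : ℝ) ^ j))⁻¹ := by
    rw [← Real.exp_neg]
    refine Real.exp_le_exp.2 (neg_le_neg ?_)
    calc 2 * (9 / 8 : ℝ) ^ j = 2 * ((3 / 4 : ℝ) ^ j) ^ 2 * (1 * 2 ^ j) := by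
          rw [← pow_mul, mul_comm j, pow_mul, one_mul, mul_assoc, ← mul_pow]
          norm_num
      _ ≤ _ := by gcongr
  have h4 : ((s * m : ℕ) : ℝ) + 1 ≤ 3 * s * 2 ^ j := by
    have h6 : (1 : ℝ) ≤ s * 2 ^ j := by exact_mod_cast Nat.mul_pos hs (by positivity)
    push_cast
    nlinarith
  have h5 : 2 * (t * m : ℝ) * (s * m : ℝ) ^ d * ((s * m : ℕ) + 1) ^ (s + 1) ≤
      (3 / 4 : ℝ) ^ j * Real.exp (2 * (9 / 8 : ℝ) ^ j) := by
    calc _ ≤ 2 * (t * (2 * 2 ^ j) : ℝ) * (s * (2 * 2 ^ j) : ℝ) ^ d * (3 * s * 2 ^ j) ^ (s + 1) := by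
          gcongr
      _ = (3 / 4 : ℝ) ^ j * (4 * t * (2 * s) ^ d * (3 * s) ^ (s + 1) *
          (2 * 2 ^ d * 2 ^ (s + 1) * (4 / 3)) ^ j) := by
          have e : ((3 : ℝ) / 4) ^ j * (4 / 3) ^ j = 1 := by
            rw [← mul_pow]
            norm_num
          simp only [mul_pow]
          rw [← pow_mul 2 d j, ← pow_mul 2 (s + 1) j, ← pow_mul 2 j d, ← pow_mul 2 j (s + 1),
            mul_comm j d, mul_comm j (s + 1)]
          linear_combination (-(4 * t * (2 ^ d * s ^ d) * (3 ^ (s + 1) * s ^ (s + 1)) *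
            (2 ^ j * 2 ^ (d * j) * 2 ^ ((s + 1) * j))) : ℝ) * e
      _ ≤ _ := by gcongr
  calc _ ≤ 2 * (t * m : ℝ) * (s * m : ℝ) ^ d *
        (((s * m : ℕ) + 1) ^ (s + 1) * (s * m).choose (s * (m / 2)) *
          (Real.exp (2 * (9 / 8 : ℝ) ^ j))⁻¹) := by gcongr
    _ = 2 * (t * m : ℝ) * (s * m : ℝ) ^ d * ((s * m : ℕ) + 1) ^ (s + 1) *
        (Real.exp (2 * (9 / 8 : ℝ) ^ j))⁻¹ * (s * m).choose (s * (m / 2)) := by ring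
    _ ≤ (3 / 4 : ℝ) ^ j * Real.exp (2 * (9 / 8 : ℝ) ^ j) *
        (Real.exp (2 * (9 / 8 : ℝ) ^ j))⁻¹ * (s * m).choose (s * (m / 2)) := by gcongr
    _ = _ := by
      rw [mul_inv_cancel_right₀ (Real.exp_ne_zero _)]

end Levels

section Packings

variable {s : ℕ} {F : Finset (Finset (Fin s))} {I V : Type*} [DecidableEq I] [DecidableEq V]

/-- The vertices of a rainbow copy. -/
def RainbowCopy.verts (E : RainbowCopy F I V) : Finset V := Finset.univ.map E.1

/-- The colours of a rainbow copy. -/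
def RainbowCopy.cols (E : RainbowCopy F I V) : Finset I := Finset.univ.map E.2

lemma RainbowCopy.card_verts (E : RainbowCopy F I V) : E.verts.card = s := by
  simp [RainbowCopy.verts]

lemma RainbowCopy.card_cols (E : RainbowCopy F I V) : E.cols.card = F.card := by
  simp [RainbowCopy.cols]

/-- Rainbow copies sharing neither vertices nor colours. -/
def RainbowCopy.Separated (E E' : RainbowCopy F I V) : Prop :=
  Disjoint E.verts E'.verts ∧ Disjoint E.cols E'.cols

/-- The rainbow copy has its vertices in `A` and its colours in `B`. -/
def RainbowCopy.LiesIn (E : RainbowCopy F I V) (A : Finset V) (B : Finset I) : Prop :=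
  E.verts ⊆ A ∧ E.cols ⊆ B

/-- Pairwise separated rainbow copies of `F` inside the system `H`, with vertices in `A` and
colours in `B`. -/
def IsPacking (H : I → Finset (Finset V)) (A : Finset V) (B : Finset I)
    (S : Finset (RainbowCopy F I V)) : Prop :=
  (∀ E ∈ S, E.LiesIn A B ∧ ∀ e, e.1.image E.1 ∈ H (E.2 e)) ∧
    (S : Set (RainbowCopy F I V)).Pairwise RainbowCopy.Separated

variable [Fintype I] [Fintype V]

open Classical in
/-- There is a `κ`-spread probability measure on the packings of size `m` in `(A, B)`. -/
def HasSpread (F : Finset (Finset (Fin s))) (H : I → Finset (Finset V)) (A : Finset V)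
    (B : Finset I) (m : ℕ) (κ : ℝ) : Prop :=
  ∃ μ : Finset (RainbowCopy F I V) → ℝ, (∀ S, 0 ≤ μ S) ∧ ∑ S, μ S = 1 ∧
    (∀ S, μ S ≠ 0 → IsPacking H A B S ∧ S.card = m) ∧
    ∀ T : Finset (RainbowCopy F I V), ∑ S, (if T ⊆ S then μ S else 0) ≤ κ ^ T.card

lemma HasSpread.of_isPacking {H : I → Finset (Finset V)} {A : Finset V} {B : Finset I} {m : ℕ}
    {S : Finset (RainbowCopy F I V)} (hS : IsPacking H A B S) (hm : S.card = m) {κ : ℝ}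
    (hκ : 1 ≤ κ) : HasSpread F H A B m κ := by
  refine ⟨fun S' => if S' = S then 1 else 0, fun _ => by positivity, by simp, ?_, ?_⟩
  · intro S' h
    simp only [ne_eq, ite_eq_right_iff, one_ne_zero, imp_false, not_not] at h
    exact h ▸ ⟨hS, hm⟩
  · intro T
    refine le_trans ?_ (one_le_pow₀ hκ)
    calc ∑ S', (if T ⊆ S' then (if S' = S then (1 : ℝ) else 0) else 0)
        ≤ ∑ S', (if S' = S then (1 : ℝ) else 0) :=
          Finset.sum_le_sum fun S' _ => by split_ifs <;> norm_num
      _ = 1 := by simp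

lemma IsPacking.union {H : I → Finset (Finset V)} {A A₁ A₂ : Finset V} {B B₁ B₂ : Finset I}
    (hA : Disjoint A₁ A₂) (hA₁ : A₁ ⊆ A) (hA₂ : A₂ ⊆ A) (hB : Disjoint B₁ B₂) (hB₁ : B₁ ⊆ B)
    (hB₂ : B₂ ⊆ B) {S₁ S₂ : Finset (RainbowCopy F I V)} (h₁ : IsPacking H A₁ B₁ S₁)
    (h₂ : IsPacking H A₂ B₂ S₂) : IsPacking H A B (S₁ ∪ S₂) := by
  constructor
  · intro E hE
    rcases Finset.mem_union.1 hE with hE | hE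
    · obtain ⟨h, h'⟩ := h₁.1 E hE
      exact ⟨⟨h.1.trans hA₁, h.2.trans hB₁⟩, h'⟩
    · obtain ⟨h, h'⟩ := h₂.1 E hE
      exact ⟨⟨h.1.trans hA₂, h.2.trans hB₂⟩, h'⟩
  · have key : ∀ E ∈ S₁, ∀ E' ∈ S₂, E.Separated E' := fun E hE E' hE' =>
      ⟨Finset.disjoint_of_subset_left (h₁.1 E hE).1.1
        (Finset.disjoint_of_subset_right (h₂.1 E' hE').1.1 hA),
      Finset.disjoint_of_subset_left (h₁.1 E hE).1.2
        (Finset.disjoint_of_subset_right (h₂.1 E' hE').1.2 hB)⟩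
    intro E hE E' hE' hne
    rw [Finset.mem_coe, Finset.mem_union] at hE hE'
    rcases hE with hE | hE <;> rcases hE' with hE' | hE'
    · exact h₁.2 hE hE' hne
    · exact key E hE E' hE'
    · exact ⟨(key E' hE' E hE).1.symm, (key E' hE' E hE).2.symm⟩
    · exact h₂.2 hE hE' hne

lemma RainbowCopy.not_liesIn_of_disjoint (hs : 1 ≤ s) {E : RainbowCopy F I V} {A₁ A₂ : Finset V}
    {B₁ B₂ : Finset I} (hA : Disjoint A₁ A₂) (h₁ : E.LiesIn A₁ B₁) : ¬ E.LiesIn A₂ B₂ := by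
  intro h₂
  have h := Finset.disjoint_of_subset_left h₁.1 (Finset.disjoint_of_subset_right h₂.1 hA)
  rw [disjoint_self, Finset.bot_eq_empty, ← Finset.card_eq_zero, E.card_verts] at h
  omega

open Classical in
/-- Spread measures on the two sides of a random splitting combine to a spread measure. -/
lemma HasSpread.combine (hs : 1 ≤ s) {σ : Type*} (P : Finset σ) (hP : P.Nonempty)
    {H : I → Finset (Finset V)} {A : Finset V} {B : Finset I} {A₁ A₂ : σ → Finset V}
    {B₁ B₂ : σ → Finset I}
    (hA : ∀ p ∈ P, Disjoint (A₁ p) (A₂ p) ∧ A₁ p ⊆ A ∧ A₂ p ⊆ A)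
    (hB : ∀ p ∈ P, Disjoint (B₁ p) (B₂ p) ∧ B₁ p ⊆ B ∧ B₂ p ⊆ B) {m₁ m₂ : ℕ} {κ κ' : ℝ}
    (hκ : 0 ≤ κ)
    (h₁ : ∀ p ∈ P, HasSpread F H (A₁ p) (B₁ p) m₁ κ)
    (h₂ : ∀ p ∈ P, HasSpread F H (A₂ p) (B₂ p) m₂ κ) (hκ' : 0 ≤ κ')
    (hT : ∀ T : Finset (RainbowCopy F I V), T.Nonempty →
      (T : Set (RainbowCopy F I V)).Pairwise RainbowCopy.Separated →
      κ ^ T.card * (P.filter fun p => ∀ E ∈ T, E.LiesIn (A₁ p) (B₁ p) ∨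
        E.LiesIn (A₂ p) (B₂ p)).card ≤ κ' ^ T.card * P.card) :
    HasSpread F H A B (m₁ + m₂) κ' := by
  choose! μ₁ hμ₁0 hμ₁1 hμ₁p hμ₁s using h₁
  choose! μ₂ hμ₂0 hμ₂1 hμ₂p hμ₂s using h₂
  have hP0 : (0 : ℝ) < P.card := by exact_mod_cast hP.card_pos
  let μ : Finset (RainbowCopy F I V) → ℝ := fun S =>
    (∑ p ∈ P, ∑ S₁, ∑ S₂, if S₁ ∪ S₂ = S then μ₁ p S₁ * μ₂ p S₂ else 0) / P.card
  have hμ0 : ∀ S, 0 ≤ μ S := fun S => by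
    refine div_nonneg (Finset.sum_nonneg fun p hp => Finset.sum_nonneg fun S₁ _ =>
      Finset.sum_nonneg fun S₂ _ => ?_) hP0.le
    split_ifs
    · exact mul_nonneg (hμ₁0 p hp _) (hμ₂0 p hp _)
    · exact le_rfl
  have hsum_ite : ∀ Q : Finset (RainbowCopy F I V) → Prop, ∀ [DecidablePred Q],
      ∑ S, (if Q S then μ S else 0) =
      (∑ p ∈ P, ∑ S₁, ∑ S₂, if Q (S₁ ∪ S₂) then μ₁ p S₁ * μ₂ p S₂ else 0) / P.card := by
    intro Q _
    have : ∀ S, (if Q S then μ S else 0) = (∑ p ∈ P, ∑ S₁, ∑ S₂,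
        if S₁ ∪ S₂ = S then (if Q S then μ₁ p S₁ * μ₂ p S₂ else 0) else 0) / P.card := by
      intro S
      by_cases hQ : Q S <;> simp [hQ, μ]
    rw [Finset.sum_congr rfl fun S _ => this S, ← Finset.sum_div]
    congr 1
    rw [Finset.sum_comm]
    refine Finset.sum_congr rfl fun p _ => ?_
    rw [Finset.sum_comm]
    refine Finset.sum_congr rfl fun S₁ _ => ?_
    rw [Finset.sum_comm]
    refine Finset.sum_congr rfl fun S₂ _ => ?_
    simp
  have hμ1 : ∑ S, μ S = 1 := by
    have h := hsum_ite fun _ => True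
    simp only [if_true] at h
    rw [h, div_eq_one_iff_eq hP0.ne']
    rw [Finset.sum_congr rfl fun p hp => ?_, Finset.sum_const, nsmul_eq_mul]
    rotate_left
    · exact (1 : ℝ)
    · simp_rw [← Finset.mul_sum, hμ₂1 p hp, mul_one]
      exact hμ₁1 p hp
    · simp
  have hμp : ∀ S, μ S ≠ 0 → IsPacking H A B S ∧ S.card = m₁ + m₂ := by
    intro S hS
    obtain ⟨p, hp, hS⟩ := Finset.exists_ne_zero_of_sum_ne_zero (div_ne_zero_iff.1 hS).1
    obtain ⟨S₁, -, hS⟩ := Finset.exists_ne_zero_of_sum_ne_zero hS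
    obtain ⟨S₂, -, hS⟩ := Finset.exists_ne_zero_of_sum_ne_zero hS
    by_cases he : S₁ ∪ S₂ = S
    · rw [if_pos he] at hS
      obtain ⟨p₁, c₁⟩ := hμ₁p p hp S₁ (left_ne_zero_of_mul hS)
      obtain ⟨p₂, c₂⟩ := hμ₂p p hp S₂ (right_ne_zero_of_mul hS)
      rw [← he]
      refine ⟨IsPacking.union (hA p hp).1 (hA p hp).2.1 (hA p hp).2.2 (hB p hp).1 (hB p hp).2.1
        (hB p hp).2.2 p₁ p₂, ?_⟩
      rw [Finset.card_union_of_disjoint, c₁, c₂]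
      rw [Finset.disjoint_left]
      intro E h h'
      exact RainbowCopy.not_liesIn_of_disjoint hs (hA p hp).1 (p₁.1 E h).1 (p₂.1 E h').1
    · exact absurd (if_neg he) hS
  refine ⟨μ, hμ0, hμ1, hμp, fun T => ?_⟩
  rcases T.eq_empty_or_nonempty with rfl | hTne
  · simp [hμ1]
  by_cases hsep : (T : Set (RainbowCopy F I V)).Pairwise RainbowCopy.Separated
  swap
  · rw [Finset.sum_eq_zero]
    · positivity
    · intro S _
      split_ifs with h
      · by_contra h0
        exact hsep ((hμp S h0).1.2.mono (Finset.coe_subset.2 h))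
      · rfl
  rw [hsum_ite fun S => T ⊆ S, div_le_iff₀ hP0]
  refine le_trans ?_ (hT T hTne hsep)
  rw [mul_comm (κ ^ _), ← nsmul_eq_mul, ← Finset.sum_const, Finset.sum_filter]
  refine Finset.sum_le_sum fun p hp => ?_
  set T₁ := T.filter fun E => E.LiesIn (A₁ p) (B₁ p)
  set T₂ := T.filter fun E => E.LiesIn (A₂ p) (B₂ p)
  have hterm : ∀ S₁ S₂, (if T ⊆ S₁ ∪ S₂ then μ₁ p S₁ * μ₂ p S₂ else 0) ≤
      if ∀ E ∈ T, E.LiesIn (A₁ p) (B₁ p) ∨ E.LiesIn (A₂ p) (B₂ p) then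
        (if T₁ ⊆ S₁ then μ₁ p S₁ else 0) * (if T₂ ⊆ S₂ then μ₂ p S₂ else 0) else 0 := by
    intro S₁ S₂
    have hnn : 0 ≤ if ∀ E ∈ T, E.LiesIn (A₁ p) (B₁ p) ∨ E.LiesIn (A₂ p) (B₂ p) then
        (if T₁ ⊆ S₁ then μ₁ p S₁ else 0) * (if T₂ ⊆ S₂ then μ₂ p S₂ else 0) else 0 := by
      have := hμ₁0 p hp S₁
      have := hμ₂0 p hp S₂
      split_ifs <;> simp <;> positivity
    by_cases hTS : T ⊆ S₁ ∪ S₂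
    · rw [if_pos hTS]
      by_cases h0 : μ₁ p S₁ * μ₂ p S₂ = 0
      · rw [h0]
        exact hnn
      obtain ⟨p₁, -⟩ := hμ₁p p hp S₁ (left_ne_zero_of_mul h0)
      obtain ⟨p₂, -⟩ := hμ₂p p hp S₂ (right_ne_zero_of_mul h0)
      rw [if_pos, if_pos, if_pos]
      · intro E hE
        obtain ⟨hE, hl⟩ := Finset.mem_filter.1 hE
        refine (Finset.mem_union.1 (hTS hE)).resolve_left fun h => ?_
        exact RainbowCopy.not_liesIn_of_disjoint hs (hA p hp).1 (p₁.1 E h).1 hl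
      · intro E hE
        obtain ⟨hE, hl⟩ := Finset.mem_filter.1 hE
        refine (Finset.mem_union.1 (hTS hE)).resolve_right fun h => ?_
        exact RainbowCopy.not_liesIn_of_disjoint hs (hA p hp).1 hl (p₂.1 E h).1
      · intro E hE
        exact (Finset.mem_union.1 (hTS hE)).imp (fun h => (p₁.1 E h).1) fun h => (p₂.1 E h).1
    · rw [if_neg hTS]
      exact hnn
  refine (Finset.sum_le_sum fun S₁ _ => Finset.sum_le_sum fun S₂ _ => hterm S₁ S₂).trans ?_
  by_cases hc : ∀ E ∈ T, E.LiesIn (A₁ p) (B₁ p) ∨ E.LiesIn (A₂ p) (B₂ p)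
  · simp only [if_pos hc]
    simp_rw [← Finset.mul_sum, ← Finset.sum_mul]
    have hcard : T.card = T₁.card + T₂.card := by
      rw [← Finset.card_union_of_disjoint]
      · congr 1
        ext E
        simp only [T₁, T₂, Finset.mem_union, Finset.mem_filter]
        have := hc E
        tauto
      · rw [Finset.disjoint_left]
        intro E h h'
        exact RainbowCopy.not_liesIn_of_disjoint hs (hA p hp).1 (Finset.mem_filter.1 h).2
          (Finset.mem_filter.1 h').2
    rw [hcard, pow_add]
    refine mul_le_mul (hμ₁s p hp T₁) (hμ₂s p hp T₂) (Finset.sum_nonneg fun S _ => ?_)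
      (by positivity)
    split_ifs
    · exact hμ₂0 p hp S
    · exact le_rfl
  · simp only [if_neg hc, Finset.sum_const_zero, le_refl]

end Packings

section Splitting

variable {V : Type*} [DecidableEq V]

lemma card_powersetCard_filter_le {A Y₁ Y₂ : Finset V} (h₁ : Y₁ ⊆ A) (h₂ : Y₂ ⊆ A)
    (h : Disjoint Y₁ Y₂) (a : ℕ) :
    ((A.powersetCard a).filter fun L => Y₁ ⊆ L ∧ Y₂ ⊆ A \ L).card ≤
      (A.card - (Y₁.card + Y₂.card)).choose (a - Y₁.card) := by
  rw [← Finset.card_union_of_disjoint h, ← Finset.card_sdiff_of_subset (Finset.union_subset h₁ h₂),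
    ← Finset.card_powersetCard]
  refine Finset.card_le_card_of_injOn (fun L => L \ Y₁) ?_ ?_
  · intro L hL
    rw [Finset.mem_coe, Finset.mem_filter, Finset.mem_powersetCard] at hL
    obtain ⟨⟨hLA, hLc⟩, hY₁, hY₂⟩ := hL
    rw [Finset.mem_coe, Finset.mem_powersetCard, Finset.card_sdiff_of_subset hY₁, hLc]
    refine ⟨fun x hx => ?_, rfl⟩
    rw [Finset.mem_sdiff] at hx
    rw [Finset.mem_sdiff, Finset.mem_union]
    refine ⟨hLA hx.1, ?_⟩
    rintro (hx' | hx')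
    · exact hx.2 hx'
    · exact (Finset.mem_sdiff.1 (hY₂ hx')).2 hx.1
  · intro L hL L' hL' hLL
    rw [Finset.mem_coe, Finset.mem_filter] at hL hL'
    rw [← Finset.sdiff_union_of_subset hL.2.1, ← Finset.sdiff_union_of_subset hL'.2.1]
    exact congrArg (· ∪ Y₁) hLL

lemma card_split_le {r m : ℕ} {q : ℝ} (hr : 1 ≤ r) (hq : 0 ≤ q)
    (hch : ∀ u₁ u₂ : ℕ, u₁ ≤ m / 2 → u₂ ≤ m - m / 2 →
      ((r * (m - (u₁ + u₂))).choose (r * (m / 2 - u₁)) : ℝ) * 2 ^ (r * (u₁ + u₂)) ≤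
        q ^ (r * (u₁ + u₂)) * (r * m).choose (r * (m / 2)))
    {A Y₁ Y₂ : Finset V} (hA : A.card = r * m) (h : Disjoint Y₁ Y₂) {u₁ u₂ : ℕ}
    (h₁ : Y₁.card = r * u₁) (h₂ : Y₂.card = r * u₂) :
    (((A.powersetCard (r * (m / 2))).filter fun L => Y₁ ⊆ L ∧ Y₂ ⊆ A \ L).card : ℝ) *
      2 ^ (r * (u₁ + u₂)) ≤ q ^ (r * (u₁ + u₂)) * (r * m).choose (r * (m / 2)) := by
  rcases ((A.powersetCard (r * (m / 2))).filter fun L => Y₁ ⊆ L ∧ Y₂ ⊆ A \ L).eq_empty_or_nonempty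
    with he | ⟨L, hL⟩
  · rw [he]
    simp only [Finset.card_empty, Nat.cast_zero, zero_mul]
    positivity
  rw [Finset.mem_filter, Finset.mem_powersetCard] at hL
  obtain ⟨⟨hLA, hLc⟩, hY₁, hY₂⟩ := hL
  have hu₁ : u₁ ≤ m / 2 := by
    have := Finset.card_le_card hY₁
    rw [h₁, hLc] at this
    exact Nat.le_of_mul_le_mul_left this hr
  have hu₂ : u₂ ≤ m - m / 2 := by
    have := Finset.card_le_card hY₂
    rw [h₂, Finset.card_sdiff_of_subset hLA, hLc, hA, ← Nat.mul_sub] at this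
    exact Nat.le_of_mul_le_mul_left this hr
  refine le_trans ?_ (hch u₁ u₂ hu₁ hu₂)
  have h3 := card_powersetCard_filter_le (hY₁.trans hLA) (hY₂.trans Finset.sdiff_subset) h
    (r * (m / 2))
  rw [hA, h₁, h₂, ← mul_add, ← Nat.mul_sub, ← Nat.mul_sub] at h3
  gcongr

variable {s : ℕ} {F : Finset (Finset (Fin s))} {I : Type*} [DecidableEq I]

open Classical in
/-- The number of splittings compatible with a family of separated rainbow copies. -/
lemma card_compatible_le {t m : ℕ} {q : ℝ} (hs : 1 ≤ s) (ht : 1 ≤ t) (hFt : F.card = t)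
    (hq : 0 ≤ q)
    (hchs : ∀ u₁ u₂ : ℕ, u₁ ≤ m / 2 → u₂ ≤ m - m / 2 →
      ((s * (m - (u₁ + u₂))).choose (s * (m / 2 - u₁)) : ℝ) * 2 ^ (s * (u₁ + u₂)) ≤
        q ^ (s * (u₁ + u₂)) * (s * m).choose (s * (m / 2)))
    (hcht : ∀ u₁ u₂ : ℕ, u₁ ≤ m / 2 → u₂ ≤ m - m / 2 →
      ((t * (m - (u₁ + u₂))).choose (t * (m / 2 - u₁)) : ℝ) * 2 ^ (t * (u₁ + u₂)) ≤
        q ^ (t * (u₁ + u₂)) * (t * m).choose (t * (m / 2)))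
    {A : Finset V} {B : Finset I} (hA : A.card = s * m) (hB : B.card = t * m)
    (T : Finset (RainbowCopy F I V))
    (hT : (T : Set (RainbowCopy F I V)).Pairwise RainbowCopy.Separated) :
    (((A.powersetCard (s * (m / 2)) ×ˢ B.powersetCard (t * (m / 2))).filter fun p =>
      ∀ E ∈ T, E.LiesIn p.1 p.2 ∨ E.LiesIn (A \ p.1) (B \ p.2)).card : ℝ) *
        2 ^ ((s + t) * T.card) ≤
      2 ^ T.card * q ^ ((s + t) * T.card) *
        ((s * m).choose (s * (m / 2)) * (t * m).choose (t * (m / 2))) := by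
  set PA := A.powersetCard (s * (m / 2))
  set PB := B.powersetCard (t * (m / 2))
  let GA : Finset (RainbowCopy F I V) → Finset (Finset V) := fun T₁ =>
    PA.filter fun L => T₁.biUnion RainbowCopy.verts ⊆ L ∧
      (T \ T₁).biUnion RainbowCopy.verts ⊆ A \ L
  let GB : Finset (RainbowCopy F I V) → Finset (Finset I) := fun T₁ =>
    PB.filter fun L => T₁.biUnion RainbowCopy.cols ⊆ L ∧
      (T \ T₁).biUnion RainbowCopy.cols ⊆ B \ L
  have hsub : ((PA ×ˢ PB).filter fun p =>
      ∀ E ∈ T, E.LiesIn p.1 p.2 ∨ E.LiesIn (A \ p.1) (B \ p.2)) ⊆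
      T.powerset.biUnion fun T₁ => GA T₁ ×ˢ GB T₁ := by
    intro p hp
    rw [Finset.mem_filter, Finset.mem_product] at hp
    obtain ⟨⟨hp1, hp2⟩, hp⟩ := hp
    rw [Finset.mem_biUnion]
    refine ⟨T.filter fun E => E.LiesIn p.1 p.2, Finset.mem_powerset.2 (Finset.filter_subset _ _),
      ?_⟩
    simp only [GA, GB, Finset.mem_product, Finset.mem_filter, Finset.biUnion_subset,
      Finset.mem_sdiff, not_and]
    exact ⟨⟨hp1, fun E hE => hE.2.1, fun E hE => ((hp E hE.1).resolve_left (hE.2 hE.1)).1⟩,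
      ⟨hp2, fun E hE => hE.2.2, fun E hE => ((hp E hE.1).resolve_left (hE.2 hE.1)).2⟩⟩
  have hterm : ∀ T₁ ∈ T.powerset, ((GA T₁ ×ˢ GB T₁).card : ℝ) * 2 ^ ((s + t) * T.card) ≤
      q ^ ((s + t) * T.card) *
        ((s * m).choose (s * (m / 2)) * (t * m).choose (t * (m / 2))) := by
    intro T₁ hT₁
    rw [Finset.mem_powerset] at hT₁
    have hcard : T₁.card + (T \ T₁).card = T.card := by
      rw [Finset.card_sdiff_of_subset hT₁, Nat.add_sub_cancel' (Finset.card_le_card hT₁)]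
    have hcv : ∀ T' ⊆ T, (T'.biUnion RainbowCopy.verts).card = s * T'.card := by
      intro T' hT'
      rw [Finset.card_biUnion fun E hE E' hE' hne => (hT (hT' hE) (hT' hE') hne).1]
      simp [RainbowCopy.card_verts, mul_comm]
    have hcc : ∀ T' ⊆ T, (T'.biUnion RainbowCopy.cols).card = t * T'.card := by
      intro T' hT'
      rw [Finset.card_biUnion fun E hE E' hE' hne => (hT (hT' hE) (hT' hE') hne).2]
      simp [RainbowCopy.card_cols, hFt, mul_comm]
    have hne : ∀ E ∈ T₁, ∀ E' ∈ T \ T₁, E ≠ E' := fun E hE E' hE' h =>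
      (Finset.mem_sdiff.1 hE').2 (h ▸ hE)
    have h1 := card_split_le hs hq hchs hA (Y₁ := T₁.biUnion RainbowCopy.verts)
      (Y₂ := (T \ T₁).biUnion RainbowCopy.verts) (by
        simp only [Finset.disjoint_biUnion_left, Finset.disjoint_biUnion_right]
        exact fun E hE E' hE' => (hT (hT₁ hE') (Finset.sdiff_subset hE) (hne E' hE' E hE)).1)
      (hcv _ hT₁) (hcv _ Finset.sdiff_subset)
    have h2 := card_split_le ht hq hcht hB (Y₁ := T₁.biUnion RainbowCopy.cols)
      (Y₂ := (T \ T₁).biUnion RainbowCopy.cols) (by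
        simp only [Finset.disjoint_biUnion_left, Finset.disjoint_biUnion_right]
        exact fun E hE E' hE' => (hT (hT₁ hE') (Finset.sdiff_subset hE) (hne E' hE' E hE)).2)
      (hcc _ hT₁) (hcc _ Finset.sdiff_subset)
    rw [hcard] at h1 h2
    rw [Finset.card_product, add_mul, pow_add, pow_add]
    push_cast
    calc ((GA T₁).card : ℝ) * (GB T₁).card * (2 ^ (s * T.card) * 2 ^ (t * T.card))
        = ((GA T₁).card * 2 ^ (s * T.card)) * ((GB T₁).card * 2 ^ (t * T.card)) := by ring
      _ ≤ (q ^ (s * T.card) * (s * m).choose (s * (m / 2))) *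
          (q ^ (t * T.card) * (t * m).choose (t * (m / 2))) :=
        mul_le_mul h1 h2 (by positivity) (by positivity)
      _ = _ := by ring
  calc _ ≤ (∑ T₁ ∈ T.powerset, ((GA T₁ ×ˢ GB T₁).card : ℝ)) * 2 ^ ((s + t) * T.card) := by
        gcongr
        exact_mod_cast (Finset.card_le_card hsub).trans Finset.card_biUnion_le
    _ ≤ ∑ T₁ ∈ T.powerset, q ^ ((s + t) * T.card) *
        ((s * m).choose (s * (m / 2)) * (t * m).choose (t * (m / 2)) : ℝ) := by
        rw [Finset.sum_mul]
        exact Finset.sum_le_sum hterm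
    _ = _ := by
        rw [Finset.sum_const, Finset.card_powerset, nsmul_eq_mul]
        push_cast
        ring

/-- Every `d`-subset of `A` has many extensions in `A` in each colour of `B`. -/
def DegCond (H : I → Finset (Finset V)) (d ℓ : ℕ) (g : ℝ) (A : Finset V) (B : Finset I) : Prop :=
  ∀ i ∈ B, ∀ D ⊆ A, D.card = d →
    g * (A.card : ℝ) ^ ℓ ≤ ((H i).filter fun e => D ⊆ e ∧ e ⊆ A).card

/-- The side `L` of a splitting of `A` receives its share of each link. -/
def SplitsLinks (H : I → Finset (Finset V)) (d ℓ : ℕ) (τ : ℝ) (A L : Finset V) (B : Finset I) :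
    Prop :=
  ∀ i ∈ B, ∀ D ⊆ A, D.card = d →
    (((H i).filter fun e => D ⊆ e ∧ e ⊆ A).card : ℝ) / 2 ^ ℓ - τ * (A.card : ℝ) ^ ℓ ≤
      (((H i).filter fun e => D ⊆ e ∧ e ⊆ A).filter fun e => e \ D ⊆ L).card

open Classical in
lemma card_not_splitsLinks_le {H : I → Finset (Finset V)} {k d ℓ : ℕ} (hkd : k = d + ℓ)
    (hℓ : 1 ≤ ℓ) (hH : ∀ i, ∀ e ∈ H i, e.card = k) {A : Finset V} (hA : 0 < A.card) {B : Finset I}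
    {τ : ℝ} (hτ : 0 ≤ τ) :
    ((A.powerset.filter fun L => ¬ SplitsLinks H d ℓ τ A L B).card : ℝ) ≤
      B.card * (A.card : ℝ) ^ d * (2 ^ A.card * Real.exp (-(2 * τ ^ 2 * A.card))) := by
  let X : I × Finset V → Finset (Finset V) := fun p =>
    A.powerset.filter fun L => ((((H p.1).filter fun e => p.2 ⊆ e ∧ e ⊆ A).filter
      fun e => e \ p.2 ⊆ L).card : ℝ) ≤
      (((H p.1).filter fun e => p.2 ⊆ e ∧ e ⊆ A).card : ℝ) / 2 ^ ℓ - τ * (A.card : ℝ) ^ ℓ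
  have hsub : (A.powerset.filter fun L => ¬ SplitsLinks H d ℓ τ A L B) ⊆
      (B ×ˢ A.powersetCard d).biUnion X := by
    intro L hL
    rw [Finset.mem_filter, SplitsLinks] at hL
    obtain ⟨hL, hn⟩ := hL
    push Not at hn
    obtain ⟨i, hi, D, hD, hDc, hlt⟩ := hn
    rw [Finset.mem_biUnion]
    exact ⟨(i, D), Finset.mem_product.2 ⟨hi, Finset.mem_powersetCard.2 ⟨hD, hDc⟩⟩,
      Finset.mem_filter.2 ⟨hL, hlt.le⟩⟩
  calc _ ≤ ∑ p ∈ B ×ˢ A.powersetCard d, ((X p).card : ℝ) := by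
        exact_mod_cast (Finset.card_le_card hsub).trans Finset.card_biUnion_le
    _ ≤ ∑ p ∈ B ×ˢ A.powersetCard d, 2 ^ A.card * Real.exp (-(2 * τ ^ 2 * A.card)) := by
        refine Finset.sum_le_sum fun p hp => ?_
        rw [Finset.mem_product, Finset.mem_powersetCard] at hp
        refine card_link_deviation_le hℓ hA (fun e he => ?_) hτ
        rw [Finset.mem_filter] at he
        refine ⟨he.2.1, he.2.2, ?_⟩
        rw [Finset.card_sdiff_of_subset he.2.1, hH _ e he.1, hp.2.2, hkd, Nat.add_sub_cancel_left]
    _ ≤ _ := by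
        rw [Finset.sum_const, nsmul_eq_mul, Finset.card_product, Finset.card_powersetCard]
        push_cast
        gcongr
        exact_mod_cast Nat.choose_le_pow _ _

lemma DegCond.of_splitsLinks {H : I → Finset (Finset V)} {d ℓ : ℕ} {A L : Finset V}
    {B B' : Finset I} {g g' τ : ℝ} (h : DegCond H d ℓ g A B) (hL : SplitsLinks H d ℓ τ A L B)
    (hLA : L ⊆ A) (hB : B' ⊆ B)
    (hg : g' * (L.card : ℝ) ^ ℓ ≤ (g / 2 ^ ℓ - τ) * (A.card : ℝ) ^ ℓ) : DegCond H d ℓ g' L B' := by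
  intro i hi D hD hDc
  have h1 := h i (hB hi) D (hD.trans hLA) hDc
  have h2 := hL i (hB hi) D (hD.trans hLA) hDc
  have h3 : (((H i).filter fun e => D ⊆ e ∧ e ⊆ A).filter fun e => e \ D ⊆ L).card ≤
      ((H i).filter fun e => D ⊆ e ∧ e ⊆ L).card := by
    refine Finset.card_le_card fun e he => ?_
    simp only [Finset.mem_filter] at he ⊢
    refine ⟨he.1.1, he.1.2.1, ?_⟩
    rw [← Finset.sdiff_union_of_subset he.1.2.1]
    exact Finset.union_subset he.2 hD
  have h3' : ((((H i).filter fun e => D ⊆ e ∧ e ⊆ A).filter fun e => e \ D ⊆ L).card : ℝ) ≤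
      ((H i).filter fun e => D ⊆ e ∧ e ⊆ L).card := by exact_mod_cast h3
  have h4 : g * (A.card : ℝ) ^ ℓ / 2 ^ ℓ ≤
      (((H i).filter fun e => D ⊆ e ∧ e ⊆ A).card : ℝ) / 2 ^ ℓ := by gcongr
  have h5 : (g / 2 ^ ℓ - τ) * (A.card : ℝ) ^ ℓ =
      g * (A.card : ℝ) ^ ℓ / 2 ^ ℓ - τ * (A.card : ℝ) ^ ℓ := by ring
  linarith

end Splitting

section Step

variable {V : Type*} [DecidableEq V] {s : ℕ} {F : Finset (Finset (Fin s))} {I : Type*}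
  [DecidableEq I]

lemma one_add_pow_le_one_add_two_pow_mul {x : ℝ} (hx0 : 0 ≤ x) (hx1 : x ≤ 1) (ℓ : ℕ) :
    (1 + x) ^ ℓ ≤ 1 + 2 ^ ℓ * x := by
  suffices h : (1 + x) ^ ℓ ≤ 1 + (2 ^ ℓ - 1) * x by linarith
  induction ℓ with
  | zero => simp
  | succ ℓ ih =>
    have h2 : (1 : ℝ) ≤ 2 ^ ℓ := one_le_pow₀ (by norm_num)
    calc (1 + x) ^ (ℓ + 1) = (1 + x) ^ ℓ * (1 + x) := pow_succ _ _
      _ ≤ (1 + (2 ^ ℓ - 1) * x) * (1 + x) := by gcongr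
      _ ≤ _ := by
        rw [pow_succ]
        nlinarith [mul_nonneg (mul_nonneg (by linarith : (0 : ℝ) ≤ 2 ^ ℓ - 1) hx0)
          (by linarith : 0 ≤ 1 - x)]

lemma side_bound {ℓ m m' : ℕ} {x g g' G : ℝ} (hx1 : x ≤ 1 / 2) (hmx : 1 ≤ x * m)
    (hx0 : 0 < x) (hg0 : 0 ≤ g') (hgG : g' ≤ G) (hg : g' + 2 ^ ℓ * (1 + G) * x ≤ g)
    (hm' : 2 * m' ≤ m + 1) :
    g' * ((s * m' : ℕ) : ℝ) ^ ℓ ≤ (g / 2 ^ ℓ - x) * ((s * m : ℕ) : ℝ) ^ ℓ := by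
  have hm'' : 2 * (m' : ℝ) ≤ m + 1 := by exact_mod_cast hm'
  have h1 : 2 * ((s * m' : ℕ) : ℝ) ≤ (1 + x) * ((s * m : ℕ) : ℝ) := by
    push_cast
    have : (0 : ℝ) ≤ s := by positivity
    nlinarith
  have h2 : 2 ^ ℓ * ((s * m' : ℕ) : ℝ) ^ ℓ ≤ (1 + 2 ^ ℓ * x) * ((s * m : ℕ) : ℝ) ^ ℓ := by
    rw [← mul_pow]
    calc (2 * ((s * m' : ℕ) : ℝ)) ^ ℓ ≤ ((1 + x) * ((s * m : ℕ) : ℝ)) ^ ℓ := by gcongr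
      _ = (1 + x) ^ ℓ * ((s * m : ℕ) : ℝ) ^ ℓ := mul_pow _ _ _
      _ ≤ _ := by
        gcongr
        exact one_add_pow_le_one_add_two_pow_mul hx0.le (by linarith) _
  have h3 : g' * (1 + 2 ^ ℓ * x) ≤ g - 2 ^ ℓ * x := by
    have : g' * (2 ^ ℓ * x) ≤ G * (2 ^ ℓ * x) := by gcongr
    nlinarith
  have hp : (0 : ℝ) < 2 ^ ℓ := by positivity
  refine le_of_mul_le_mul_left ?_ hp
  calc 2 ^ ℓ * (g' * ((s * m' : ℕ) : ℝ) ^ ℓ) = g' * (2 ^ ℓ * ((s * m' : ℕ) : ℝ) ^ ℓ) := by ring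
    _ ≤ g' * ((1 + 2 ^ ℓ * x) * ((s * m : ℕ) : ℝ) ^ ℓ) := by gcongr
    _ = g' * (1 + 2 ^ ℓ * x) * ((s * m : ℕ) : ℝ) ^ ℓ := by ring
    _ ≤ (g - 2 ^ ℓ * x) * ((s * m : ℕ) : ℝ) ^ ℓ := by gcongr
    _ = _ := by
      rw [← mul_assoc]
      congr 1
      field_simp

lemma pow_mul_le_pow_mul_of_scaled {κ κ' y x a c P : ℝ} {n : ℕ} (hκ0 : 0 ≤ κ) (hy : 0 ≤ y)
    (hx : 0 ≤ x) (hn : 0 < n) (hP : 0 ≤ P) (ha : a ≤ y ^ n * c) (hc : c ≤ (1 + 2 * x) * P)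
    (hκ : κ * (y * (1 + 2 * x)) ≤ κ') : κ ^ n * a ≤ κ' ^ n * P := by
  have h1 : (1 + 2 * x) ≤ (1 + 2 * x) ^ n := le_self_pow₀ (by linarith) (by omega)
  calc κ ^ n * a ≤ κ ^ n * (y ^ n * ((1 + 2 * x) ^ n * P)) := by
        refine mul_le_mul_of_nonneg_left (ha.trans ?_) (by positivity)
        refine mul_le_mul_of_nonneg_left (hc.trans ?_) (by positivity)
        exact mul_le_mul_of_nonneg_right h1 hP
    _ = (κ * (y * (1 + 2 * x))) ^ n * P := by
        rw [mul_pow, mul_pow]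
        ring
    _ ≤ _ := by gcongr

variable [Fintype I] [Fintype V]

open Classical in
/-- Spread measures on all sufficiently dense halves give a spread measure on the whole. -/
lemma HasSpread.of_halves {t m k d ℓ : ℕ} {x g g' G κ κ' : ℝ} (hs : 1 ≤ s) (ht : 1 ≤ t)
    (hFt : F.card = t) (hkd : k = d + ℓ) (hℓ : 1 ≤ ℓ) (hm : 1 ≤ m)
    (hx0 : 0 < x) (hx1 : x ≤ 1 / 2) (hmx : 1 ≤ x * m)
    (hchs : ∀ u₁ u₂ : ℕ, u₁ ≤ m / 2 → u₂ ≤ m - m / 2 →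
      ((s * (m - (u₁ + u₂))).choose (s * (m / 2 - u₁)) : ℝ) * 2 ^ (s * (u₁ + u₂)) ≤
        (1 + 4 * x) ^ (s * (u₁ + u₂)) * (s * m).choose (s * (m / 2)))
    (hcht : ∀ u₁ u₂ : ℕ, u₁ ≤ m / 2 → u₂ ≤ m - m / 2 →
      ((t * (m - (u₁ + u₂))).choose (t * (m / 2 - u₁)) : ℝ) * 2 ^ (t * (u₁ + u₂)) ≤
        (1 + 4 * x) ^ (t * (u₁ + u₂)) * (t * m).choose (t * (m / 2)))
    (hdev : 2 * (t * m : ℝ) * (s * m : ℝ) ^ d * (2 ^ (s * m) * Real.exp (-(2 * x ^ 2 * (s * m)))) ≤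
      x * (s * m).choose (s * (m / 2)))
    (hg0 : 0 ≤ g') (hgG : g' ≤ G) (hg : g' + 2 ^ ℓ * (1 + G) * x ≤ g)
    (hκ0 : 0 ≤ κ) (hκ : κ * (2 * ((1 + 4 * x) / 2) ^ (s + t) * (1 + 2 * x)) ≤ κ')
    {H : I → Finset (Finset V)} (hH : ∀ i, ∀ e ∈ H i, e.card = k) {A : Finset V} {B : Finset I}
    (hA : A.card = s * m) (hB : B.card = t * m) (hdeg : DegCond H d ℓ g A B)
    (ih : ∀ m', m' = m / 2 ∨ m' = m - m / 2 → ∀ (A' : Finset V) (B' : Finset I),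
      A'.card = s * m' → B'.card = t * m' → DegCond H d ℓ g' A' B' → HasSpread F H A' B' m' κ) :
    HasSpread F H A B m κ' := by
  obtain ⟨CA, hCAd⟩ : ∃ CA : ℝ, CA = (((s * m).choose (s * (m / 2)) : ℕ) : ℝ) := ⟨_, rfl⟩
  rw [← hCAd] at hdev
  obtain ⟨CB, hCBd⟩ : ∃ CB : ℝ, CB = (((t * m).choose (t * (m / 2)) : ℕ) : ℝ) := ⟨_, rfl⟩
  have hCA : 0 < CA := by
    have : 0 < (s * m).choose (s * (m / 2)) :=
      Nat.choose_pos (Nat.mul_le_mul_left _ (Nat.div_le_self _ _))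
    rw [hCAd]
    exact_mod_cast this
  have hCB : 0 < CB := by
    have : 0 < (t * m).choose (t * (m / 2)) :=
      Nat.choose_pos (Nat.mul_le_mul_left _ (Nat.div_le_self _ _))
    rw [hCBd]
    exact_mod_cast this
  have hA0 : 0 < A.card := by
    rw [hA]
    exact Nat.mul_pos hs hm
  set N := A.powerset.filter fun L => ¬ SplitsLinks H d ℓ x A L B with hN
  have hNc : 2 * (N.card : ℝ) ≤ x * CA := by
    refine le_trans ?_ hdev
    have h := card_not_splitsLinks_le hkd hℓ hH hA0 (B := B) hx0.le
    rw [hA, hB] at h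
    push_cast at h
    have : 2 * (t * m : ℝ) * (s * m : ℝ) ^ d *
        (2 ^ (s * m) * Real.exp (-(2 * x ^ 2 * (s * m)))) =
        2 * ((t * m : ℝ) * (s * m : ℝ) ^ d *
        (2 ^ (s * m) * Real.exp (-(2 * x ^ 2 * (s * m))))) := by ring
    rw [this]
    gcongr
  set PA := A.powersetCard (s * (m / 2))
  set PB := B.powersetCard (t * (m / 2))
  have hPA : (PA.card : ℝ) = CA := by rw [Finset.card_powersetCard, hA, hCAd]
  have hPB : (PB.card : ℝ) = CB := by rw [Finset.card_powersetCard, hB, hCBd]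
  set good := PA.filter fun L => SplitsLinks H d ℓ x A L B ∧ SplitsLinks H d ℓ x A (A \ L) B
  have hgood : (1 - x) * CA ≤ good.card := by
    have h1 : PA ⊆ good ∪ (N ∪ N.image fun L => A \ L) := by
      intro L hL
      have hLA := (Finset.mem_powersetCard.1 hL).1
      by_cases h1 : SplitsLinks H d ℓ x A L B
      · by_cases h2 : SplitsLinks H d ℓ x A (A \ L) B
        · exact Finset.mem_union_left _ (Finset.mem_filter.2 ⟨hL, h1, h2⟩)
        · refine Finset.mem_union_right _ (Finset.mem_union_right _ (Finset.mem_image.2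
            ⟨A \ L, Finset.mem_filter.2 ⟨Finset.mem_powerset.2 Finset.sdiff_subset, h2⟩, ?_⟩))
          exact Finset.sdiff_sdiff_eq_self hLA
      · exact Finset.mem_union_right _ (Finset.mem_union_left _
          (Finset.mem_filter.2 ⟨Finset.mem_powerset.2 hLA, h1⟩))
    have h2 : PA.card ≤ good.card + (N.card + N.card) := by
      refine (Finset.card_le_card h1).trans ((Finset.card_union_le _ _).trans ?_)
      exact Nat.add_le_add_left ((Finset.card_union_le _ _).trans
        (Nat.add_le_add_left Finset.card_image_le _)) _
    have h3 : (PA.card : ℝ) ≤ good.card + (N.card + N.card) := by exact_mod_cast h2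
    linarith
  have hgoodpos : 0 < good.card := by
    have : (0 : ℝ) < good.card := lt_of_lt_of_le (mul_pos (by linarith) hCA) hgood
    exact_mod_cast this
  have hPBpos : 0 < PB.card := by
    have : (0 : ℝ) < PB.card := by rw [hPB]; exact hCB
    exact_mod_cast this
  have hPc : CA * CB ≤ (1 + 2 * x) * ((good ×ˢ PB).card : ℝ) := by
    rw [Finset.card_product]
    push_cast
    rw [hPB, ← mul_assoc]
    refine mul_le_mul_of_nonneg_right ?_ hCB.le
    calc CA ≤ (1 + 2 * x) * ((1 - x) * CA) := by
          have : 0 ≤ x * (1 - 2 * x) * CA := by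
            have : 0 ≤ 1 - 2 * x := by linarith
            positivity
          nlinarith
      _ ≤ _ := by gcongr
  have hκ'0 : 0 ≤ κ' := le_trans (by positivity) hκ
  have hres := HasSpread.combine (F := F) (H := H) (A := A) (B := B) hs (good ×ˢ PB)
    (Finset.Nonempty.product (Finset.card_pos.1 hgoodpos) (Finset.card_pos.1 hPBpos))
    (A₁ := fun p => p.1) (A₂ := fun p => A \ p.1) (B₁ := fun p => p.2) (B₂ := fun p => B \ p.2)
    (m₁ := m / 2) (m₂ := m - m / 2) (κ := κ) (κ' := κ') ?_ ?_ hκ0 ?_ ?_ hκ'0 ?_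
  · rwa [Nat.add_sub_cancel' (Nat.div_le_self _ _)] at hres
  · intro p hp
    have hp1 := (Finset.mem_filter.1 (Finset.mem_product.1 hp).1).1
    exact ⟨Finset.disjoint_sdiff, (Finset.mem_powersetCard.1 hp1).1, Finset.sdiff_subset⟩
  · intro p hp
    have hp1 := (Finset.mem_product.1 hp).2
    exact ⟨Finset.disjoint_sdiff, (Finset.mem_powersetCard.1 hp1).1, Finset.sdiff_subset⟩
  · intro p hp
    obtain ⟨hp1, hp2⟩ := Finset.mem_product.1 hp
    obtain ⟨hp1, hsp, -⟩ := Finset.mem_filter.1 hp1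
    obtain ⟨hp1, hc1⟩ := Finset.mem_powersetCard.1 hp1
    obtain ⟨hp2, hc2⟩ := Finset.mem_powersetCard.1 hp2
    refine ih _ (Or.inl rfl) _ _ hc1 hc2 (hdeg.of_splitsLinks hsp hp1 hp2 ?_)
    rw [hc1, hA]
    exact side_bound hx1 hmx hx0 hg0 hgG hg (by omega)
  · intro p hp
    obtain ⟨hp1, hp2⟩ := Finset.mem_product.1 hp
    obtain ⟨hp1, -, hsp⟩ := Finset.mem_filter.1 hp1
    obtain ⟨hp1, hc1⟩ := Finset.mem_powersetCard.1 hp1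
    obtain ⟨hp2, hc2⟩ := Finset.mem_powersetCard.1 hp2
    have hc1' : (A \ p.1).card = s * (m - m / 2) := by
      rw [Finset.card_sdiff_of_subset hp1, hc1, hA, Nat.mul_sub]
    have hc2' : (B \ p.2).card = t * (m - m / 2) := by
      rw [Finset.card_sdiff_of_subset hp2, hc2, hB, Nat.mul_sub]
    refine ih _ (Or.inr rfl) _ _ hc1' hc2' (hdeg.of_splitsLinks hsp Finset.sdiff_subset
      Finset.sdiff_subset ?_)
    rw [hc1', hA]
    exact side_bound hx1 hmx hx0 hg0 hgG hg (by omega)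
  · intro T hT hsep
    have h1 := card_compatible_le hs ht hFt (by positivity : 0 ≤ 1 + 4 * x) hchs hcht hA hB T hsep
    rw [← hCAd, ← hCBd] at h1
    rw [← le_div_iff₀ (by positivity)] at h1
    have h2 : 2 ^ T.card * (1 + 4 * x) ^ ((s + t) * T.card) * (CA * CB) /
        2 ^ ((s + t) * T.card) = (2 * ((1 + 4 * x) / 2) ^ (s + t)) ^ T.card * (CA * CB) := by
      rw [mul_pow, div_pow, div_pow, ← pow_mul, ← pow_mul]
      ring
    rw [h2] at h1
    refine pow_mul_le_pow_mul_of_scaled hκ0 (by positivity) hx0.le hT.card_pos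
      (Nat.cast_nonneg _) ?_ hPc hκ
    refine le_trans ?_ h1
    refine Nat.cast_le.2 (Finset.card_le_card fun q hq => ?_)
    simp only [Finset.mem_filter] at hq ⊢
    exact ⟨Finset.mem_product.2 ⟨(Finset.mem_filter.1 (Finset.mem_product.1 hq.1).1).1,
      (Finset.mem_product.1 hq.1).2⟩, hq.2⟩

end Step

section Iteration

variable {V : Type*} [DecidableEq V] {s : ℕ} {F : Finset (Finset (Fin s))} {I : Type*}
  [DecidableEq I]

lemma DegCond.mono {H : I → Finset (Finset V)} {d ℓ : ℕ} {g g' : ℝ} {A : Finset V} {B : Finset I}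
    (h : DegCond H d ℓ g A B) (hg : g' ≤ g) : DegCond H d ℓ g' A B := fun i hi D hD hDc =>
  (mul_le_mul_of_nonneg_right hg (by positivity)).trans (h i hi D hD hDc)

lemma HasSpread.mono [Fintype I] [Fintype V] {H : I → Finset (Finset V)} {A : Finset V}
    {B : Finset I} {m : ℕ} {κ κ' : ℝ} (h : HasSpread F H A B m κ) (h0 : 0 ≤ κ) (hκ : κ ≤ κ') :
    HasSpread F H A B m κ' := by
  obtain ⟨μ, h1, h2, h3, h4⟩ := h
  exact ⟨μ, h1, h2, h3, fun T => (h4 T).trans (pow_le_pow_left₀ h0 hκ _)⟩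

lemma spread_step_le {r j : ℕ} (hr : 1 ≤ r) {K₀ c : ℝ} (hK : 0 ≤ K₀) (hc : c = 2 + 4 * r) :
    K₀ * Real.exp (-(3 * c * (3 / 4 : ℝ) ^ j)) / 2 ^ (j * (r - 1)) *
      (2 * ((1 + 4 * (3 / 4 : ℝ) ^ (j + 1)) / 2) ^ r * (1 + 2 * (3 / 4 : ℝ) ^ (j + 1))) ≤
    K₀ * Real.exp (-(3 * c * (3 / 4 : ℝ) ^ (j + 1))) / 2 ^ ((j + 1) * (r - 1)) := by
  set x := (3 / 4 : ℝ) ^ (j + 1) with hx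
  have hx0 : 0 < x := by positivity
  have hxj : (3 / 4 : ℝ) ^ j = 4 / 3 * x := by rw [hx, pow_succ]; ring
  have h1 : (1 + 4 * x) ^ r * (1 + 2 * x) ≤ Real.exp (c * x) := by
    have e1 : 1 + 4 * x ≤ Real.exp (4 * x) := by linarith [Real.add_one_le_exp (4 * x)]
    have e2 : 1 + 2 * x ≤ Real.exp (2 * x) := by linarith [Real.add_one_le_exp (2 * x)]
    calc (1 + 4 * x) ^ r * (1 + 2 * x) ≤ Real.exp (4 * x) ^ r * Real.exp (2 * x) := by gcongr
      _ = Real.exp (c * x) := by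
        rw [← Real.exp_nat_mul, ← Real.exp_add, hc]
        congr 1
        ring
  obtain ⟨q, rfl⟩ : ∃ q, r = q + 1 := ⟨r - 1, by omega⟩
  rw [Nat.add_sub_cancel, hxj]
  have h2 : K₀ * Real.exp (-(3 * c * (4 / 3 * x))) / 2 ^ (j * q) *
      (2 * ((1 + 4 * x) / 2) ^ (q + 1) * (1 + 2 * x)) =
      K₀ * Real.exp (-(3 * c * (4 / 3 * x))) * ((1 + 4 * x) ^ (q + 1) * (1 + 2 * x)) /
        2 ^ ((j + 1) * q) := by
    rw [div_pow, pow_succ 2 q, add_mul, one_mul, pow_add]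
    field_simp
    ring
  rw [h2]
  have h3 : Real.exp (-(3 * c * x)) = Real.exp (-(3 * c * (4 / 3 * x))) * Real.exp (c * x) := by
    rw [← Real.exp_add]
    congr 1
    ring
  rw [h3, ← mul_assoc]
  refine div_le_div_of_nonneg_right ?_ (by positivity)
  rw [mul_assoc _ _ (1 + 2 * x), ← mul_assoc K₀]
  exact mul_le_mul_of_nonneg_left h1 (by positivity)

end Iteration

/-- If every dense enough pair contains a perfect packing, then every slightly denser large pair
carries a spread measure on perfect packings. -/
theorem exists_hasSpread_of_degCond {s t k d ℓ : ℕ} {F : Finset (Finset (Fin s))} (hs : 1 ≤ s)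
    (ht : 1 ≤ t) (hFt : F.card = t) (hkd : k = d + ℓ) (hℓ : 1 ≤ ℓ) {γ₀ γ : ℝ} (hγ₀ : 0 ≤ γ₀)
    (hγ : γ₀ < γ) (N₀ : ℕ)
    (hbase : ∀ m : ℕ, N₀ ≤ m → ∀ (I V : Type) [DecidableEq I] [DecidableEq V]
      (H : I → Finset (Finset V)), (∀ i, ∀ e ∈ H i, e.card = k) → ∀ (A : Finset V) (B : Finset I),
      A.card = s * m → B.card = t * m → DegCond H d ℓ γ₀ A B →
      ∃ S : Finset (RainbowCopy F I V), IsPacking H A B S ∧ S.card = m) :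
    ∃ K : ℝ, 0 ≤ K ∧ ∃ N : ℕ, ∀ m : ℕ, N ≤ m → ∀ (I V : Type) [DecidableEq I] [DecidableEq V]
      [Fintype I] [Fintype V] (H : I → Finset (Finset V)), (∀ i, ∀ e ∈ H i, e.card = k) →
      ∀ (A : Finset V) (B : Finset I), A.card = s * m → B.card = t * m → DegCond H d ℓ γ A B →
      HasSpread F H A B m (K * (m : ℝ) ^ (-(s + t - 1 : ℝ))) := by
  have hρ := tendsto_pow_atTop_nhds_zero_of_lt_one (show (0 : ℝ) ≤ 3 / 4 by norm_num)
    (show (3 / 4 : ℝ) < 1 by norm_num)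
  have h2 := (tendsto_pow_atTop_atTop_of_one_lt (show 1 < 2 by norm_num))
  have hγp : 0 < γ := hγ₀.trans_lt hγ
  set a : ℝ := 3 * 2 ^ ℓ * (1 + γ) with ha
  have ha0 : 0 < a := by positivity
  obtain ⟨j₀, hj₀⟩ := Filter.eventually_atTop.1 ((eventually_choose_le s hs).and
    ((eventually_choose_le t ht).and ((eventually_deviation_le s t d hs).and
    ((hρ.eventually (ge_mem_nhds (show (0 : ℝ) < 1 / 2 by norm_num))).and
    ((hρ.eventually (ge_mem_nhds (show (0 : ℝ) < (γ - γ₀) / a from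
      div_pos (sub_pos.2 hγ) ha0))).and (h2.eventually_ge_atTop N₀))))))
  set c : ℝ := 2 + 4 * ((s + t : ℕ) : ℝ) with hc
  have hc0 : 0 < c := by positivity
  set r := s + t with hr
  set K₀ : ℝ := Real.exp (3 * c * (3 / 4) ^ j₀) * 2 ^ (j₀ * (r - 1)) with hK₀
  have hK₀0 : 0 < K₀ := by positivity
  set κ : ℕ → ℝ := fun j => K₀ * Real.exp (-(3 * c * (3 / 4 : ℝ) ^ j)) / 2 ^ (j * (r - 1)) with hκ
  have hκ0 : ∀ j, 0 < κ j := fun j => by positivity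
  set g : ℕ → ℝ := fun j => γ - a * (3 / 4) ^ j with hg
  have hgle : ∀ j, g j ≤ γ := fun j => sub_le_self _ (by positivity)
  have hgge : ∀ j, j₀ ≤ j → γ₀ ≤ g j := by
    intro j hj
    have := (hj₀ j hj).2.2.2.2.1
    rw [le_div_iff₀ ha0] at this
    simp only [hg]
    linarith
  have main : ∀ (I V : Type) [DecidableEq I] [DecidableEq V] [Fintype I] [Fintype V]
      (H : I → Finset (Finset V)), (∀ i, ∀ e ∈ H i, e.card = k) → ∀ j, j₀ ≤ j →
      ∀ m, 2 ^ j ≤ m → m ≤ 2 ^ (j + 1) →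
      ∀ (A : Finset V) (B : Finset I), A.card = s * m → B.card = t * m →
      DegCond H d ℓ (g j) A B → HasSpread F H A B m (κ j) := by
    intro I V _ _ _ _ H hH j hj
    induction j, hj using Nat.le_induction with
    | base =>
      intro m hm1 hm2 A B hA hB hdeg
      obtain ⟨S, hS, hSm⟩ := hbase m ((hj₀ j₀ le_rfl).2.2.2.2.2.trans hm1) I V H hH A B hA hB
        (hdeg.mono (hgge j₀ le_rfl))
      refine HasSpread.of_isPacking hS hSm (le_of_eq ?_)
      simp only [hκ, hK₀, Real.exp_neg]
      field_simp
    | succ j hj ih =>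
      intro m hm1 hm2 A B hA hB hdeg
      obtain ⟨e1, e2, e3, e4, -, -⟩ := hj₀ (j + 1) (by omega)
      have hm : 1 ≤ m := le_trans Nat.one_le_two_pow hm1
      have hp1 : 2 ^ (j + 1) = 2 * 2 ^ j := by ring
      have hp2 : 2 ^ (j + 1 + 1) = 2 * (2 * 2 ^ j) := by ring
      have hpx : (3 / 4 : ℝ) ^ (j + 1) = 3 / 4 * (3 / 4) ^ j := by ring
      refine HasSpread.of_halves (k := k) (d := d) (ℓ := ℓ) (g := g (j + 1)) (g' := g j) (G := γ)
        (κ := κ j) hs ht hFt hkd hℓ hm (x := (3 / 4 : ℝ) ^ (j + 1)) (by positivity) e4 ?_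
        (fun u₁ u₂ => e1 m u₁ u₂ hm1 hm2) (fun u₁ u₂ => e2 m u₁ u₂ hm1 hm2) (e3 m hm1 hm2)
        (hγ₀.trans (hgge j hj)) (hgle j) ?_ (hκ0 j).le ?_ hH hA hB hdeg ?_
      · have : ((2 : ℝ)) ^ (j + 1) ≤ m := by exact_mod_cast hm1
        calc (1 : ℝ) ≤ (3 / 4 * 2) ^ (j + 1) := one_le_pow₀ (by norm_num)
          _ = (3 / 4) ^ (j + 1) * 2 ^ (j + 1) := mul_pow _ _ _
          _ ≤ _ := by gcongr
      · simp only [hg, ha, hpx]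
        apply le_of_eq
        ring
      · exact spread_step_le (by omega) hK₀0.le hc
      · intro m' hm' A' B' hA' hB' hd'
        exact ih m' (by omega) (by omega) A' B' hA' hB' hd'
  refine ⟨K₀ * 2 ^ (r - 1), by positivity, 2 ^ j₀, ?_⟩
  intro m hm I V _ _ _ _ H hH A B hA hB hdeg
  have hm0 : m ≠ 0 := (lt_of_lt_of_le (by positivity) hm).ne'
  have hj : j₀ ≤ Nat.log 2 m := (Nat.le_log_iff_pow_le (by norm_num) hm0).2 hm
  have hm2 : m ≤ 2 ^ (Nat.log 2 m + 1) := (Nat.lt_pow_succ_log_self (by norm_num) m).le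
  refine (main I V H hH _ hj m (Nat.pow_log_le_self 2 hm0) hm2 A B hA hB
    (hdeg.mono (hgle _))).mono (hκ0 _).le ?_
  set j := Nat.log 2 m
  have hmpos : (0 : ℝ) < m := by positivity
  have hexp : (-(s + t - 1 : ℝ)) = -((r - 1 : ℕ) : ℝ) := by
    rw [Nat.cast_sub (by omega), hr]
    push_cast
    ring
  rw [hexp, Real.rpow_neg hmpos.le, Real.rpow_natCast, ← div_eq_mul_inv, div_le_div_iff₀
    (by positivity) (by positivity)]
  have h3 : (m : ℝ) ^ (r - 1) ≤ 2 ^ (r - 1) * 2 ^ (j * (r - 1)) := by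
    have : (m : ℝ) ≤ 2 * 2 ^ j := by
      have : (m : ℝ) ≤ 2 ^ (j + 1) := by exact_mod_cast hm2
      rwa [pow_succ, mul_comm] at this
    calc (m : ℝ) ^ (r - 1) ≤ (2 * 2 ^ j) ^ (r - 1) := by gcongr
      _ = _ := by rw [mul_pow, pow_mul]
  have h4 : Real.exp (-(3 * c * (3 / 4 : ℝ) ^ j)) ≤ 1 := by
    rw [Real.exp_le_one_iff, neg_nonpos]
    positivity
  calc K₀ * Real.exp (-(3 * c * (3 / 4 : ℝ) ^ j)) * (m : ℝ) ^ (r - 1)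
      ≤ K₀ * 1 * (2 ^ (r - 1) * 2 ^ (j * (r - 1))) := by gcongr
    _ = _ := by ring

section Threshold

lemma exists_choose_lower_bound (s k d : ℕ) (hs : 1 ≤ s) {ℓ : ℕ} (hkd : k = d + ℓ) (hℓ : 1 ≤ ℓ)
    {a b : ℝ} (ha : 0 ≤ a) (hab : a < b) : ∃ n₀ : ℕ, ∀ n : ℕ, n₀ ≤ n →
    a / ℓ.factorial * ((s * n : ℕ) : ℝ) ^ ℓ ≤ b * ((s * n - d).choose ℓ : ℝ) := by
  have hb : 0 < b := ha.trans_lt hab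
  have hη : 0 < (b - a) / b := div_pos (sub_pos.2 hab) hb
  refine ⟨max k ⌈ℓ * k / ((b - a) / b)⌉₊, fun n hn => ?_⟩
  have hn1 : k ≤ n := (le_max_left _ _).trans hn
  have hn2 : ℓ * k / ((b - a) / b) ≤ n := (Nat.le_ceil _).trans (by
    exact_mod_cast (le_max_right _ _).trans hn)
  have hnN : n ≤ s * n := Nat.le_mul_of_pos_left n hs
  set N := s * n
  have hk0 : 1 ≤ k := by omega
  have hN0 : (0 : ℝ) < N := by
    have : 0 < N := by omega
    exact_mod_cast this
  have hkN : (k : ℝ) ≤ N := by exact_mod_cast hn1.trans hnN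
  have h1 := Nat.pow_le_choose (α := ℝ) ℓ (N - d)
  have h2 : (N : ℝ) - k ≤ ((N - d + 1 - ℓ : ℕ) : ℝ) := by
    rw [← Nat.cast_sub (hn1.trans hnN)]
    exact_mod_cast (by omega : N - k ≤ N - d + 1 - ℓ)
  have h3 : 1 + (ℓ : ℝ) * (-(k / N)) ≤ (1 + -((k : ℝ) / N)) ^ ℓ := by
    refine one_add_mul_le_pow ?_ ℓ
    have : (k : ℝ) / N ≤ 1 := (div_le_one hN0).2 hkN
    linarith
  have h4 : (ℓ : ℝ) * (k / N) ≤ (b - a) / b := by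
    rw [div_le_iff₀ hη] at hn2
    rw [← mul_div_assoc, div_le_iff₀ hN0]
    have : (n : ℝ) ≤ N := by exact_mod_cast hnN
    nlinarith
  have h5 : a ≤ b * (1 + -((k : ℝ) / N)) ^ ℓ := by
    have : b * (1 - (b - a) / b) = a := by
      field_simp
      ring
    rw [← this]
    gcongr
    linarith
  have hf : (0 : ℝ) < ℓ.factorial := by positivity
  calc a / ℓ.factorial * (N : ℝ) ^ ℓ
      ≤ b * (1 + -((k : ℝ) / N)) ^ ℓ / ℓ.factorial * (N : ℝ) ^ ℓ := by gcongr
    _ = b * ((N - k : ℝ) ^ ℓ / ℓ.factorial) := by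
      have : (N - k : ℝ) = (1 + -((k : ℝ) / N)) * N := by field_simp; ring
      rw [this, mul_pow]
      ring
    _ ≤ b * ((((N - d + 1 - ℓ : ℕ) : ℝ) ^ ℓ) / ℓ.factorial) := by
      gcongr
    _ ≤ _ := by
      gcongr

lemma card_filter_superset_le {V : Type*} [Fintype V] [DecidableEq V] {k : ℕ}
    {H : Finset (Finset V)} (hH : ∀ e ∈ H, e.card = k) (D : Finset V) :
    (H.filter fun e => D ⊆ e).card ≤ (Fintype.card V - D.card).choose (k - D.card) := by
  rw [← Finset.card_compl, ← Finset.card_powersetCard]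
  refine Finset.card_le_card_of_injOn (fun e => e \ D) ?_ ?_
  · intro e he
    obtain ⟨he, hD⟩ := Finset.mem_filter.1 he
    refine Finset.mem_coe.2 (Finset.mem_powersetCard.2 ⟨fun x hx => ?_, ?_⟩)
    · exact Finset.mem_compl.2 (Finset.mem_sdiff.1 hx).2
    · rw [Finset.card_sdiff_of_subset hD, hH e he]
  · intro e he e' he' h
    obtain ⟨-, hD⟩ := Finset.mem_filter.1 he
    obtain ⟨-, hD'⟩ := Finset.mem_filter.1 he'
    rw [← Finset.sdiff_union_of_subset hD, ← Finset.sdiff_union_of_subset hD']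
    exact congrArg (· ∪ D) h

/-- No relative degree exceeds `1`, so the threshold is a genuine infimum. -/
lemma exists_lt_transversalDiracThreshold_add {k s t d : ℕ} (F : Finset (Finset (Fin s)))
    (hs : 1 ≤ s) (ht : 0 < t) (hk : 0 < k) (hd : d ≤ k) {β : ℝ} (hβ : 0 < β) :
    0 ≤ transversalDiracThreshold k s t d F ∧
    ∃ n₀ : ℕ, ∀ n : ℕ, n₀ ≤ n → ∀ Hs : Fin (t * n) → Finset (Finset (Fin (s * n))),
      (∀ i, ∀ e ∈ Hs i, e.card = k) →
      (∀ i (D : Finset (Fin (s * n))), D.card = d →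
        (transversalDiracThreshold k s t d F + β) * ((s * n - d).choose (k - d) : ℝ) ≤
          (((Hs i).filter fun e => D ⊆ e).card : ℝ)) →
      IsTransversalFFactor F Hs := by
  unfold transversalDiracThreshold
  set X := {δ : ℝ | 0 < δ ∧ ∀ α : ℝ, 0 < α → ∃ n₀ : ℕ, ∀ n : ℕ, n₀ ≤ n →
    ∀ Hs : Fin (t * n) → Finset (Finset (Fin (s * n))),
      (∀ i, ∀ e ∈ Hs i, e.card = k) →
      (∀ i (D : Finset (Fin (s * n))), D.card = d →
        (δ + α) * ((s * n - d).choose (k - d) : ℝ) ≤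
          (((Hs i).filter fun e => D ⊆ e).card : ℝ)) →
      IsTransversalFFactor F Hs} with hX
  have hne : X.Nonempty := by
    refine ⟨1, one_pos, fun α hα => ⟨k, fun n hn Hs hH hdeg => ?_⟩⟩
    exfalso
    have hnN : n ≤ s * n := Nat.le_mul_of_pos_left n hs
    obtain ⟨D, hD⟩ := Finset.exists_subset_card_eq (s := (Finset.univ : Finset (Fin (s * n))))
      (n := d) (by simpa using (by omega : d ≤ s * n))
    have i : Fin (t * n) := ⟨0, Nat.mul_pos ht (by omega)⟩
    have h1 := hdeg i D hD.2
    have h2 := card_filter_superset_le (hH i) D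
    rw [hD.2, Fintype.card_fin] at h2
    have h3 : 0 < (s * n - d).choose (k - d) := Nat.choose_pos (by omega)
    have h2' : (((Hs i).filter fun e => D ⊆ e).card : ℝ) ≤ (s * n - d).choose (k - d) := by
      exact_mod_cast h2
    have h3' : (0 : ℝ) < (s * n - d).choose (k - d) := by exact_mod_cast h3
    nlinarith
  refine ⟨Real.sInf_nonneg fun δ hδ => hδ.1.le, ?_⟩
  obtain ⟨δ, hδ, hlt⟩ := Real.lt_sInf_add_pos hne (half_pos hβ)
  obtain ⟨n₀, hn₀⟩ := hδ.2 (β / 2) (half_pos hβ)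
  refine ⟨n₀, fun n hn Hs hH hdeg => hn₀ n hn Hs hH fun i D hD => le_trans ?_ (hdeg i D hD)⟩
  exact mul_le_mul_of_nonneg_right (by linarith) (Nat.cast_nonneg _)

/-- A transversal factor in the system induced on `(A, B)` is a perfect packing of `(A, B)`. -/
lemma IsTransversalFFactor.exists_isPacking {s t m : ℕ} {F : Finset (Finset (Fin s))} (hs : 1 ≤ s)
    {I V : Type} [DecidableEq I] [DecidableEq V] {H : I → Finset (Finset V)} {A : Finset V}
    {B : Finset I} (f : Fin (s * m) ↪ V) (hf : ∀ x, f x ∈ A) (g : Fin (t * m) ↪ I)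
    (hg : ∀ x, g x ∈ B) {Hs : Fin (t * m) → Finset (Finset (Fin (s * m)))}
    (hHs : ∀ i, ∀ e ∈ Hs i, e.map f ∈ H (g i)) (h : IsTransversalFFactor F Hs) :
    ∃ S : Finset (RainbowCopy F I V), IsPacking H A B S ∧ S.card = m := by
  classical
  obtain ⟨φ, hφ, hdis, c, hc, hmem⟩ := h
  set E : Fin m → RainbowCopy F I V := fun j =>
    ((⟨φ j, hφ j⟩ : Fin s ↪ Fin (s * m)).trans f,
      (⟨fun e => c (j, e), fun e e' h => (Prod.mk.inj (hc.1 h)).2⟩ :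
        {e // e ∈ F} ↪ Fin (t * m)).trans g) with hE
  have hsep : ∀ j j', j ≠ j' → (E j).Separated (E j') := by
    intro j j' hjj
    constructor
    · refine Finset.disjoint_left.2 fun x hx hx' => ?_
      obtain ⟨a, -, rfl⟩ := Finset.mem_map.1 hx
      obtain ⟨b, -, hb⟩ := Finset.mem_map.1 hx'
      exact hdis j j' hjj a b (f.injective hb).symm
    · refine Finset.disjoint_left.2 fun x hx hx' => ?_
      obtain ⟨a, -, rfl⟩ := Finset.mem_map.1 hx
      obtain ⟨b, -, hb⟩ := Finset.mem_map.1 hx'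
      exact hjj (Prod.mk.inj (hc.1 (g.injective hb))).1.symm
  have hinj : Function.Injective E := by
    intro j j' h
    by_contra hne
    have h1 := (hsep j j' hne).1
    rw [← h, disjoint_self, Finset.bot_eq_empty, ← Finset.card_eq_zero,
      RainbowCopy.card_verts] at h1
    omega
  refine ⟨Finset.univ.image E, ⟨?_, ?_⟩, ?_⟩
  · intro E' hE'
    obtain ⟨j, -, rfl⟩ := Finset.mem_image.1 hE'
    refine ⟨⟨?_, ?_⟩, fun e => ?_⟩
    · intro x hx
      obtain ⟨a, -, rfl⟩ := Finset.mem_map.1 hx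
      exact hf _
    · intro x hx
      obtain ⟨a, -, rfl⟩ := Finset.mem_map.1 hx
      exact hg _
    · have := hHs _ _ (hmem j e)
      rw [Finset.map_eq_image, Finset.image_image] at this
      exact this
  · intro E₁ h₁ E₂ h₂ hne
    obtain ⟨j, -, rfl⟩ := Finset.mem_image.1 (Finset.mem_coe.1 h₁)
    obtain ⟨j', -, rfl⟩ := Finset.mem_image.1 (Finset.mem_coe.1 h₂)
    exact hsep j j' fun h => hne (h ▸ rfl)
  · rw [Finset.card_image_of_injective _ hinj, Finset.card_univ, Fintype.card_fin]

lemma exists_isPacking_of_degCond {k s t d ℓ : ℕ} (F : Finset (Finset (Fin s)))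
    (hs : 1 ≤ s) (ht : 0 < t) (hkd : k = d + ℓ) (hℓ : 1 ≤ ℓ) {β : ℝ} (hβ : 0 < β) :
    ∃ N₀ : ℕ, ∀ m : ℕ, N₀ ≤ m → ∀ (I V : Type) [DecidableEq I] [DecidableEq V]
      (H : I → Finset (Finset V)), (∀ i, ∀ e ∈ H i, e.card = k) → ∀ (A : Finset V) (B : Finset I),
      A.card = s * m → B.card = t * m →
      DegCond H d ℓ ((transversalDiracThreshold k s t d F + β) / ℓ.factorial) A B →
      ∃ S : Finset (RainbowCopy F I V), IsPacking H A B S ∧ S.card = m := by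
  classical
  obtain ⟨hT, n₀, hn₀⟩ := exists_lt_transversalDiracThreshold_add F hs ht (k := k) (d := d)
    (by omega) (by omega) hβ
  refine ⟨n₀, fun m hm I V _ _ H hH A B hA hB hdeg => ?_⟩
  set f : Fin (s * m) ↪ V := (A.equivFinOfCardEq hA).symm.toEmbedding.trans
    (Function.Embedding.subtype _) with hf
  set g : Fin (t * m) ↪ I := (B.equivFinOfCardEq hB).symm.toEmbedding.trans
    (Function.Embedding.subtype _) with hg
  have hfA : ∀ x, f x ∈ A := fun x => ((A.equivFinOfCardEq hA).symm x).2
  have hgB : ∀ x, g x ∈ B := fun x => ((B.equivFinOfCardEq hB).symm x).2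
  have hAf : Finset.univ.map f = A := by
    refine Finset.eq_of_subset_of_card_le (fun x hx => ?_) ?_
    · obtain ⟨a, -, rfl⟩ := Finset.mem_map.1 hx
      exact hfA a
    · rw [Finset.card_map, Finset.card_univ, Fintype.card_fin, hA]
  set Hs : Fin (t * m) → Finset (Finset (Fin (s * m))) := fun i =>
    Finset.univ.filter fun e => e.map f ∈ H (g i) with hHs
  have hmem : ∀ i e, e ∈ Hs i ↔ e.map f ∈ H (g i) := fun i e => by simp [hHs]
  refine IsTransversalFFactor.exists_isPacking hs f hfA g hgB (fun i e he => (hmem i e).1 he)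
    (hn₀ m hm Hs (fun i e he => ?_) fun i D hD => ?_)
  · rw [← Finset.card_map f, hH _ _ ((hmem i e).1 he)]
  · have h1 := hdeg (g i) (hgB i) (D.map f)
      (fun x hx => by obtain ⟨a, -, rfl⟩ := Finset.mem_map.1 hx; exact hfA a)
      (by rw [Finset.card_map, hD])
    have h2 : ((H (g i)).filter fun e => D.map f ⊆ e ∧ e ⊆ A).card ≤
        ((Hs i).filter fun e => D ⊆ e).card := by
      rw [← Finset.card_map (Finset.mapEmbedding f).toEmbedding]
      refine Finset.card_le_card fun e he => ?_
      obtain ⟨he, hDe, heA⟩ := Finset.mem_filter.1 he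
      rw [← hAf] at heA
      obtain ⟨u, -, rfl⟩ := Finset.subset_map_iff.1 heA
      refine Finset.mem_map.2 ⟨u, Finset.mem_filter.2 ⟨(hmem i u).2 he, ?_⟩, rfl⟩
      exact Finset.map_subset_map.1 hDe
    refine le_trans ?_ (h1.trans (Nat.cast_le.2 h2))
    have h3 : ((s * m - d).choose ℓ : ℝ) ≤ ((s * m : ℕ) : ℝ) ^ ℓ / ℓ.factorial := by
      refine (Nat.choose_le_pow_div (α := ℝ) ℓ (s * m - d)).trans ?_
      gcongr
      exact Nat.sub_le _ _
    have hℓk : k - d = ℓ := by omega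
    rw [hA, hℓk, div_mul_eq_mul_div, mul_div_assoc]
    gcongr

/-- Systems above the Dirac threshold carry a well-spread measure on transversal factors. -/
theorem exists_hasSpread_of_threshold {k s t d : ℕ} (F : Finset (Finset (Fin s)))
    (hs : 1 ≤ s) (ht : 0 < t) (hFt : F.card = t) (hd : d < k) {α : ℝ} (hα : 0 < α) :
    ∃ K : ℝ, 0 ≤ K ∧ ∃ N : ℕ, ∀ n : ℕ, N ≤ n →
      ∀ Hs : Fin (t * n) → Finset (Finset (Fin (s * n))),
      (∀ i, ∀ e ∈ Hs i, e.card = k) →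
      (∀ i (D : Finset (Fin (s * n))), D.card = d →
        (transversalDiracThreshold k s t d F + α) * ((s * n - d).choose (k - d) : ℝ) ≤
          (((Hs i).filter fun e => D ⊆ e).card : ℝ)) →
      HasSpread F Hs Finset.univ Finset.univ n (K * (n : ℝ) ^ (-(s + t - 1 : ℝ))) := by
  obtain ⟨ℓ, hkd⟩ : ∃ ℓ, k = d + ℓ := ⟨k - d, by omega⟩
  have hℓ : 1 ≤ ℓ := by omega
  have hT := (exists_lt_transversalDiracThreshold_add F hs ht (k := k) (d := d)
    (by omega) (by omega) hα).1
  set δ := transversalDiracThreshold k s t d F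
  obtain ⟨N₀, hN₀⟩ := exists_isPacking_of_degCond F hs ht hkd hℓ (show 0 < α / 4 by positivity)
  have hf : (0 : ℝ) < ℓ.factorial := by positivity
  obtain ⟨K, hK, N, hN⟩ := exists_hasSpread_of_degCond hs ht hFt hkd hℓ
    (γ₀ := (δ + α / 4) / ℓ.factorial) (γ := (δ + α / 2) / ℓ.factorial) (by positivity)
    (by gcongr; linarith) N₀ hN₀
  obtain ⟨n₀, hn₀⟩ := exists_choose_lower_bound s k d hs hkd hℓ (a := δ + α / 2) (b := δ + α)
    (by positivity) (by linarith)
  refine ⟨K, hK, max N n₀, fun n hn Hs hH hdeg => hN n ((le_max_left _ _).trans hn) _ _ Hs hH _ _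
    (by simp) (by simp) fun i _ D _ hD => ?_⟩
  have hℓk : k - d = ℓ := by omega
  have h1 := hdeg i D hD
  rw [hℓk] at h1
  simp only [Finset.subset_univ, and_true]
  rw [Finset.card_univ, Fintype.card_fin]
  exact (hn₀ n ((le_max_right _ _).trans hn)).trans h1

end Threshold

section Sparsification

/-- The coloured edges of a system. -/
def systemEdges {M N : ℕ} (σ : Fin M → Finset (Finset (Fin N))) :
    Finset (Fin M × Finset (Fin N)) :=
  (Finset.univ.sigma σ).map (Equiv.sigmaEquivProd _ _).toEmbedding

lemma mem_systemEdges {M N : ℕ} {σ : Fin M → Finset (Finset (Fin N))}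
    {x : Fin M × Finset (Fin N)} : x ∈ systemEdges σ ↔ x.2 ∈ σ x.1 := by
  obtain ⟨i, e⟩ := x
  simp [systemEdges]

lemma card_systemEdges {M N : ℕ} (σ : Fin M → Finset (Finset (Fin N))) :
    (systemEdges σ).card = ∑ i, (σ i).card := by
  rw [systemEdges, Finset.card_map, Finset.card_sigma]

open Classical in
lemma sysSparsProb_eq_sum_subsetWeight {M N : ℕ} (Hs : Fin M → Finset (Finset (Fin N))) (p : ℝ)
    (Q : (Fin M → Finset (Finset (Fin N))) → Prop) :
    sysSparsProb Hs p Q = ∑ G ∈ (systemEdges Hs).powerset, subsetWeight p (systemEdges Hs) G *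
      (if Q (fun i => (Hs i).filter fun e => (i, e) ∈ G) then 1 else 0) := by
  rw [sysSparsProb]
  have hfib : ∀ σ ∈ Fintype.piFinset (fun i => (Hs i).powerset),
      (fun i => (Hs i).filter fun e => (i, e) ∈ systemEdges σ) = σ := by
    intro σ hσ
    funext i
    ext e
    have := Finset.mem_powerset.1 (Fintype.mem_piFinset.1 hσ i)
    rw [Finset.mem_filter, mem_systemEdges]
    exact ⟨fun h => h.2, fun h => ⟨this h, h⟩⟩
  refine Finset.sum_nbij' systemEdges (fun G i => (Hs i).filter fun e => (i, e) ∈ G) ?_ ?_ hfib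
    ?_ ?_
  · intro σ hσ
    refine Finset.mem_powerset.2 fun x hx => mem_systemEdges.2 ?_
    exact Finset.mem_powerset.1 (Fintype.mem_piFinset.1 hσ x.1) (mem_systemEdges.1 hx)
  · intro G _
    exact Fintype.mem_piFinset.2 fun i => Finset.mem_powerset.2 (Finset.filter_subset _ _)
  · intro G hG
    ext ⟨i, e⟩
    rw [mem_systemEdges, Finset.mem_filter]
    exact ⟨fun h => h.2, fun h => ⟨mem_systemEdges.1 (Finset.mem_powerset.1 hG h), h⟩⟩
  · intro σ hσ
    have hle : ∀ i, (σ i).card ≤ (Hs i).card := fun i =>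
      Finset.card_le_card (Finset.mem_powerset.1 (Fintype.mem_piFinset.1 hσ i))
    rw [hfib σ hσ, mul_ite, mul_one, mul_zero]
    congr 1
    rw [subsetWeight, card_systemEdges, card_systemEdges, ← Finset.sum_tsub_distrib _
      (fun i _ => hle i), Finset.prod_mul_distrib, Finset.prod_pow_eq_pow_sum,
      Finset.prod_pow_eq_pow_sum]

lemma IsPacking.isTransversalFFactor {s t n : ℕ} {F : Finset (Finset (Fin s))} (hFt : F.card = t)
    {Hs Hs' : Fin (t * n) → Finset (Finset (Fin (s * n)))}
    {S : Finset (RainbowCopy F (Fin (t * n)) (Fin (s * n)))}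
    (hS : IsPacking Hs Finset.univ Finset.univ S) (hSn : S.card = n)
    (h : ∀ E ∈ S, ∀ e, e.1.image E.1 ∈ Hs' (E.2 e)) : IsTransversalFFactor F Hs' := by
  set u := (S.equivFinOfCardEq hSn).symm
  have hsep : ∀ j j', j ≠ j' → (u j).1.Separated (u j').1 := fun j j' hjj =>
    hS.2 (u j).2 (u j').2 fun h => hjj (u.injective (Subtype.ext h))
  refine ⟨fun j => (u j).1.1, fun j => (u j).1.1.injective, fun j j' hjj a b hab => ?_,
    fun x => (u x.1).1.2 x.2, ?_, fun j e => h _ (u j).2 e⟩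
  · exact Finset.disjoint_left.1 (hsep j j' hjj).1
      (Finset.mem_map_of_mem _ (Finset.mem_univ a))
      (Finset.mem_map.2 ⟨b, Finset.mem_univ b, hab.symm⟩)
  · rw [Fintype.bijective_iff_injective_and_card]
    refine ⟨fun x y hxy => ?_, ?_⟩
    · have h1 : x.1 = y.1 := by
        by_contra hne
        exact Finset.disjoint_left.1 (hsep _ _ hne).2
          (Finset.mem_map_of_mem _ (Finset.mem_univ x.2))
          (Finset.mem_map.2 ⟨y.2, Finset.mem_univ y.2, hxy.symm⟩)
      obtain ⟨j, e⟩ := x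
      obtain ⟨j', e'⟩ := y
      obtain rfl : j = j' := h1
      exact Prod.ext rfl ((u j).1.2.injective hxy)
    · simp [hFt, mul_comm]

lemma exists_const_sysSparsProb {k s t d : ℕ} {α : ℝ} (hα : 0 < α) (hs : 2 ≤ s) (ht : 0 < t)
    (hd : 1 ≤ d) (hdk : d ≤ k - 1) {F : Finset (Finset (Fin s))} (hFk : ∀ e ∈ F, e.card = k)
    (hFt : F.card = t) (hF : StrictlyOneBalanced F) :
    ∃ C₀ : ℝ, 1 ≤ C₀ ∧ ∀ C : ℝ, C₀ ≤ C → ∀ ε : ℝ, 0 < ε →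
      ∃ n₀ : ℕ, ∀ n : ℕ, n₀ ≤ n →
      ∀ Hs : Fin (t * n) → Finset (Finset (Fin (s * n))),
        (∀ i, ∀ e ∈ Hs i, e.card = k) →
        (∀ i (D : Finset (Fin (s * n))), D.card = d →
          (transversalDiracThreshold k s t d F + α) * ((s * n - d).choose (k - d) : ℝ) ≤
            (((Hs i).filter fun e => D ⊆ e).card : ℝ)) →
      ∀ p : ℝ, 0 ≤ p → p ≤ 1 →
        C * (n : ℝ) ^ (-(1 / oneDensity F) - 1) * (Real.log n) ^ ((1 : ℝ) / t) ≤ p →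
        1 - ε ≤ sysSparsProb Hs p (fun σ => IsTransversalFFactor F σ) := by
  classical
  obtain ⟨K, hK, N, hN⟩ := exists_hasSpread_of_threshold F (by omega) ht hFt
    (by omega : d < k) hα
  obtain ⟨C₀, hC₀, h⟩ := exists_const_prob_covers hF (k := k) (by omega) hFk hs hFt ht K hK
  refine ⟨C₀, hC₀, fun C hC ε hε => ?_⟩
  obtain ⟨n₀, hn₀⟩ := h C hC ε hε
  refine ⟨max N n₀, fun n hn Hs hH hdeg p hp0 hp1 hp => ?_⟩
  obtain ⟨μ, hμ0, hμ1, hμS, hμT⟩ := hN n ((le_max_left _ _).trans hn) Hs hH hdeg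
  have hexp : -(1 / oneDensity F) - 1 = -((s - 1 : ℝ) / t) - 1 := by
    rw [oneDensity, hFt, Fintype.card_fin, one_div_div]
  rw [hexp] at hp
  set p₀ := C * (n : ℝ) ^ (-((s - 1 : ℝ) / t) - 1) * (Real.log n) ^ ((1 : ℝ) / t) with hp₀
  have hp₀0 : 0 ≤ p₀ := by
    have : 0 ≤ Real.log n := Real.log_natCast_nonneg n
    have : 0 ≤ C := by linarith
    positivity
  set 𝓕 : Finset (Finset (RainbowCopy F (Fin (t * n)) (Fin (s * n)))) :=
    Finset.univ.filter fun S => IsPacking Hs Finset.univ Finset.univ S ∧ S.card = n with h𝓕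
  have hmain := hn₀ n ((le_max_right _ _).trans hn) p₀ rfl (hp.trans hp1) (systemEdges Hs) 𝓕 μ hμ0
    ?_ ?_ ?_ ?_
  · refine hmain.trans ((sum_subsetWeight_mono hp₀0 hp hp1 _ _ ?_).trans ?_)
    · intro G G' hG
      dsimp only
      split_ifs with h1 h2
      · exact le_rfl
      · obtain ⟨S, hS, hE⟩ := h1
        exact absurd ⟨S, hS, fun E hES => (hE E hES).trans hG⟩ h2
      · exact zero_le_one
      · exact le_rfl
    · rw [sysSparsProb_eq_sum_subsetWeight]
      refine Finset.sum_le_sum fun G hG => mul_le_mul_of_nonneg_left ?_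
        (subsetWeight_nonneg hp0 hp1 _ _)
      split_ifs with h1 h2
      · exact le_rfl
      · obtain ⟨S, hS, hE⟩ := h1
        obtain ⟨-, hS, hSn⟩ := Finset.mem_filter.1 hS
        refine absurd (hS.isTransversalFFactor hFt hSn fun E hES e => ?_) h2
        rw [Finset.mem_filter]
        exact ⟨(hS.1 E hES).2 e, hE E hES (Finset.mem_image.2 ⟨e, Finset.mem_univ _, rfl⟩)⟩
      · exact zero_le_one
      · exact le_rfl
  · rw [h𝓕, Finset.sum_filter_of_ne fun S _ hS => hμS S hS, hμ1]
  · intro S hS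
    exact (Finset.mem_filter.1 hS).2.2.le
  · intro S hS E hE x hx
    obtain ⟨e, -, rfl⟩ := Finset.mem_image.1 hx
    exact mem_systemEdges.2 (((Finset.mem_filter.1 hS).2.1.1 E hE).2 e)
  · intro T
    refine le_trans (Finset.sum_le_sum_of_subset_of_nonneg (Finset.subset_univ _) fun S _ _ => ?_)
      (hμT T)
    split_ifs
    · exact hμ0 S
    · exact le_rfl

end Sparsification

theorem transversal_factor_robustness
    (α : ℝ) (hα : 0 < α) (k s t : ℕ) (hk : 0 < k) (hs : 2 ≤ s) (ht : 0 < t) :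
    ∃ C : ℝ, 0 < C ∧
      ∀ d : ℕ, 1 ≤ d → d ≤ k - 1 →
      ∀ F : Finset (Finset (Fin s)),
        (∀ e ∈ F, e.card = k) → F.card = t → StrictlyOneBalanced F →
      ∀ ε : ℝ, 0 < ε →
      ∃ n₀ : ℕ, ∀ n : ℕ, n₀ ≤ n →
      ∀ Hs : Fin (t * n) → Finset (Finset (Fin (s * n))),
        (∀ i, ∀ e ∈ Hs i, e.card = k) →
        (∀ i (D : Finset (Fin (s * n))), D.card = d →
          (transversalDiracThreshold k s t d F + α) * ((s * n - d).choose (k - d) : ℝ) ≤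
            (((Hs i).filter fun e => D ⊆ e).card : ℝ)) →
      ∀ p : ℝ, 0 ≤ p → p ≤ 1 →
        C * (n : ℝ) ^ (-(1 / oneDensity F) - 1) * (Real.log n) ^ ((1 : ℝ) / t) ≤ p →
        1 - ε ≤ sysSparsProb Hs p (fun σ => IsTransversalFFactor F σ) := by
  classical
  have h : ∀ (d : ℕ) (F : Finset (Finset (Fin s))), ∃ C₀ : ℝ, 1 ≤ C₀ ∧ ∀ C : ℝ, C₀ ≤ C →
      1 ≤ d → d ≤ k - 1 → (∀ e ∈ F, e.card = k) → F.card = t → StrictlyOneBalanced F →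
      ∀ ε : ℝ, 0 < ε →
      ∃ n₀ : ℕ, ∀ n : ℕ, n₀ ≤ n →
      ∀ Hs : Fin (t * n) → Finset (Finset (Fin (s * n))),
        (∀ i, ∀ e ∈ Hs i, e.card = k) →
        (∀ i (D : Finset (Fin (s * n))), D.card = d →
          (transversalDiracThreshold k s t d F + α) * ((s * n - d).choose (k - d) : ℝ) ≤
            (((Hs i).filter fun e => D ⊆ e).card : ℝ)) →
      ∀ p : ℝ, 0 ≤ p → p ≤ 1 →
        C * (n : ℝ) ^ (-(1 / oneDensity F) - 1) * (Real.log n) ^ ((1 : ℝ) / t) ≤ p →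
        1 - ε ≤ sysSparsProb Hs p (fun σ => IsTransversalFFactor F σ) := by
    intro d F
    by_cases hdF : 1 ≤ d ∧ d ≤ k - 1 ∧ (∀ e ∈ F, e.card = k) ∧ F.card = t ∧ StrictlyOneBalanced F
    · obtain ⟨h1, h2, h3, h4, h5⟩ := hdF
      obtain ⟨C₀, hC₀, h⟩ := exists_const_sysSparsProb hα hs ht h1 h2 h3 h4 h5
      exact ⟨C₀, hC₀, fun C hC _ _ _ _ _ => h C hC⟩
    · exact ⟨1, le_rfl, fun C _ h1 h2 h3 h4 h5 => absurd ⟨h1, h2, h3, h4, h5⟩ hdF⟩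
  choose C₀ hC₀ h using h
  refine ⟨1 + ∑ x ∈ Finset.range k ×ˢ (Finset.univ : Finset (Finset (Finset (Fin s)))),
    C₀ x.1 x.2, ?_, fun d hd hdk F hFk hFt hF => h d F _ ?_ hd hdk hFk hFt hF⟩
  · have : 0 ≤ ∑ x ∈ Finset.range k ×ˢ (Finset.univ : Finset (Finset (Finset (Fin s)))),
        C₀ x.1 x.2 := Finset.sum_nonneg fun x _ => zero_le_one.trans (hC₀ _ _)
    linarith
  · have := Finset.single_le_sum
      (s := Finset.range k ×ˢ (Finset.univ : Finset (Finset (Finset (Fin s)))))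
      (f := fun x => C₀ x.1 x.2) (fun x _ => zero_le_one.trans (hC₀ x.1 x.2))
      (a := (d, F)) (Finset.mem_product.2 ⟨Finset.mem_range.2 (by omega), Finset.mem_univ _⟩)
    simp only at this
    linarith
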